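/- arXiv:2605.08859 — 9 statements merged into one kernel-verified Lean document; each statement's English description precedes it below -/
import Mathlib

section
/- There exist a real number α > 11/40 and a natural number n_α such that for every integer n ≥ n_α, every finite set M of items, and every family v_1, …, v_n of XOS valuations on M, there exists a partition of M into n pairwise disjoint (possibly empty) parts P_1, …, P_n with union M such that v_i(P_i) ≥ α · APS(M, v_i, 1/n) for every agent i ∈ {1, …, n}. -/
open Finset

/-- `v` is an XOS valuation on the finite set `M`: there is a nonempty finite family of
nonnegative additive functions whose pointwise maximum gives `v` on all subsets of `M`. -/
def IsXOS {ι : Type} (M : Finset ι) (v : Finset ι → ℝ) : Prop :=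
  ∃ (t : ℕ) (a : Fin (t + 1) → ι → ℝ),
    (∀ j, ∀ e ∈ M, 0 ≤ a j e) ∧
    ∀ S ⊆ M, v S = Finset.univ.sup' Finset.univ_nonempty (fun j => ∑ e ∈ S, a j e)

/-- Anyprice share of valuation `v` over the finite set `M` with entitlement `b`:
the supremum, over all fractional `b`-partitions `lam` of `M`, of the minimum value of a
bundle with positive weight. -/
noncomputable def APS {ι : Type} [DecidableEq ι] (M : Finset ι) (v : Finset ι → ℝ)
    (b : ℝ) : ℝ :=
  sSup { x | ∃ lam : Finset ι → ℝ,
    (∀ B ∈ M.powerset, 0 ≤ lam B) ∧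
    (∑ B ∈ M.powerset, lam B) = 1 ∧
    (∀ e ∈ M, (∑ B ∈ M.powerset.filter (fun B => e ∈ B), lam B) ≤ b) ∧
    x = sInf { y | ∃ B ∈ M.powerset, 0 < lam B ∧ y = v B } }

namespace APSX

/-- Fractional packing of a bundle by sub-bundles of value at least `β`. -/
theorem pack {ι : Type} [DecidableEq ι] (S : Finset ι) (a : ι → ℝ) (β : ℝ) (hβ : 0 < β)
    (ha : ∀ e ∈ S, 0 ≤ a e) (hs : ∀ e ∈ S, a e < β) (hx : ∑ e ∈ S, a e ≤ 11/3*β) :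
    ∃ w : Finset ι → ℝ, (∀ C, 0 ≤ w C) ∧ (∀ C, w C ≠ 0 → C ⊆ S ∧ β ≤ ∑ e ∈ C, a e) ∧
      (∀ e, ∑ C ∈ S.powerset, (if e ∈ C then w C else 0) ≤ 1) ∧
      3/(4*β) * (∑ e ∈ S, a e - β) ≤ ∑ C ∈ S.powerset, w C := by
  set x := ∑ e ∈ S, a e with hxd
  -- sums of indicator weights
  have ind1 : ∀ (A : Finset ι) (c : ℝ), A ⊆ S →
      ∑ C ∈ S.powerset, (if C = A then c else 0) = c := by
    intro A c hA
    rw [Finset.sum_ite_eq' S.powerset A]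
    simp [hA]
  have ind2 : ∀ (A : Finset ι) (c : ℝ) (e : ι), A ⊆ S →
      ∑ C ∈ S.powerset, (if e ∈ C then (if C = A then c else 0) else 0)
        = if e ∈ A then c else 0 := by
    intro A c e hA
    rw [← ind1 A (if e ∈ A then c else 0) hA]
    apply Finset.sum_congr rfl
    intro C _
    by_cases h : C = A
    · subst h; simp
    · simp [h]
  have key : ∀ y z : ℝ, y ≤ z * (4*β/3) → 3/(4*β) * y ≤ z := by
    intro y z h
    rw [div_mul_eq_mul_div, div_le_iff₀ (by positivity)]
    linarith
  rcases lt_or_ge x β with h1 | h1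
  · refine ⟨fun _ => 0, by simp, by simp, by simp, ?_⟩
    simp only [Finset.sum_const_zero]
    apply key; linarith
  rcases lt_or_ge x (2*β) with h2 | h2
  · refine ⟨fun C => if C = S then 1 else 0, ?_, ?_, ?_, ?_⟩
    · intro C; dsimp only; split_ifs <;> norm_num
    · intro C hC
      have : C = S := by by_contra h; simp [h] at hC
      subst this; exact ⟨subset_rfl, h1⟩
    · intro e; rw [ind2 S 1 e subset_rfl]; split_ifs <;> norm_num
    · rw [ind1 S 1 subset_rfl]; apply key; linarith
  -- maximal D
  obtain ⟨D, hD, hmax⟩ := Finset.exists_max_image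
    (S.powerset.filter (fun D => ∑ e ∈ D, a e ≤ x - β)) Finset.card
    ⟨∅, by simp; linarith⟩
  simp only [Finset.mem_filter, Finset.mem_powerset] at hD hmax
  obtain ⟨hDS, hDx⟩ := hD
  have hne : ∃ e ∈ S, e ∉ D := by
    by_contra h
    push Not at h
    have : D = S := subset_antisymm hDS h
    rw [this] at hDx; linarith
  obtain ⟨e, heS, heD⟩ := hne
  have hins : x - β < ∑ e ∈ insert e D, a e := by
    by_contra h
    push Not at h
    have := hmax (insert e D) ⟨Finset.insert_subset heS hDS, h⟩
    rw [Finset.card_insert_of_notMem heD] at this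
    omega
  have hins' := hins
  rw [Finset.sum_insert heD] at hins'
  have hsd : ∑ e ∈ S \ D, a e = x - ∑ e ∈ D, a e := by
    rw [← Finset.sum_sdiff hDS] at hxd; linarith
  have hes := hs e heS
  rcases lt_or_ge x (3*β) with h3 | h3
  · have hse : ∑ e ∈ S.erase e, a e = x - a e := by
      rw [← Finset.add_sum_erase S a heS] at hxd; linarith
    refine ⟨fun C => (if C = S \ D then 1/2 else 0) + (if C = S.erase e then 1/2 else 0)
      + (if C = insert e D then 1/2 else 0), ?_, ?_, ?_, ?_⟩
    · intro C; positivity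
    · intro C hC
      by_cases c1 : C = S \ D
      · subst c1; exact ⟨Finset.sdiff_subset, by linarith⟩
      by_cases c2 : C = S.erase e
      · subst c2; exact ⟨Finset.erase_subset _ _, by linarith⟩
      by_cases c3 : C = insert e D
      · subst c3; exact ⟨Finset.insert_subset heS hDS, by linarith⟩
      simp [c1, c2, c3] at hC
    · intro f
      have : ∀ C : Finset ι, (if f ∈ C then ((if C = S \ D then (1/2:ℝ) else 0)
        + (if C = S.erase e then 1/2 else 0)
        + (if C = insert e D then 1/2 else 0)) else 0) =
        (if f ∈ C then (if C = S \ D then (1/2:ℝ) else 0) else 0)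
        + (if f ∈ C then (if C = S.erase e then (1/2:ℝ) else 0) else 0)
        + (if f ∈ C then (if C = insert e D then (1/2:ℝ) else 0) else 0) := by
        intro C; by_cases h : f ∈ C <;> simp [h]
      simp only [this, Finset.sum_add_distrib]
      rw [ind2 _ _ _ Finset.sdiff_subset, ind2 _ _ _ (Finset.erase_subset _ _),
        ind2 _ _ _ (Finset.insert_subset heS hDS)]
      by_cases q1 : f ∈ D
      · by_cases q2 : f = e
        · subst q2; exact absurd q1 heD
        · simp [q1, q2]; split_ifs <;> norm_num
      · by_cases q2 : f = e
        · subst q2; simp [q1]; split_ifs <;> norm_num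
        · simp [q1, q2]; split_ifs <;> norm_num
    · simp only [Finset.sum_add_distrib]
      rw [ind1 _ _ Finset.sdiff_subset, ind1 _ _ (Finset.erase_subset _ _),
        ind1 _ _ (Finset.insert_subset heS hDS)]
      apply key; linarith
  · refine ⟨fun C => (if C = S \ D then 1 else 0) + (if C = D then 1 else 0), ?_, ?_, ?_, ?_⟩
    · intro C; positivity
    · intro C hC
      by_cases c1 : C = S \ D
      · subst c1; exact ⟨Finset.sdiff_subset, by linarith⟩
      by_cases c2 : C = D
      · subst c2; exact ⟨hDS, by linarith⟩
      simp [c1, c2] at hC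
    · intro f
      have : ∀ C : Finset ι, (if f ∈ C then ((if C = S \ D then (1:ℝ) else 0)
        + (if C = D then 1 else 0)) else 0) =
        (if f ∈ C then (if C = S \ D then (1:ℝ) else 0) else 0)
        + (if f ∈ C then (if C = D then (1:ℝ) else 0) else 0) := by
        intro C; by_cases h : f ∈ C <;> simp [h]
      simp only [this, Finset.sum_add_distrib]
      rw [ind2 _ _ _ Finset.sdiff_subset, ind2 _ _ _ hDS]
      by_cases q1 : f ∈ D
      · simp [q1]
      · simp [q1]; split_ifs <;> norm_num
    · simp only [Finset.sum_add_distrib]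
      rw [ind1 _ _ Finset.sdiff_subset, ind1 _ _ hDS]
      apply key; linarith

end APSX

namespace APSX

/-- A normalised fractional partition with additive supporting functions. -/
structure Prof {ι : Type} [DecidableEq ι] (M : Finset ι) (r : ℝ) where
  fam : Finset (Finset ι)
  lam : Finset ι → ℝ
  a : Finset ι → ι → ℝ
  sub : ∀ B ∈ fam, B ⊆ M
  lam0 : ∀ B ∈ fam, 0 ≤ lam B
  a0 : ∀ B ∈ fam, ∀ e, 0 ≤ a B e
  asum : ∀ B ∈ fam, ∑ e ∈ B, a B e = 1
  lsum : ∑ B ∈ fam, lam B = 1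
  marg : ∀ e, ∑ B ∈ fam, (if e ∈ B then lam B else 0) ≤ r

namespace Prof

variable {ι : Type} [DecidableEq ι] {M : Finset ι} {r : ℝ}

/-- Expected value of item `e` in the trimmed bundles `S B`. -/
noncomputable def pf (P : Prof M r) (S : Finset ι → Finset ι) (e : ι) : ℝ :=
  ∑ B ∈ P.fam, P.lam B * (if e ∈ S B then P.a B e else 0)

/-- Expected remaining value. -/
noncomputable def F (P : Prof M r) (S : Finset ι → Finset ι) : ℝ :=
  ∑ B ∈ P.fam, P.lam B * ∑ e ∈ S B, P.a B e

theorem pf_nonneg (P : Prof M r) (S : Finset ι → Finset ι) (e : ι) : 0 ≤ P.pf S e := by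
  apply Finset.sum_nonneg
  intro B hB
  apply mul_nonneg (P.lam0 B hB)
  split_ifs
  · exact P.a0 B hB e
  · exact le_rfl

theorem sum_pf (P : Prof M r) (S : Finset ι → Finset ι) (C : Finset ι) :
    ∑ e ∈ C, P.pf S e = P.F (fun B => S B ∩ C) := by
  unfold pf F
  rw [Finset.sum_comm]
  apply Finset.sum_congr rfl
  intro B _
  rw [← Finset.mul_sum]
  congr 1
  rw [← Finset.sum_filter]
  apply Finset.sum_congr _ (fun _ _ => rfl)
  ext e; simp [and_comm]

theorem F_mono (P : Prof M r) (S S' : Finset ι → Finset ι) (h : ∀ B ∈ P.fam, S B ⊆ S' B) :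
    P.F S ≤ P.F S' := by
  apply Finset.sum_le_sum
  intro B hB
  apply mul_le_mul_of_nonneg_left _ (P.lam0 B hB)
  exact Finset.sum_le_sum_of_subset_of_nonneg (h B hB) (fun e _ _ => P.a0 B hB e)

theorem F_nonneg (P : Prof M r) (S : Finset ι → Finset ι) : 0 ≤ P.F S := by
  apply Finset.sum_nonneg
  intro B hB
  exact mul_nonneg (P.lam0 B hB) (Finset.sum_nonneg (fun e _ => P.a0 B hB e))

theorem F_congr (P : Prof M r) (S S' : Finset ι → Finset ι) (h : ∀ B ∈ P.fam, S B = S' B) :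
    P.F S = P.F S' := by
  apply Finset.sum_congr rfl
  intro B hB
  rw [h B hB]

theorem F_id (P : Prof M r) : P.F (fun B => B) = 1 := by
  unfold F
  rw [← P.lsum]
  apply Finset.sum_congr rfl
  intro B hB
  rw [P.asum B hB, mul_one]

theorem F_le_one (P : Prof M r) (S : Finset ι → Finset ι) (h : ∀ B ∈ P.fam, S B ⊆ B) :
    P.F S ≤ 1 := by
  rw [← P.F_id]; exact P.F_mono _ _ h

theorem sum_pf_M (P : Prof M r) (S : Finset ι → Finset ι) (h : ∀ B ∈ P.fam, S B ⊆ B) :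
    ∑ e ∈ M, P.pf S e = P.F S := by
  rw [sum_pf]
  apply F_congr
  intro B hB
  exact Finset.inter_eq_left.mpr ((h B hB).trans (P.sub B hB))

/-- Removing a set costs at most its trimmed expected value. -/
theorem F_sdiff (P : Prof M r) (S : Finset ι → Finset ι) (C : Finset ι) :
    P.F (fun B => S B \ C) = P.F S - ∑ e ∈ C, P.pf S e := by
  rw [sum_pf]
  unfold F
  rw [← Finset.sum_sub_distrib]
  apply Finset.sum_congr rfl
  intro B _
  rw [← mul_sub]
  congr 1
  rw [← Finset.sum_inter_add_sum_sdiff (S B) C]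
  ring

theorem pf_mono (P : Prof M r) (S S' : Finset ι → Finset ι) (h : ∀ B ∈ P.fam, S B ⊆ S' B)
    (e : ι) : P.pf S e ≤ P.pf S' e := by
  apply Finset.sum_le_sum
  intro B hB
  apply mul_le_mul_of_nonneg_left _ (P.lam0 B hB)
  by_cases h1 : e ∈ S B
  · rw [if_pos h1, if_pos (h B hB h1)]
  · rw [if_neg h1]; split_ifs
    · exact P.a0 B hB e
    · exact le_rfl

theorem pick (P : Prof M r) (S : Finset ι → Finset ι) (β Γ : ℝ) (g : ι → ℝ)
    (hβ : 0 < β) (hβ' : 1 ≤ 11/3*β)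
    (hS : ∀ B ∈ P.fam, S B ⊆ B)
    (hs : ∀ B ∈ P.fam, ∀ e ∈ S B, P.a B e < β)
    (hg : ∀ e, 0 ≤ g e) (hr : 0 ≤ r) (hG : ∑ e ∈ M, g e ≤ Γ) (hF : β < P.F S) :
    ∃ B ∈ P.fam, ∃ C ⊆ S B, β ≤ ∑ e ∈ C, P.a B e ∧
      ∑ e ∈ C, g e ≤ r * Γ / (3/(4*β) * (P.F S - β)) := by
  have hpk : ∀ B : Finset ι, ∃ w : Finset ι → ℝ, B ∈ P.fam → ((∀ C, 0 ≤ w C) ∧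
      (∀ C, w C ≠ 0 → C ⊆ S B ∧ β ≤ ∑ e ∈ C, P.a B e) ∧
      (∀ e, ∑ C ∈ (S B).powerset, (if e ∈ C then w C else 0) ≤ 1) ∧
      3/(4*β) * (∑ e ∈ S B, P.a B e - β) ≤ ∑ C ∈ (S B).powerset, w C) := by
    intro B
    by_cases hB : B ∈ P.fam
    · obtain ⟨w, hw⟩ := pack (S B) (P.a B) β hβ (fun e _ => P.a0 B hB e) (hs B hB) (by
        have := Finset.sum_le_sum_of_subset_of_nonneg (hS B hB)
          (fun e _ _ => P.a0 B hB e)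
        rw [P.asum B hB] at this
        linarith)
      exact ⟨w, fun _ => hw⟩
    · exact ⟨fun _ => 0, fun h => absurd h hB⟩
  choose w hw using hpk
  set h := 3/(4*β) * (P.F S - β) with hh
  have hpos : 0 < h := by
    apply mul_pos (by positivity); linarith
  set θ := r * Γ / h with hθ
  by_contra hcon
  push Not at hcon
  -- total weight
  have tot : h ≤ ∑ B ∈ P.fam, P.lam B * ∑ C ∈ (S B).powerset, w B C := by
    have : h = ∑ B ∈ P.fam, P.lam B * (3/(4*β) * (∑ e ∈ S B, P.a B e - β)) := by
      rw [hh]; unfold F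
      have e1 : ∀ B, P.lam B * (3/(4*β) * (∑ e ∈ S B, P.a B e - β)) =
        3/(4*β) * (P.lam B * ∑ e ∈ S B, P.a B e) - 3/(4*β) * β * P.lam B := by
        intro B; ring
      simp only [e1, Finset.sum_sub_distrib, ← Finset.mul_sum, P.lsum]
      ring
    rw [this]
    apply Finset.sum_le_sum
    intro B hB
    exact mul_le_mul_of_nonneg_left (hw B hB).2.2.2 (P.lam0 B hB)
  have wg : ∀ B ∈ P.fam, ∑ C ∈ (S B).powerset, w B C * ∑ e ∈ C, g e ≤ ∑ e ∈ B, g e := by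
    intro B hB
    have e1 : ∑ C ∈ (S B).powerset, w B C * ∑ e ∈ C, g e
        = ∑ e ∈ S B, g e * ∑ C ∈ (S B).powerset, (if e ∈ C then w B C else 0) := by
      simp only [Finset.mul_sum]
      rw [Finset.sum_comm]
      apply Finset.sum_congr rfl
      intro C hC
      rw [Finset.mem_powerset] at hC
      have : C = (S B).filter (fun e => e ∈ C) := by
        ext e; simp; exact fun h => hC h
      conv_lhs => rw [this]
      rw [Finset.sum_filter]
      apply Finset.sum_congr rfl
      intro e _
      split_ifs
      · rw [mul_comm]; congr 2; exact this.symm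
      · simp
    rw [e1]
    calc _ ≤ ∑ e ∈ S B, g e * 1 := by
          apply Finset.sum_le_sum
          intro e _
          exact mul_le_mul_of_nonneg_left ((hw B hB).2.2.1 e) (hg e)
      _ = ∑ e ∈ S B, g e := by simp
      _ ≤ _ := Finset.sum_le_sum_of_subset_of_nonneg (hS B hB) (fun e _ _ => hg e)
  have tg : ∑ B ∈ P.fam, P.lam B * ∑ C ∈ (S B).powerset, w B C * ∑ e ∈ C, g e ≤ r * Γ := by
    calc _ ≤ ∑ B ∈ P.fam, P.lam B * ∑ e ∈ B, g e := by
          apply Finset.sum_le_sum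
          intro B hB
          exact mul_le_mul_of_nonneg_left (wg B hB) (P.lam0 B hB)
      _ = ∑ e ∈ M, g e * ∑ B ∈ P.fam, (if e ∈ B then P.lam B else 0) := by
          simp only [Finset.mul_sum]
          rw [Finset.sum_comm]
          apply Finset.sum_congr rfl
          intro B hB
          have : B = M.filter (fun e => e ∈ B) := by
            ext e; simp; exact fun h => P.sub B hB h
          conv_lhs => rw [this]
          rw [Finset.sum_filter]
          apply Finset.sum_congr rfl
          intro e _
          split_ifs
          · rw [mul_comm]; congr 2; exact this.symm
          · simp
      _ ≤ ∑ e ∈ M, g e * r := by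
          apply Finset.sum_le_sum
          intro e _
          exact mul_le_mul_of_nonneg_left (P.marg e) (hg e)
      _ = r * ∑ e ∈ M, g e := by rw [← Finset.sum_mul, mul_comm]
      _ ≤ _ := mul_le_mul_of_nonneg_left hG hr
  have term : ∀ B ∈ P.fam, ∀ C ∈ (S B).powerset, 0 ≤ w B C * (∑ e ∈ C, g e - θ) ∧
      (w B C * (∑ e ∈ C, g e - θ) = 0 → w B C = 0) := by
    intro B hB C _
    by_cases h0 : w B C = 0
    · simp [h0]
    · obtain ⟨c1, c2⟩ := (hw B hB).2.1 C h0
      have := hcon B hB C c1 c2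
      have h1 := (hw B hB).1 C
      have h2 : 0 < w B C * (∑ e ∈ C, g e - θ) :=
        mul_pos (lt_of_le_of_ne h1 (Ne.symm h0)) (by linarith)
      exact ⟨h2.le, fun h => absurd h h2.ne'⟩
  have inner : ∀ B ∈ P.fam, 0 ≤ P.lam B * ∑ C ∈ (S B).powerset, w B C * (∑ e ∈ C, g e - θ) := by
    intro B hB
    exact mul_nonneg (P.lam0 B hB) (Finset.sum_nonneg (fun C hC => (term B hB C hC).1))
  have sumle : ∑ B ∈ P.fam, P.lam B * ∑ C ∈ (S B).powerset, w B C * (∑ e ∈ C, g e - θ)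
      = ∑ B ∈ P.fam, P.lam B * ∑ C ∈ (S B).powerset, w B C * ∑ e ∈ C, g e
        - θ * ∑ B ∈ P.fam, P.lam B * ∑ C ∈ (S B).powerset, w B C := by
    rw [Finset.mul_sum, ← Finset.sum_sub_distrib]
    apply Finset.sum_congr rfl
    intro B _
    simp only [mul_sub, Finset.sum_sub_distrib, ← Finset.sum_mul]
    ring
  have hθ0 : 0 ≤ θ := by
    apply div_nonneg (mul_nonneg hr _) hpos.le
    exact le_trans (Finset.sum_nonneg (fun e _ => hg e)) hG
  have hθh : θ * h = r * Γ := by rw [hθ]; field_simp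
  have s0 : ∑ B ∈ P.fam, P.lam B * ∑ C ∈ (S B).powerset, w B C * (∑ e ∈ C, g e - θ) = 0 := by
    apply le_antisymm _ (Finset.sum_nonneg inner)
    rw [sumle]
    have := mul_le_mul_of_nonneg_left tot hθ0
    linarith
  have z := (Finset.sum_eq_zero_iff_of_nonneg inner).mp s0
  have : ∑ B ∈ P.fam, P.lam B * ∑ C ∈ (S B).powerset, w B C = 0 := by
    apply Finset.sum_eq_zero
    intro B hB
    rcases mul_eq_zero.mp (z B hB) with h | h
    · rw [h, zero_mul]
    · have := (Finset.sum_eq_zero_iff_of_nonneg (fun C hC => (term B hB C hC).1)).mp h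
      rw [Finset.sum_eq_zero, mul_zero]
      intro C hC
      exact (term B hB C hC).2 (this C hC)
  linarith

/-- Restrict a profile to the bundles satisfying `q`. -/
noncomputable def restrict (P : Prof M r) (q : Finset ι → Prop) [DecidablePred q] (c : ℝ)
    (hc : 0 < c) (hr : 0 ≤ r) (hq : c ≤ ∑ B ∈ P.fam.filter q, P.lam B) : Prof M (r / c) where
  fam := P.fam.filter q
  lam := fun B => P.lam B / ∑ B ∈ P.fam.filter q, P.lam B
  a := P.a
  sub := fun B hB => P.sub B (Finset.mem_filter.mp hB).1
  lam0 := fun B hB => div_nonneg (P.lam0 B (Finset.mem_filter.mp hB).1) (by linarith)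
  a0 := fun B hB => P.a0 B (Finset.mem_filter.mp hB).1
  asum := fun B hB => P.asum B (Finset.mem_filter.mp hB).1
  lsum := by
    rw [← Finset.sum_div]
    exact div_self (by linarith)
  marg := by
    intro e
    have h1 : ∀ B, (if e ∈ B then P.lam B / ∑ B ∈ P.fam.filter q, P.lam B else 0) =
        (if e ∈ B then P.lam B else 0) / ∑ B ∈ P.fam.filter q, P.lam B := by
      intro B; split_ifs <;> simp
    simp only [h1]
    rw [← Finset.sum_div]
    apply div_le_div₀ hr _ hc hq
    refine le_trans ?_ (P.marg e)
    apply Finset.sum_le_sum_of_subset_of_nonneg (Finset.filter_subset _ _)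
    intro B hB _
    split_ifs
    · exact P.lam0 B hB
    · exact le_rfl

/-- Mass of bundles disjoint from a set. -/
theorem mass_disjoint (P : Prof M r) (Q : Finset ι) :
    1 - Q.card * r ≤ ∑ B ∈ P.fam.filter (fun B => Disjoint B Q), P.lam B := by
  have h1 := Finset.sum_filter_add_sum_filter_not P.fam (fun B => Disjoint B Q) P.lam
  rw [P.lsum] at h1
  have h2 : ∑ B ∈ P.fam.filter (fun B => ¬ Disjoint B Q), P.lam B ≤ Q.card * r := by
    calc _ = ∑ B ∈ P.fam, (if ¬ Disjoint B Q then P.lam B else 0) := by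
          rw [Finset.sum_filter]
      _ ≤ ∑ B ∈ P.fam, ∑ e ∈ Q, (if e ∈ B then P.lam B else 0) := by
          apply Finset.sum_le_sum
          intro B hB
          have nn : ∀ e ∈ Q, 0 ≤ (if e ∈ B then P.lam B else 0) := by
            intro e _; split_ifs
            · exact P.lam0 B hB
            · exact le_rfl
          split_ifs with hd
          · exact Finset.sum_nonneg nn
          · rw [Finset.not_disjoint_iff] at hd
            obtain ⟨e, h1, h2⟩ := hd
            have := Finset.single_le_sum nn h2
            rwa [if_pos h1] at this
      _ = ∑ e ∈ Q, ∑ B ∈ P.fam, (if e ∈ B then P.lam B else 0) := Finset.sum_comm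
      _ ≤ ∑ e ∈ Q, r := Finset.sum_le_sum (fun e _ => P.marg e)
      _ = _ := by simp
  linarith

end Prof
end APSX

namespace APSX

noncomputable def bet : ℝ := 2753/10000
noncomputable def alp : ℝ := 2752/10000
noncomputable def Gam : ℝ := 10021/10000
noncomputable def Fmin : ℝ := 28/100
/-- Packing rate. -/
noncomputable def hr (F : ℝ) : ℝ := 3/(4*bet) * (F - bet)
/-- Guaranteed remaining fraction. -/
noncomputable def Fh (N : ℕ) : ℕ → ℝ
  | 0 => 999/1000
  | t+1 => Fh N t * (1 - Gam / (N * hr (Fh N t)))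
noncomputable def TT (F : ℝ) : ℝ := 3/(4*bet) * (1 - F + bet * Real.log F)

theorem hr_mono {x y : ℝ} (h : x ≤ y) : hr x ≤ hr y := by
  unfold hr bet; linarith

theorem hr_pos {x : ℝ} (h : Fmin ≤ x) : 1/100 ≤ hr x := by
  unfold Fmin at h
  unfold hr bet; linarith

theorem TT_tangent (F y : ℝ) (hF : 0 < F) (hy : 0 < y) :
    TT y ≤ TT F + hr F / F * (F - y) := by
  have h1 : Real.log y - Real.log F ≤ (y - F)/F := by
    rw [← Real.log_div hy.ne' hF.ne']
    have := Real.log_le_sub_one_of_pos (div_pos hy hF)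
    calc _ ≤ y / F - 1 := this
      _ = _ := by field_simp
  have h2 : TT F + hr F / F * (F - y) - TT y
      = 3/(4*bet) * (bet * ((y-F)/F - (Real.log y - Real.log F))) := by
    unfold TT hr; field_simp; ring
  have h3 : 0 ≤ 3/(4*bet) * (bet * ((y-F)/F - (Real.log y - Real.log F))) := by
    apply mul_nonneg (by unfold bet; norm_num)
    apply mul_nonneg (by unfold bet; norm_num)
    linarith
  linarith

theorem log_Fmin : -(12755/10000 : ℝ) ≤ Real.log Fmin := by
  rw [Real.le_log_iff_exp_le (by unfold Fmin; norm_num)]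
  have h1 : (271828/100000 : ℝ) ≤ Real.exp 1 := by
    have := Real.exp_one_gt_d9; linarith
  have h2 : (1 + 2755/10000 + (2755/10000)^2/2 + (2755/10000)^3/6 : ℝ) ≤ Real.exp (2755/10000) := by
    have := Real.sum_le_exp_of_nonneg (x := (2755/10000:ℝ)) (by norm_num) 4
    simp [Finset.sum_range_succ, Nat.factorial] at this
    linarith
  have h3 : (100/28 : ℝ) ≤ Real.exp (12755/10000) := by
    have : (12755/10000 : ℝ) = 1 + 2755/10000 := by norm_num
    rw [this, Real.exp_add]
    calc (100/28 : ℝ) ≤ 271828/100000 * (1 + 2755/10000 + (2755/10000)^2/2 + (2755/10000)^3/6) := by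
          norm_num
      _ ≤ _ := by gcongr
  rw [Real.exp_neg]
  unfold Fmin
  rw [inv_le_comm₀ (Real.exp_pos _) (by norm_num)]
  linarith

theorem TT_gap : TT (999/1000) + Gam < TT Fmin := by
  have h1 := log_Fmin
  have h2 := Real.log_le_sub_one_of_pos (show (0:ℝ) < 999/1000 by norm_num)
  unfold TT Gam
  have e : (3/(4*bet) : ℝ) = 7500/2753 := by unfold bet; norm_num
  rw [e]
  unfold bet Fmin at *
  linarith

theorem Fh_bound (N : ℕ) (hN : 1 ≤ N) : ∀ t ≤ N, Fmin ≤ Fh N t ∧ Fh N t ≤ 999/1000 ∧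
    TT (Fh N t) ≤ TT (999/1000) + Gam * t / N := by
  intro t
  have hN' : (0:ℝ) < N := by exact_mod_cast hN
  induction t with
  | zero => intro _; refine ⟨by unfold Fh Fmin; norm_num, le_rfl, by simp [Fh]⟩
  | succ t ih =>
    intro ht
    obtain ⟨i1, i2, i3⟩ := ih (by omega)
    have hF : 0 < Fh N t := lt_of_lt_of_le (by unfold Fmin; norm_num) i1
    have hh : 0 < hr (Fh N t) := lt_of_lt_of_le (by norm_num) (hr_pos i1)
    have hstep : Fh N (t+1) = Fh N t * (1 - Gam / (N * hr (Fh N t))) := rfl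
    have hG : 0 < Gam := by unfold Gam; norm_num
    have hdiff : Fh N t - Fh N (t+1) = Fh N t * Gam / (N * hr (Fh N t)) := by
      rw [hstep]; ring
    have hd0 : 0 ≤ Fh N t * Gam / (N * hr (Fh N t)) := by positivity
    have hval : hr (Fh N t) / Fh N t * (Fh N t * Gam / (N * hr (Fh N t))) = Gam / N := by
      field_simp
    have bound : ∀ y, 0 < y → Fh N (t+1) ≤ y → TT y ≤ TT (999/1000) + Gam * (t+1) / N := by
      intro y hy hyF
      have := TT_tangent (Fh N t) y hF hy
      have h2 : hr (Fh N t) / Fh N t * (Fh N t - y) ≤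
        hr (Fh N t) / Fh N t * (Fh N t * Gam / (N * hr (Fh N t))) := by
        apply mul_le_mul_of_nonneg_left _ (by positivity)
        linarith
      rw [hval] at h2
      have e : Gam * ((t:ℝ)+1) / N = Gam * t / N + Gam / N := by ring
      rw [e]; linarith
    have main : Fmin ≤ Fh N (t+1) := by
      by_contra hc
      push Not at hc
      have := bound Fmin (by unfold Fmin; norm_num) hc.le
      have h4 : Gam * ((t:ℝ)+1) / N ≤ Gam := by
        rw [div_le_iff₀ hN']
        apply mul_le_mul_of_nonneg_left _ hG.le
        exact_mod_cast ht
      have := TT_gap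
      linarith
    refine ⟨main, by linarith, ?_⟩
    have := bound (Fh N (t+1)) (lt_of_lt_of_le (by unfold Fmin; norm_num) main) le_rfl
    push_cast
    exact this

theorem Fh_ge (N : ℕ) (hN : 1 ≤ N) (t : ℕ) (ht : t ≤ N) : Fmin ≤ Fh N t := (Fh_bound N hN t ht).1
theorem Fh_le (N : ℕ) (hN : 1 ≤ N) (t : ℕ) (ht : t ≤ N) : Fh N t ≤ 999/1000 :=
  (Fh_bound N hN t ht).2.1

end APSX

namespace APSX

/-- Expected value of a set of items. -/
noncomputable def Prof.p {ι : Type} [DecidableEq ι] {M : Finset ι} {r : ℝ} (P : Prof M r)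
    (C : Finset ι) : ℝ := ∑ e ∈ C, P.pf (fun B => B) e

/-- Trimming rule after agent with additive function `b` took `C`. -/
noncomputable def trim {ι : Type} [DecidableEq ι] {M : Finset ι} {r : ℝ} (P : Prof M r)
    (S : Finset ι → Finset ι) (C : Finset ι) (b : ι → ℝ) (δ ε : ℝ) (B : Finset ι) : Finset ι :=
  open Classical in
  if P.p C < δ ∨ ε < ∑ e ∈ C ∩ B, b e then S B \ C else S B

theorem trim_sub {ι : Type} [DecidableEq ι] {M : Finset ι} {r : ℝ} (P : Prof M r)
    (S : Finset ι → Finset ι) (C : Finset ι) (b : ι → ℝ) (δ ε : ℝ) (B : Finset ι) :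
    trim P S C b δ ε B ⊆ S B := by
  unfold trim; split_ifs
  · exact Finset.sdiff_subset
  · exact subset_rfl

theorem trim_or {ι : Type} [DecidableEq ι] {M : Finset ι} {r : ℝ} (P : Prof M r)
    (S : Finset ι → Finset ι) (C : Finset ι) (b : ι → ℝ) (δ ε : ℝ) (B : Finset ι) :
    Disjoint (trim P S C b δ ε B) C ∨ (δ ≤ P.p C ∧ ∑ e ∈ C ∩ B, b e ≤ ε) := by
  unfold trim; split_ifs with h
  · exact Or.inl Finset.sdiff_disjoint
  · right; push Not at h; exact h

theorem trim_drop1 {ι : Type} [DecidableEq ι] {M : Finset ι} {r : ℝ} (P : Prof M r)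
    (S : Finset ι → Finset ι) (C : Finset ι) (b : ι → ℝ) (δ ε : ℝ) :
    P.F S - P.F (trim P S C b δ ε) ≤ ∑ e ∈ C, P.pf S e := by
  have h1 := P.F_sdiff S C
  have h2 : P.F (fun B => S B \ C) ≤ P.F (trim P S C b δ ε) := by
    apply P.F_mono
    intro B _
    unfold trim; split_ifs
    · exact subset_rfl
    · exact Finset.sdiff_subset
  linarith

theorem trim_drop2 {ι : Type} [DecidableEq ι] {M : Finset ι} {r : ℝ} (P : Prof M r)
    (S : Finset ι → Finset ι) (C : Finset ι) (b : ι → ℝ) (δ ε : ℝ) (hS : ∀ B ∈ P.fam, S B ⊆ B)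
    (hb : ∀ e, 0 ≤ b e) (hbC : ∑ e ∈ C, b e ≤ 1) (hε : 0 < ε) (hr0 : 0 ≤ r) (hr : r ≤ δ * ε) :
    P.F S - P.F (trim P S C b δ ε) ≤ δ := by
  by_cases hh : P.p C < δ
  · refine (trim_drop1 P S C b δ ε).trans (le_trans ?_ hh.le)
    exact Finset.sum_le_sum (fun e _ => P.pf_mono _ _ hS e)
  have h1 : P.F S - P.F (trim P S C b δ ε) ≤
      ∑ B ∈ P.fam, P.lam B * ((∑ e ∈ C ∩ B, b e) / ε) := by
    unfold Prof.F
    rw [← Finset.sum_sub_distrib]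
    apply Finset.sum_le_sum
    intro B hB
    rw [← mul_sub]
    apply mul_le_mul_of_nonneg_left _ (P.lam0 B hB)
    have hnn : 0 ≤ ∑ e ∈ C ∩ B, b e := Finset.sum_nonneg (fun e _ => hb e)
    by_cases h2 : ε < ∑ e ∈ C ∩ B, b e
    · have a1 : ∑ e ∈ S B, P.a B e ≤ 1 := by
        rw [← P.asum B hB]
        exact Finset.sum_le_sum_of_subset_of_nonneg (hS B hB) (fun e _ _ => P.a0 B hB e)
      have a2 : 0 ≤ ∑ e ∈ trim P S C b δ ε B, P.a B e :=
        Finset.sum_nonneg (fun e _ => P.a0 B hB e)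
      have a3 : 1 ≤ (∑ e ∈ C ∩ B, b e) / ε := by
        rw [le_div_iff₀ hε]; linarith
      linarith
    · have : trim P S C b δ ε B = S B := by
        unfold trim; rw [if_neg]; push Not at hh h2 ⊢; exact ⟨hh, h2⟩
      rw [this, sub_self]; positivity
  have h2 : ∑ B ∈ P.fam, P.lam B * ((∑ e ∈ C ∩ B, b e) / ε)
      = (∑ e ∈ C, b e * ∑ B ∈ P.fam, (if e ∈ B then P.lam B else 0)) / ε := by
    simp only [Finset.mul_sum]
    rw [Finset.sum_comm, Finset.sum_div]
    apply Finset.sum_congr rfl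
    intro B _
    rw [mul_div_assoc', Finset.mul_sum]
    congr 1
    rw [← Finset.filter_mem_eq_inter, Finset.sum_filter]
    apply Finset.sum_congr rfl
    intro e _
    split_ifs
    · ring
    · ring
  have h3 : ∑ e ∈ C, b e * ∑ B ∈ P.fam, (if e ∈ B then P.lam B else 0) ≤ r := by
    calc _ ≤ ∑ e ∈ C, b e * r :=
          Finset.sum_le_sum (fun e _ => mul_le_mul_of_nonneg_left (P.marg e) (hb e))
      _ = (∑ e ∈ C, b e) * r := by rw [Finset.sum_mul]
      _ ≤ 1 * r := mul_le_mul_of_nonneg_right hbC hr0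
      _ = r := one_mul r
  rw [h2] at h1
  refine h1.trans ?_
  rw [div_le_iff₀ hε]; linarith

/-- power estimate -/
theorem pow_est (s : ℕ) (x ξ : ℝ) (h0 : 0 ≤ x) (hξ : ξ < 1) (h1 : s * x ≤ ξ) (hx1 : x < 1) :
    ((1 - x)⁻¹)^s ≤ 1 + s * x / (1 - ξ) := by
  have hb := one_add_mul_le_pow (a := -x) (by linarith) s
  have hsx : 0 ≤ s * x := by positivity
  have h2 : 0 < 1 - s * x := by linarith
  have h3 : 1 - s * x ≤ (1 - x)^s := by
    calc 1 - s * x = 1 + s * (-x) := by ring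
      _ ≤ (1 + -x)^s := hb
      _ = _ := by ring
  rw [inv_pow]
  calc ((1-x)^s)⁻¹ ≤ (1 - s*x)⁻¹ := inv_anti₀ h2 h3
    _ ≤ _ := by
      rw [inv_le_iff_one_le_mul₀ h2]
      have h4 : (1 + s * x / (1 - ξ)) * (1 - s * x) - 1 = s * x * (ξ - s * x) / (1 - ξ) := by
        have : 1 - ξ ≠ 0 := by linarith
        field_simp; ring
      have h5 : 0 ≤ s * x * (ξ - s * x) / (1 - ξ) := by
        apply div_nonneg (mul_nonneg hsx _) <;> linarith
      linarith

theorem pow_est2 (s : ℕ) (y : ℝ) (hy : y < 1) : 1 + s * y ≤ ((1 - y)⁻¹)^s := by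
  have h1 : (1 - y)^s ≤ Real.exp (-(s*y)) := by
    have : 1 - y ≤ Real.exp (-y) := by have := Real.add_one_le_exp (-y); linarith
    calc (1-y)^s ≤ (Real.exp (-y))^s := pow_le_pow_left₀ (by linarith) this s
      _ = _ := by rw [← Real.exp_nat_mul]; ring_nf
  have h2 : 1 + s * y ≤ Real.exp (s*y) := by have := Real.add_one_le_exp (s*y); linarith
  have h3 : 0 < (1-y)^s := pow_pos (by linarith) s
  rw [inv_pow]
  refine h2.trans ?_
  rw [le_inv_comm₀ (Real.exp_pos _) h3, ← Real.exp_neg]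
  exact h1

end APSX

namespace APSX

theorem step_core {ι : Type} [DecidableEq ι] {M : Finset ι} (N s : ℕ) (hs : 1 ≤ s) (hN : 1 ≤ N)
    (r : ℝ) (hrN : r = 1/(N:ℝ)) (P : ℕ → Prof M r)
    (hsm : ∀ k < N, ∀ B ∈ (P k).fam, ∀ e ∈ B, (P k).a B e < bet)
    (δ ε : ℝ) (hδ0 : 0 < δ) (hδ : s * δ ≤ Fmin / 1000) (hε : 0 < ε) (hNe : r ≤ δ * ε)
    (t : ℕ) (ht : t < N) (S : ℕ → Finset ι → Finset ι)
    (hS : ∀ k, ∀ B, S k B ⊆ B)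
    (hF : ∀ k, t ≤ k → k < N → 0 < (P k).F (S k))
    (hΨ : ∑ k ∈ Finset.Ico t N, (((P k).F (S k))⁻¹)^s ≤ ((Fh N t)⁻¹)^s) :
    ∃ B ∈ (P t).fam, ∃ C ⊆ S t B, bet ≤ ∑ e ∈ C, (P t).a B e ∧
      ∑ k ∈ Finset.range N, (P k).p C ≤ 100210 ∧
      (∀ k, t+1 ≤ k → k < N → 0 < (P k).F (trim (P k) (S k) C ((P t).a B) δ ε)) ∧
      ∑ k ∈ Finset.Ico (t+1) N, (((P k).F (trim (P k) (S k) C ((P t).a B) δ ε))⁻¹)^s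
        ≤ ((Fh N (t+1))⁻¹)^s := by
  have hN' : (0:ℝ) < N := by exact_mod_cast hN
  have hFm : (0:ℝ) < Fmin := by unfold Fmin; norm_num
  have hge := Fh_ge N hN t ht.le
  have hge1 := Fh_ge N hN (t+1) ht
  set Fx := Fh N t with hFx
  have hFx0 : 0 < Fx := by linarith
  have hFk : ∀ k, t ≤ k → k < N → Fx ≤ (P k).F (S k) := by
    intro k h1 h2
    have hp := hF k h1 h2
    have : (((P k).F (S k))⁻¹)^s ≤ (Fx⁻¹)^s := by
      refine le_trans ?_ hΨ
      apply Finset.single_le_sum (f := fun k => (((P k).F (S k))⁻¹)^s)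
      · intro i hi
        rw [Finset.mem_Ico] at hi
        have := hF i hi.1 hi.2
        positivity
      · rw [Finset.mem_Ico]; exact ⟨h1, h2⟩
    have h3 := (pow_le_pow_iff_left₀ (by positivity) (by positivity) (by omega)).mp this
    exact (inv_le_inv₀ hp hFx0).mp h3
  -- split off t in the potential
  have hΨ' : ∑ k ∈ Finset.Ico (t+1) N, (((P k).F (S k))⁻¹)^s ≤ (Fx⁻¹)^s := by
    rw [Finset.sum_eq_sum_Ico_succ_bot ht] at hΨ
    have := hF t le_rfl ht
    have : 0 ≤ (((P t).F (S t))⁻¹)^s := by positivity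
    linarith
  set g : ι → ℝ := fun e =>
    ∑ k ∈ Finset.Ico (t+1) N, (Fx^s * (((P k).F (S k))⁻¹)^s / (P k).F (S k) / (999/1000))
      * (P k).pf (S k) e
    + ∑ k ∈ Finset.range N, (1/1000/(N:ℝ)) * (P k).pf (fun B => B) e with hg
  have hcoef : ∀ k ∈ Finset.Ico (t+1) N,
      0 ≤ (Fx^s * (((P k).F (S k))⁻¹)^s / (P k).F (S k) / (999/1000)) := by
    intro k hk
    rw [Finset.mem_Ico] at hk
    have := hF k (by omega) hk.2
    positivity
  have hg0 : ∀ e, 0 ≤ g e := by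
    intro e
    apply add_nonneg
    · exact Finset.sum_nonneg (fun k hk => mul_nonneg (hcoef k hk) ((P k).pf_nonneg _ _))
    · exact Finset.sum_nonneg (fun k _ => mul_nonneg (by positivity) ((P k).pf_nonneg _ _))
  have hgC : ∀ C : Finset ι, ∑ e ∈ C, g e =
      ∑ k ∈ Finset.Ico (t+1) N, (Fx^s * (((P k).F (S k))⁻¹)^s / (P k).F (S k) / (999/1000))
      * ∑ e ∈ C, (P k).pf (S k) e
    + ∑ k ∈ Finset.range N, (1/1000/(N:ℝ)) * (P k).p C := by
    intro C
    rw [hg, Finset.sum_add_distrib]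
    congr 1
    · rw [Finset.sum_comm]
      apply Finset.sum_congr rfl
      intro k _; rw [Finset.mul_sum]
    · rw [Finset.sum_comm]
      apply Finset.sum_congr rfl
      intro k _; rw [Prof.p, Finset.mul_sum]
  have hgM : ∑ e ∈ M, g e ≤ Gam := by
    rw [hgC]
    have h1 : ∑ k ∈ Finset.Ico (t+1) N,
        (Fx^s * (((P k).F (S k))⁻¹)^s / (P k).F (S k) / (999/1000))
        * ∑ e ∈ M, (P k).pf (S k) e ≤ 1/(999/1000) := by
      have : ∀ k ∈ Finset.Ico (t+1) N,
        (Fx^s * (((P k).F (S k))⁻¹)^s / (P k).F (S k) / (999/1000))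
        * ∑ e ∈ M, (P k).pf (S k) e = Fx^s/(999/1000) * (((P k).F (S k))⁻¹)^s := by
        intro k hk
        rw [Finset.mem_Ico] at hk
        have := hF k (by omega) hk.2
        rw [(P k).sum_pf_M _ (fun B _ => hS k B)]
        field_simp
      rw [Finset.sum_congr rfl this, ← Finset.mul_sum]
      calc _ ≤ Fx^s/(999/1000) * (Fx⁻¹)^s :=
            mul_le_mul_of_nonneg_left hΨ' (by positivity)
        _ = _ := by rw [inv_pow]; field_simp
    have h2 : ∑ k ∈ Finset.range N, (1/1000/(N:ℝ)) * (P k).p M = 1/1000 := by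
      have : ∀ k ∈ Finset.range N, (1/1000/(N:ℝ)) * (P k).p M = 1/1000/(N:ℝ) := by
        intro k _
        rw [Prof.p, (P k).sum_pf_M _ (fun B _ => subset_rfl), Prof.F_id, mul_one]
      rw [Finset.sum_congr rfl this]
      simp; field_simp
    unfold Gam; linarith
  have hFt := hFk t le_rfl ht
  obtain ⟨B, hB, C, hC, hbC, hGC⟩ := (P t).pick (S t) bet Gam g (by unfold bet; norm_num)
    (by unfold bet; norm_num) (fun B _ => hS t B)
    (fun B hB e he => hsm t ht B hB e (hS t B he)) hg0 (by rw [hrN]; positivity) hgM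
    (by unfold bet; unfold Fmin at hge; linarith)
  set y := Gam / (N * hr Fx) with hy
  have hhr : 1/100 ≤ hr Fx := hr_pos hge
  have hG0 : 0 < Gam := by unfold Gam; norm_num
  have hGy : ∑ e ∈ C, g e ≤ y := by
    refine hGC.trans ?_
    change r * Gam / hr ((P t).F (S t)) ≤ y
    have h1 := hr_mono hFt
    generalize (P t).F (S t) = z at h1 ⊢
    rw [hrN, hy, one_div, inv_mul_eq_div, div_div]
    apply div_le_div_of_nonneg_left hG0.le (by positivity)
    exact mul_le_mul_of_nonneg_left h1 hN'.le
  have hstep : Fh N (t+1) = Fx * (1 - y) := rfl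
  have hy1 : y < 1 := by
    by_contra hc
    push Not at hc
    have : Fx * (1 - y) ≤ 0 := mul_nonpos_of_nonneg_of_nonpos hFx0.le (by linarith)
    linarith
  have hy0 : 0 ≤ y := by positivity
  refine ⟨B, hB, C, hC, hbC, ?_, ?_⟩
  · rw [hgC] at hGy
    have h1 : 0 ≤ ∑ k ∈ Finset.Ico (t+1) N,
        (Fx^s * (((P k).F (S k))⁻¹)^s / (P k).F (S k) / (999/1000))
        * ∑ e ∈ C, (P k).pf (S k) e :=
      Finset.sum_nonneg (fun k hk => mul_nonneg (hcoef k hk)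
        (Finset.sum_nonneg (fun e _ => (P k).pf_nonneg _ _)))
    rw [← Finset.mul_sum] at hGy
    have h2 : 1/1000/(N:ℝ) * ∑ k ∈ Finset.range N, (P k).p C ≤ Gam / (N * (1/100)) := by
      have : y ≤ Gam / (N * (1/100)) := by
        rw [hy]
        apply div_le_div_of_nonneg_left hG0.le (by positivity)
        exact mul_le_mul_of_nonneg_left hhr hN'.le
      linarith
    have h3 : ∑ k ∈ Finset.range N, (P k).p C =
        1000 * N * (1/1000/(N:ℝ) * ∑ k ∈ Finset.range N, (P k).p C) := by field_simp
    rw [h3]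
    calc _ ≤ 1000 * N * (Gam / (N * (1/100))) := mul_le_mul_of_nonneg_left h2 (by positivity)
      _ = 100210 := by unfold Gam; field_simp; norm_num
  have hsub : C ⊆ B := hC.trans (hS t B)
  have hb1 : ∑ e ∈ C, (P t).a B e ≤ 1 := by
    rw [← (P t).asum B hB]
    exact Finset.sum_le_sum_of_subset_of_nonneg hsub (fun e _ _ => (P t).a0 B hB e)
  -- the estimate for each k
  have hk : ∀ k, t+1 ≤ k → k < N →
      0 < (P k).F (trim (P k) (S k) C ((P t).a B) δ ε) ∧
      (((P k).F (trim (P k) (S k) C ((P t).a B) δ ε))⁻¹)^s ≤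
        (((P k).F (S k))⁻¹)^s + s * ((((P k).F (S k))⁻¹)^s / (P k).F (S k) / (999/1000) *
          ∑ e ∈ C, (P k).pf (S k) e) := by
    intro k h1 h2
    have hp := hF k (by omega) h2
    have hFxk := hFk k (by omega) h2
    have d1 := trim_drop1 (P k) (S k) C ((P t).a B) δ ε
    have d2 := trim_drop2 (P k) (S k) C ((P t).a B) δ ε (fun B _ => hS k B)
      ((P t).a0 B hB) hb1 hε (by rw [hrN]; positivity) hNe
    have d0 : (P k).F (trim (P k) (S k) C ((P t).a B) δ ε) ≤ (P k).F (S k) :=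
      (P k).F_mono _ _ (fun B' _ => trim_sub _ _ _ _ _ _ _)
    set F0 := (P k).F (S k)
    set F1 := (P k).F (trim (P k) (S k) C ((P t).a B) δ ε)
    set x := (F0 - F1)/F0 with hx
    have hx0 : 0 ≤ x := div_nonneg (by linarith) hp.le
    have hs1 : (1:ℝ) ≤ s := by exact_mod_cast hs
    have hxs : s * x ≤ 1/1000 := by
      rw [hx, mul_div_assoc', div_le_iff₀ hp]
      have : (s:ℝ) * (F0 - F1) ≤ s * δ := mul_le_mul_of_nonneg_left d2 (by positivity)
      linarith
    have hx1 : x < 1 := by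
      have : 1 * x ≤ s * x := mul_le_mul_of_nonneg_right hs1 hx0
      linarith
    have hF1 : F1 = F0 * (1 - x) := by rw [hx]; field_simp; ring
    refine ⟨by rw [hF1]; exact mul_pos hp (by linarith), ?_⟩
    have := pow_est s x (1/1000) hx0 (by norm_num) hxs hx1
    rw [hF1, mul_inv, mul_pow]
    have hinv : 0 ≤ (F0⁻¹)^s := by positivity
    have hxle : x ≤ (∑ e ∈ C, (P k).pf (S k) e) / F0 :=
      div_le_div_of_nonneg_right d1 hp.le
    calc (F0⁻¹)^s * ((1-x)⁻¹)^s ≤ (F0⁻¹)^s * (1 + s * x / (1 - 1/1000)) :=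
          mul_le_mul_of_nonneg_left this hinv
      _ ≤ (F0⁻¹)^s * (1 + s * ((∑ e ∈ C, (P k).pf (S k) e) / F0) / (1 - 1/1000)) := by
          apply mul_le_mul_of_nonneg_left _ hinv
          have := mul_le_mul_of_nonneg_left hxle (show (0:ℝ) ≤ s by positivity)
          have h7 := div_le_div_of_nonneg_right this (show (0:ℝ) ≤ 1 - 1/1000 by norm_num)
          linarith
      _ = _ := by
          have : (1:ℝ) - 1/1000 = 999/1000 := by norm_num
          rw [this]; ring
  refine ⟨fun k h1 h2 => (hk k h1 h2).1, ?_⟩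
  calc _ ≤ ∑ k ∈ Finset.Ico (t+1) N, ((((P k).F (S k))⁻¹)^s
        + s * ((((P k).F (S k))⁻¹)^s / (P k).F (S k) / (999/1000) *
          ∑ e ∈ C, (P k).pf (S k) e)) := by
        apply Finset.sum_le_sum
        intro k hk'
        rw [Finset.mem_Ico] at hk'
        exact (hk k hk'.1 hk'.2).2
    _ = ∑ k ∈ Finset.Ico (t+1) N, (((P k).F (S k))⁻¹)^s
        + s * ((Fx⁻¹)^s * ∑ k ∈ Finset.Ico (t+1) N,
          (Fx^s * (((P k).F (S k))⁻¹)^s / (P k).F (S k) / (999/1000))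
            * ∑ e ∈ C, (P k).pf (S k) e) := by
        rw [Finset.sum_add_distrib, Finset.mul_sum, Finset.mul_sum]
        congr 1
        apply Finset.sum_congr rfl
        intro k _
        have : (Fx⁻¹)^s * Fx^s = 1 := by rw [← mul_pow, inv_mul_cancel₀ hFx0.ne', one_pow]
        linear_combination (-(s:ℝ) * ((((P k).F (S k))⁻¹)^s / (P k).F (S k) / (999/1000)) *
          ∑ e ∈ C, (P k).pf (S k) e) * this
    _ ≤ (Fx⁻¹)^s + s * ((Fx⁻¹)^s * y) := by
        apply add_le_add hΨ'
        apply mul_le_mul_of_nonneg_left _ (by positivity)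
        apply mul_le_mul_of_nonneg_left _ (by positivity)
        rw [hgC] at hGy
        have : 0 ≤ ∑ k ∈ Finset.range N, (1/1000/(N:ℝ)) * (P k).p C :=
          Finset.sum_nonneg (fun k _ => mul_nonneg (by positivity)
            (Finset.sum_nonneg (fun e _ => (P k).pf_nonneg _ _)))
        linarith
    _ = (Fx⁻¹)^s * (1 + s * y) := by ring
    _ ≤ (Fx⁻¹)^s * ((1-y)⁻¹)^s := mul_le_mul_of_nonneg_left (pow_est2 s y hy1) (by positivity)
    _ = _ := by rw [hstep, mul_inv, mul_pow]

end APSX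

namespace APSX

theorem sum_biUnion_le' {ι κ : Type} [DecidableEq ι] [DecidableEq κ] (T : Finset κ)
    (C : κ → Finset ι) (f : ι → ℝ) (hf : ∀ e, 0 ≤ f e) :
    ∑ e ∈ T.biUnion C, f e ≤ ∑ k ∈ T, ∑ e ∈ C k, f e := by
  induction T using Finset.induction_on with
  | empty => simp
  | insert k T hk ih =>
    rw [Finset.biUnion_insert, Finset.sum_insert hk]
    have := Finset.sum_union_inter (s₁ := C k) (s₂ := T.biUnion C) (f := f)
    have h2 : 0 ≤ ∑ e ∈ C k ∩ T.biUnion C, f e := Finset.sum_nonneg (fun e _ => hf e)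
    linarith

theorem seq_state {ι : Type} [DecidableEq ι] {M : Finset ι} (N s : ℕ) (hs : 1 ≤ s) (hN : 1 ≤ N)
    (r : ℝ) (hrN : r = 1/(N:ℝ)) (P : ℕ → Prof M r)
    (hsm : ∀ k < N, ∀ B ∈ (P k).fam, ∀ e ∈ B, (P k).a B e < bet)
    (δ ε : ℝ) (hδ0 : 0 < δ) (hδ : s * δ ≤ Fmin / 1000) (hε : 0 < ε) (hNe : r ≤ δ * ε)
    (hNs : (N:ℝ) ≤ ((999/1000 : ℝ)⁻¹)^s) (t : ℕ) : t ≤ N →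
    ∃ (Bp Cp : ℕ → Finset ι) (S : ℕ → Finset ι → Finset ι),
      (∀ j < t, Bp j ∈ (P j).fam ∧ Cp j ⊆ Bp j ∧ bet ≤ ∑ e ∈ Cp j, (P j).a (Bp j) e ∧
        ∑ k ∈ Finset.range N, (P k).p (Cp j) ≤ 100210) ∧
      (∀ j k, j < k → k < t → Disjoint (Cp k) (Cp j) ∨
        (δ ≤ (P k).p (Cp j) ∧ ∑ e ∈ Cp j ∩ Cp k, (P j).a (Bp j) e ≤ ε)) ∧
      (∀ j k, j < t → t ≤ k → k < N → ∀ B, Disjoint (S k B) (Cp j) ∨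
        (δ ≤ (P k).p (Cp j) ∧ ∑ e ∈ Cp j ∩ B, (P j).a (Bp j) e ≤ ε)) ∧
      (∀ k B, S k B ⊆ B) ∧
      (∀ k, t ≤ k → k < N → 0 < (P k).F (S k)) ∧
      ∑ k ∈ Finset.Ico t N, (((P k).F (S k))⁻¹)^s ≤ ((Fh N t)⁻¹)^s := by
  induction t with
  | zero =>
    intro _
    refine ⟨fun _ => ∅, fun _ => ∅, fun _ B => B, by simp, by simp, by simp, by simp, ?_, ?_⟩
    · intro k _ _; rw [Prof.F_id]; norm_num
    · simp only [Prof.F_id]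
      simp only [inv_one, one_pow, Finset.sum_const, Nat.card_Ico, Nat.sub_zero, nsmul_eq_mul,
        mul_one]
      exact hNs
  | succ t ih =>
    intro ht
    obtain ⟨Bp, Cp, S, h1, h2, h3, h4, h5, h6⟩ := ih (by omega)
    obtain ⟨B, hB, C, hC, hb, hp, hF, hΨ⟩ := step_core N s hs hN r hrN P hsm δ ε hδ0 hδ hε hNe t
      (by omega) S h4 h5 h6
    refine ⟨Function.update Bp t B, Function.update Cp t C,
      fun k B' => trim (P k) (S k) C ((P t).a B) δ ε B', ?_, ?_, ?_, ?_, hF, hΨ⟩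
    · intro j hj
      rcases Nat.lt_succ_iff_lt_or_eq.mp hj with h | h
      · simpa [h.ne] using h1 j h
      · subst h
        simp only [Function.update_self]
        exact ⟨hB, hC.trans (h4 _ _), hb, hp⟩
    · intro j k hjk hk
      rcases Nat.lt_succ_iff_lt_or_eq.mp hk with h | h
      · have hj : j ≠ t := by omega
        simpa [h.ne, hj] using h2 j k hjk h
      · subst h
        have hj : j ≠ k := by omega
        simp only [Function.update_self, Function.update_of_ne hj]
        rcases h3 j k hjk le_rfl (by omega) B with h | h
        · exact Or.inl (Disjoint.mono_left hC h)
        · refine Or.inr ⟨h.1, le_trans ?_ h.2⟩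
          apply Finset.sum_le_sum_of_subset_of_nonneg
          · exact Finset.inter_subset_inter_left (hC.trans (h4 _ _))
          · intro e _ _
            exact (P j).a0 _ (h1 j hjk).1 e
    · intro j k hj hk hkN B'
      rcases Nat.lt_succ_iff_lt_or_eq.mp hj with h | h
      · simp only [Function.update_of_ne h.ne]
        rcases h3 j k h (by omega) hkN B' with h | h
        · exact Or.inl (Disjoint.mono_left (trim_sub _ _ _ _ _ _ _) h)
        · exact Or.inr h
      · subst h
        simp only [Function.update_self]
        exact trim_or _ _ _ _ _ _ _
    · intro k B'
      exact (trim_sub _ _ _ _ _ _ _).trans (h4 k B')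

theorem thmA_param {ι : Type} [DecidableEq ι] {M : Finset ι} (N s : ℕ) (hs : 1 ≤ s) (hN : 1 ≤ N)
    (r : ℝ) (hrN : r = 1/(N:ℝ)) (P : ℕ → Prof M r)
    (hsm : ∀ k < N, ∀ B ∈ (P k).fam, ∀ e ∈ B, (P k).a B e < bet)
    (δ ε : ℝ) (hδ0 : 0 < δ) (hδ : s * δ ≤ Fmin / 1000) (hε : 0 < ε) (hNe : r ≤ δ * ε)
    (hδε : 100210 * ε ≤ δ * (1/10000))
    (hNs : (N:ℝ) ≤ ((999/1000 : ℝ)⁻¹)^s) :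
    ∃ A : ℕ → Finset ι, (∀ j k, j < k → k < N → Disjoint (A j) (A k)) ∧
      ∀ j < N, ∃ B ∈ (P j).fam, A j ⊆ B ∧ alp ≤ ∑ e ∈ A j, (P j).a B e := by
  obtain ⟨Bp, Cp, S, h1, h2, -⟩ := seq_state N s hs hN r hrN P hsm δ ε hδ0 hδ hε hNe hNs N le_rfl
  refine ⟨fun j => Cp j \ (Finset.Ioo j N).biUnion Cp, ?_, ?_⟩
  · intro j k hjk hk
    rw [Finset.disjoint_left]
    intro e he he'
    simp only [Finset.mem_sdiff, Finset.mem_biUnion, Finset.mem_Ioo, not_exists, not_and] at he he'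
    exact he.2 k ⟨hjk, hk⟩ he'.1
  · intro j hj
    obtain ⟨b1, b2, b3, b4⟩ := h1 j hj
    refine ⟨Bp j, b1, Finset.sdiff_subset.trans b2, ?_⟩
    have nn := (P j).a0 _ b1
    set U := (Finset.Ioo j N).biUnion Cp
    have e1 := Finset.sum_inter_add_sum_sdiff (Cp j) U ((P j).a (Bp j))
    have e2 : ∑ e ∈ Cp j ∩ U, (P j).a (Bp j) e ≤
        ∑ k ∈ Finset.Ioo j N, ∑ e ∈ Cp j ∩ Cp k, (P j).a (Bp j) e := by
      have : Cp j ∩ U = (Finset.Ioo j N).biUnion (fun k => Cp j ∩ Cp k) := by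
        rw [Finset.inter_biUnion]
      rw [this]
      exact sum_biUnion_le' _ _ _ nn
    have pnn : ∀ k, 0 ≤ (P k).p (Cp j) := fun k =>
      Finset.sum_nonneg (fun e _ => (P k).pf_nonneg _ _)
    have e3 : ∀ k ∈ Finset.Ioo j N, ∑ e ∈ Cp j ∩ Cp k, (P j).a (Bp j) e ≤
        ε / δ * (P k).p (Cp j) := by
      intro k hk
      rw [Finset.mem_Ioo] at hk
      rcases h2 j k hk.1 hk.2 with h | ⟨ha, hb⟩
      · rw [Finset.disjoint_iff_inter_eq_empty.mp h.symm, Finset.sum_empty]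
        exact mul_nonneg (by positivity) (pnn k)
      · refine hb.trans ?_
        rw [div_mul_eq_mul_div, le_div_iff₀ hδ0]
        exact mul_le_mul_of_nonneg_left ha hε.le
    have e4 : ∑ k ∈ Finset.Ioo j N, ε / δ * (P k).p (Cp j) ≤ ε / δ * 100210 := by
      rw [← Finset.mul_sum]
      apply mul_le_mul_of_nonneg_left _ (by positivity)
      refine le_trans ?_ b4
      apply Finset.sum_le_sum_of_subset_of_nonneg
      · intro k hk; simp only [Finset.mem_Ioo, Finset.mem_range] at hk ⊢; exact hk.2
      · intro k _ _; exact pnn k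
    have e5 : ε / δ * 100210 ≤ 1/10000 := by
      rw [div_mul_eq_mul_div, div_le_iff₀ hδ0]; linarith
    have e6 := Finset.sum_le_sum e3
    have e7 : bet - 1/10000 = alp := by unfold bet alp; norm_num
    linarith

end APSX

namespace APSX

theorem param_exists : ∃ N0 : ℕ, 1 ≤ N0 ∧ ∀ N : ℕ, N0 ≤ N → ∃ s : ℕ, 1 ≤ s ∧
    2 * 10^16 * (s:ℝ)^2 ≤ N ∧ (N:ℝ) ≤ ((999/1000 : ℝ)⁻¹)^s := by
  have ht := tendsto_pow_const_mul_const_pow_of_abs_lt_one 2 (r := (999/1000:ℝ))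
    (by rw [abs_of_pos] <;> norm_num)
  have hev := ht.eventually (gt_mem_nhds (show (0:ℝ) < 1/(8*10^16) by norm_num))
  obtain ⟨s0, hs0⟩ := Filter.eventually_atTop.mp hev
  set K : ℕ := 2 * 10^16 with hK
  refine ⟨K * (s0+1)^2, Nat.one_le_iff_ne_zero.mpr (by rw [hK]; positivity), ?_⟩
  intro N hN
  set s := Nat.sqrt (N / K) with hsd
  have hKpos : 0 < K := by rw [hK]; positivity
  have h1 : s0 + 1 ≤ s := by
    rw [hsd, Nat.le_sqrt', Nat.le_div_iff_mul_le hKpos]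
    linarith
  refine ⟨s, by omega, ?_, ?_⟩
  · have : s^2 ≤ N / K := Nat.sqrt_le' _
    rw [Nat.le_div_iff_mul_le hKpos] at this
    have h2 : ((s^2 * K : ℕ):ℝ) ≤ N := by exact_mod_cast this
    rw [hK] at h2
    push_cast at h2
    linarith
  · have h3 : N / K < (s+1)^2 := Nat.lt_succ_sqrt' _
    rw [Nat.div_lt_iff_lt_mul hKpos] at h3
    have h4 : (N:ℝ) < ((s+1)^2 * K : ℕ) := by exact_mod_cast h3
    have h5 := hs0 s (by omega)
    have hs1 : (1:ℝ) ≤ s := by exact_mod_cast (by omega : 1 ≤ s)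
    have h6 : (0:ℝ) < (999/1000)^s := by positivity
    have hN0 : (0:ℝ) < N := by
      have : 0 < N := lt_of_lt_of_le (by positivity) hN
      exact_mod_cast this
    rw [inv_pow, le_inv_comm₀ hN0 h6, ← one_div, le_div_iff₀ hN0]
    have h7 : (N:ℝ) ≤ 8 * 10^16 * (s:ℝ)^2 := by
      rw [hK] at h4
      push_cast at h4
      nlinarith
    calc (999/1000:ℝ)^s * N ≤ (999/1000:ℝ)^s * (8 * 10^16 * (s:ℝ)^2) :=
          mul_le_mul_of_nonneg_left h7 h6.le
      _ = 8 * 10^16 * ((s:ℝ)^2 * (999/1000:ℝ)^s) := by ring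
      _ ≤ 8 * 10^16 * (1/(8*10^16)) := mul_le_mul_of_nonneg_left h5.le (by norm_num)
      _ = 1 := by norm_num

theorem thmA : ∃ N0 : ℕ, 1 ≤ N0 ∧ ∀ N : ℕ, N0 ≤ N → ∀ (ι : Type) [DecidableEq ι] (M : Finset ι)
    (r : ℝ) (_ : r = 1/(N:ℝ)) (P : ℕ → Prof M r)
    (_ : ∀ k < N, ∀ B ∈ (P k).fam, ∀ e ∈ B, (P k).a B e < bet),
    ∃ A : ℕ → Finset ι, (∀ j k, j < k → k < N → Disjoint (A j) (A k)) ∧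
      ∀ j < N, ∃ B ∈ (P j).fam, A j ⊆ B ∧ alp ≤ ∑ e ∈ A j, (P j).a B e := by
  obtain ⟨N0, hN0, h⟩ := param_exists
  refine ⟨N0, hN0, ?_⟩
  intro N hN ι _ M r hrN P hsm
  obtain ⟨s, hs, h1, h2⟩ := h N hN
  have hs1 : (1:ℝ) ≤ s := by exact_mod_cast hs
  have hNp : (0:ℝ) < N := by
    have : 0 < N := by omega
    exact_mod_cast this
  refine thmA_param N s hs (by omega) r hrN P hsm (28/100000/s) (28/100000/s/10000/100210)
    (by positivity) ?_ (by positivity) ?_ ?_ h2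
  · unfold Fmin; field_simp; norm_num
  · rw [hrN, div_le_iff₀ hNp]
    have : (28/100000/s * (28/100000/s/10000/100210) * (2 * 10^16 * (s:ℝ)^2) : ℝ) =
      28/100000 * (28/100000/10000/100210) * (2 * 10^16) := by field_simp
    calc (1:ℝ) ≤ 28/100000 * (28/100000/10000/100210) * (2 * 10^16) := by norm_num
      _ = _ := this.symm
      _ ≤ _ := mul_le_mul_of_nonneg_left h1 (by positivity)
  · rw [show 100210 * (28/100000/(s:ℝ)/10000/100210) = 28/100000/s * (1/10000) by field_simp]

end APSX

namespace APSX

theorem easy_phase {ι κ : Type} [DecidableEq ι] [DecidableEq κ] {M : Finset ι} (E : Finset κ)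
    (ρ : ℝ) (hρ : 0 ≤ ρ) (R : κ → Prof M ρ) (Q : Finset ι)
    (hsm : ∀ k ∈ E, ∀ B ∈ (R k).fam, ∀ e ∈ B, (R k).a B e < bet)
    (hF : ∀ k ∈ E, 1 - alp ≤ (R k).F (fun B => B \ Q))
    (f : ι → ℝ) (hf : ∀ e, 0 ≤ f e) (hfM : ∑ e ∈ M, f e ≤ 1)
    (L : ℝ) (hEL : (E.card : ℝ) ≤ L) (hL : L * (L+1) * ρ ≤ 1/40) :
    ∀ T ⊆ E, ∃ C : κ → Finset ι,
      (∀ k ∈ T, Disjoint (C k) Q ∧ ∃ B ∈ (R k).fam, C k ⊆ B ∧ bet ≤ ∑ e ∈ C k, (R k).a B e) ∧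
      (∀ k ∈ T, ∀ l ∈ T, k ≠ l → Disjoint (C k) (C l)) ∧
      ∑ e ∈ T.biUnion C, (∑ k ∈ E, (R k).pf (fun B => B) e + f e) ≤ T.card * ((L+1) * ρ) := by
  intro T
  have hL0 : 0 ≤ L := le_trans (by positivity) hEL
  set g : ι → ℝ := fun e => ∑ k ∈ E, (R k).pf (fun B => B) e + f e with hg
  have hg0 : ∀ e, 0 ≤ g e := fun e =>
    add_nonneg (Finset.sum_nonneg (fun k _ => (R k).pf_nonneg _ _)) (hf e)
  have hgM : ∑ e ∈ M, g e ≤ L + 1 := by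
    rw [hg, Finset.sum_add_distrib, Finset.sum_comm]
    have : ∀ k ∈ E, ∑ e ∈ M, (R k).pf (fun B => B) e = 1 := by
      intro k _
      rw [(R k).sum_pf_M _ (fun B _ => subset_rfl), Prof.F_id]
    rw [Finset.sum_congr rfl this]
    simp only [Finset.sum_const, nsmul_eq_mul, mul_one]
    linarith
  induction T using Finset.induction_on with
  | empty => intro _; exact ⟨fun _ => ∅, by simp, by simp, by simp⟩
  | insert k T hk ih =>
    intro hT
    have hkE : k ∈ E := hT (Finset.mem_insert_self _ _)
    have hTE : T ⊆ E := (Finset.subset_insert _ _).trans hT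
    obtain ⟨C, c1, c2, c3⟩ := ih hTE
    set W := T.biUnion C with hW
    have hWsmall : ∑ e ∈ W, g e ≤ 1/40 := by
      have h1 : (T.card : ℝ) ≤ L := le_trans (by exact_mod_cast Finset.card_le_card hTE) hEL
      have h2 := mul_le_mul_of_nonneg_right h1 (show 0 ≤ (L+1)*ρ by positivity)
      calc _ ≤ _ := c3
        _ ≤ _ := h2
        _ ≤ 1/40 := by linarith
    have hFk : 69/100 ≤ (R k).F (fun B => (B \ Q) \ W) := by
      rw [(R k).F_sdiff (fun B => B \ Q) W]
      have h1 := hF k hkE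
      have h2 : ∑ e ∈ W, (R k).pf (fun B => B \ Q) e ≤ ∑ e ∈ W, g e := by
        apply Finset.sum_le_sum
        intro e _
        calc _ ≤ (R k).pf (fun B => B) e := (R k).pf_mono _ _ (fun B _ => Finset.sdiff_subset) e
          _ ≤ ∑ k ∈ E, (R k).pf (fun B => B) e :=
            Finset.single_le_sum (f := fun k => (R k).pf (fun B => B) e)
              (fun k _ => (R k).pf_nonneg _ _) hkE
          _ ≤ g e := by rw [hg]; have := hf e; dsimp only; linarith
      unfold alp at h1; linarith
    obtain ⟨B, hB, D, hD, hbD, hgD⟩ := (R k).pick (fun B => (B \ Q) \ W) bet (L+1) g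
      (by unfold bet; norm_num) (by unfold bet; norm_num)
      (fun B _ => Finset.sdiff_subset.trans Finset.sdiff_subset)
      (fun B hB e he => hsm k hkE B hB e ((Finset.sdiff_subset.trans Finset.sdiff_subset) he))
      hg0 hρ hgM (by unfold bet; linarith)
    have hgD' : ∑ e ∈ D, g e ≤ (L+1) * ρ := by
      refine hgD.trans ?_
      have h1 : 1 ≤ 3/(4*bet) * ((R k).F (fun B => (B \ Q) \ W) - bet) := by
        unfold bet; linarith
      have h2 : 0 ≤ ρ * (L+1) := by positivity
      calc _ ≤ ρ * (L+1) / 1 := div_le_div_of_nonneg_left h2 one_pos h1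
        _ = _ := by ring
    have hDW : Disjoint D W := Finset.disjoint_of_subset_left hD Finset.sdiff_disjoint
    have hDQ : Disjoint D Q :=
      Finset.disjoint_of_subset_left (hD.trans Finset.sdiff_subset) Finset.sdiff_disjoint
    have hne : ∀ l ∈ T, l ≠ k := fun l hl h => hk (h ▸ hl)
    have hDl : ∀ l ∈ T, Disjoint D (C l) := fun l hl =>
      Finset.disjoint_of_subset_right (Finset.subset_biUnion_of_mem C hl) hDW
    refine ⟨Function.update C k D, ?_, ?_, ?_⟩
    · intro l hl
      rcases Finset.mem_insert.mp hl with h | h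
      · subst h
        simp only [Function.update_self]
        exact ⟨hDQ, B, hB, hD.trans (Finset.sdiff_subset.trans Finset.sdiff_subset), hbD⟩
      · simpa [hne l h] using c1 l h
    · intro l hl m hm hlm
      rcases Finset.mem_insert.mp hl with h | h
      · subst h
        have hm' := Finset.mem_of_mem_insert_of_ne hm hlm.symm
        simpa [hlm.symm] using hDl m hm'
      · rcases Finset.mem_insert.mp hm with h' | h'
        · subst h'
          simpa [hlm] using (hDl l h).symm
        · simpa [hne l h, hne m h'] using c2 l h m h' hlm
    · have : (insert k T).biUnion (Function.update C k D) = D ∪ W := by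
        rw [Finset.biUnion_insert, Function.update_self]
        congr 1
        apply Finset.biUnion_congr rfl
        intro l hl
        rw [Function.update_of_ne (hne l hl)]
      rw [this, Finset.sum_union hDW, Finset.card_insert_of_notMem hk]
      push_cast
      linarith

theorem hard_step {ι κ : Type} [DecidableEq ι] [DecidableEq κ] {M : Finset ι} (u : ℕ) (hu : 1 ≤ u)
    (L : ℝ) (huL : (u:ℝ) ≤ L)
    (ρ : ℝ) (hρ : ρ = 1/(u:ℝ)) (R : κ → Prof M ρ) (Pl : Finset κ)
    (hsm : ∀ j ∈ Pl, ∀ B ∈ (R j).fam, ∀ e ∈ B, (R j).a B e < bet)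
    (t : ℕ) (ht : t < u) (W : Finset ι)
    (hF : ∀ j ∈ Pl, Fh u t ≤ (R j).F (fun B => B \ W)) (i : κ) (hi : i ∈ Pl) :
    ∃ B ∈ (R i).fam, ∃ C ⊆ B \ W, bet ≤ ∑ e ∈ C, (R i).a B e ∧
      ∃ Pl' ⊆ Pl.erase i, (294/1000000 / L) * Pl.card - 1 ≤ Pl'.card ∧
        ∀ j ∈ Pl', Fh u (t+1) ≤ (R j).F (fun B => B \ (W ∪ C)) := by
  have hu' : (0:ℝ) < u := by exact_mod_cast hu
  have hge := Fh_ge u hu t ht.le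
  have hle := Fh_le u hu t ht.le
  have hge1 := Fh_ge u hu (t+1) ht
  set Fx := Fh u t with hFx
  have hFm : (0:ℝ) < Fmin := by unfold Fmin; norm_num
  have hFx0 : 0 < Fx := by linarith
  have hhr : 1/100 ≤ hr Fx := hr_pos hge
  have hhr2 : hr Fx ≤ 2 := by unfold hr bet; linarith
  have hc : (0:ℝ) < Pl.card := by exact_mod_cast Finset.card_pos.mpr ⟨i, hi⟩
  set Fb : ℝ := (1/(Pl.card:ℝ)) * ∑ j ∈ Pl, (R j).F (fun B => B \ W) with hFb
  set g : ι → ℝ := fun e => (1/(Pl.card:ℝ)) * ∑ j ∈ Pl, (R j).pf (fun B => B \ W) e with hg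
  have hg0 : ∀ e, 0 ≤ g e := fun e =>
    mul_nonneg (by positivity) (Finset.sum_nonneg (fun k _ => (R k).pf_nonneg _ _))
  have hgC : ∀ C : Finset ι, ∑ e ∈ C, g e =
      (1/(Pl.card:ℝ)) * ∑ j ∈ Pl, ∑ e ∈ C, (R j).pf (fun B => B \ W) e := by
    intro C
    rw [hg, ← Finset.mul_sum, Finset.sum_comm]
  have hgM : ∑ e ∈ M, g e ≤ Fb := by
    rw [hgC, hFb]
    apply le_of_eq; congr 1
    apply Finset.sum_congr rfl
    intro j _
    exact (R j).sum_pf_M _ (fun B _ => Finset.sdiff_subset)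
  have hFi := hF i hi
  obtain ⟨B, hB, C, hC, hbC, hGC⟩ := (R i).pick (fun B => B \ W) bet Fb g
    (by unfold bet; norm_num) (by unfold bet; norm_num)
    (fun B _ => Finset.sdiff_subset)
    (fun B hB e he => hsm i hi B hB e (Finset.sdiff_subset he))
    hg0 (by rw [hρ]; positivity) hgM (by unfold bet; unfold Fmin at hge; linarith)
  have hFbge : Fx ≤ Fb := by
    rw [hFb, one_div, inv_mul_eq_div, le_div_iff₀ hc]
    calc Fx * Pl.card = ∑ j ∈ Pl, Fx := by simp; ring
      _ ≤ _ := Finset.sum_le_sum hF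
  have hGC' : ∑ e ∈ C, g e ≤ Fb / (u * hr Fx) := by
    refine hGC.trans ?_
    change ρ * Fb / hr ((R i).F (fun B => B \ W)) ≤ _
    have h1 := hr_mono hFi
    generalize (R i).F (fun B => B \ W) = z at h1 ⊢
    rw [hρ, one_div, inv_mul_eq_div, div_div]
    apply div_le_div_of_nonneg_left (by linarith) (by positivity)
    exact mul_le_mul_of_nonneg_left h1 hu'.le
  have hnew : ∀ j, (R j).F (fun B => B \ (W ∪ C)) =
      (R j).F (fun B => B \ W) - ∑ e ∈ C, (R j).pf (fun B => B \ W) e := by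
    intro j
    rw [← (R j).F_sdiff (fun B => B \ W) C]
    apply Prof.F_congr
    intro B _
    rw [Finset.sdiff_union_distrib]; ext e; simp; tauto
  have hstep : Fh u (t+1) = Fx * (1 - Gam / (u * hr Fx)) := rfl
  set z := 1 / (u * hr Fx) with hz
  have hz0 : 0 < z := by positivity
  have hstep' : Fh u (t+1) = Fx * (1 - Gam * z) := by rw [hstep, hz]; ring
  have hGz : Gam * z < 1 := by
    by_contra hcon
    push Not at hcon
    have : Fx * (1 - Gam * z) ≤ 0 := mul_nonpos_of_nonneg_of_nonpos hFx0.le (by linarith)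
    linarith
  have hz1 : z < 1 := by
    unfold Gam at hGz; linarith
  -- sum of new values
  have hsum : Pl.card * (Fx * (1 - z)) ≤ ∑ j ∈ Pl, (R j).F (fun B => B \ (W ∪ C)) := by
    simp only [hnew, Finset.sum_sub_distrib]
    have h1 : ∑ j ∈ Pl, (R j).F (fun B => B \ W) = Pl.card * Fb := by
      rw [hFb, ← mul_assoc, mul_one_div_cancel hc.ne', one_mul]
    have h2 : ∑ j ∈ Pl, ∑ e ∈ C, (R j).pf (fun B => B \ W) e = Pl.card * ∑ e ∈ C, g e := by
      rw [hgC, ← mul_assoc, mul_one_div_cancel hc.ne', one_mul]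
    rw [h1, h2, ← mul_sub]
    apply mul_le_mul_of_nonneg_left _ hc.le
    have h3 : Fb / (u * hr Fx) = Fb * z := by rw [hz]; ring
    have h4 : Fx * (1 - z) ≤ Fb * (1-z) := mul_le_mul_of_nonneg_right hFbge (by linarith)
    linarith
  refine ⟨B, hB, C, hC, hbC,
    (Pl.filter (fun j => Fh u (t+1) ≤ (R j).F (fun B => B \ (W ∪ C)))).erase i,
    Finset.erase_subset_erase _ (Finset.filter_subset _ _), ?_, ?_⟩
  · set G := Pl.filter (fun j => Fh u (t+1) ≤ (R j).F (fun B => B \ (W ∪ C))) with hG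
    have h1 : (G.card : ℝ) - 1 ≤ (G.erase i).card := by
      have := Finset.pred_card_le_card_erase (s := G) (a := i)
      have h2 : G.card ≤ (G.erase i).card + 1 := by omega
      have h3 : (G.card:ℝ) ≤ (G.erase i).card + 1 := by exact_mod_cast h2
      linarith
    have h2 : ∑ j ∈ Pl, (R j).F (fun B => B \ (W ∪ C)) ≤ G.card + Pl.card * Fh u (t+1) := by
      have : ∀ j ∈ Pl, (R j).F (fun B => B \ (W ∪ C)) ≤
          (if Fh u (t+1) ≤ (R j).F (fun B => B \ (W ∪ C)) then 1 else 0) + Fh u (t+1) := by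
        intro j _
        split_ifs with h
        · have := (R j).F_le_one (fun B => B \ (W ∪ C)) (fun B _ => Finset.sdiff_subset)
          linarith
        · linarith
      refine (Finset.sum_le_sum this).trans ?_
      rw [Finset.sum_add_distrib, ← Finset.sum_filter]
      simp only [Finset.sum_const, nsmul_eq_mul, mul_one]
      exact le_rfl
    have h3 : Pl.card * (Fx * (1 - z)) - Pl.card * Fh u (t+1) = Pl.card * (Fx * (Gam - 1) * z) := by
      rw [hstep']; ring
    have hL : 0 < L := by linarith
    have h4 : 294/1000000 / L ≤ Fx * (Gam - 1) * z := by
      have hz2 : 1/(L * 2) ≤ z := by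
        rw [hz]
        apply one_div_le_one_div_of_le (by positivity)
        exact mul_le_mul huL hhr2 (by linarith) hL.le
      have h5 : (588/1000000 : ℝ) ≤ Fx * (Gam - 1) := by
        unfold Gam; unfold Fmin at hge; linarith
      calc 294/1000000 / L = 588/1000000 * (1/(L*2)) := by field_simp; norm_num
        _ ≤ _ := mul_le_mul h5 hz2 (by positivity) (by linarith)
    have h6 := mul_le_mul_of_nonneg_left h4 hc.le
    linarith
  · intro j hj
    exact (Finset.mem_filter.mp (Finset.mem_of_mem_erase hj)).2

theorem hard_phase {ι κ : Type} [DecidableEq ι] [DecidableEq κ] {M : Finset ι} (u : ℕ)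
    (L : ℝ) (huL : (u:ℝ) ≤ L) (hL1 : 1 ≤ L)
    (ρ : ℝ) (hρ : ρ = 1/(u:ℝ)) (R : κ → Prof M ρ) (H : Finset κ) :
    ∀ (Pl : Finset κ) (_ : ∀ j ∈ Pl, ∀ B ∈ (R j).fam, ∀ e ∈ B, (R j).a B e < bet)
    (t : ℕ) (_ : t + H.card ≤ u) (W : Finset ι)
    (_ : ∀ j ∈ Pl, Fh u t ≤ (R j).F (fun B => B \ W))
    (_ : (2 / (294/1000000 / L))^H.card ≤ (Pl.card : ℝ)),
    ∃ (i : κ → κ) (C : κ → Finset ι), (∀ k ∈ H, i k ∈ Pl ∧ Disjoint (C k) W ∧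
      ∃ B ∈ (R (i k)).fam, C k ⊆ B ∧ bet ≤ ∑ e ∈ C k, (R (i k)).a B e) ∧
      (∀ k ∈ H, ∀ l ∈ H, k ≠ l → i k ≠ i l ∧ Disjoint (C k) (C l)) := by
  induction H using Finset.induction_on with
  | empty => intro _ _ _ _ _ _ _; exact ⟨fun k => k, fun _ => ∅, by simp, by simp⟩
  | insert k H hk ih =>
    intro Pl hsm t ht W hF hcard
    rw [Finset.card_insert_of_notMem hk] at ht hcard
    set τ := 294/1000000 / L with hτ
    have hL : 0 < L := by linarith
    have hτ0 : 0 < τ := by positivity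
    have hτ1 : τ ≤ 1 := by
      rw [hτ, div_le_one hL]; linarith
    have h2τ : 1 ≤ 2/τ := by rw [le_div_iff₀ hτ0]; linarith
    have hone : 1 ≤ (2/τ)^H.card := one_le_pow₀ h2τ
    have hpos : 0 < Pl.card := by
      have : (0:ℝ) < Pl.card := lt_of_lt_of_le (by positivity) hcard
      exact_mod_cast this
    obtain ⟨i, hi⟩ := Finset.card_pos.mp hpos
    obtain ⟨B, hB, C, hC, hbC, Pl', hPl', hcard', hF'⟩ := hard_step u (by omega) L huL ρ hρ R Pl hsm t
      (by omega) W hF i hi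
    rw [← hτ] at hcard'
    have hsub : Pl' ⊆ Pl := hPl'.trans (Finset.erase_subset _ _)
    obtain ⟨i', C', h1, h2⟩ := ih Pl' (fun j hj => hsm j (hsub hj)) (t+1) (by omega) (W ∪ C) hF' (by
      refine le_trans ?_ hcard'
      have : τ * (2/τ)^(H.card+1) ≤ τ * Pl.card := mul_le_mul_of_nonneg_left hcard hτ0.le
      have e : τ * (2/τ)^(H.card+1) = 2 * (2/τ)^H.card := by rw [pow_succ]; field_simp
      linarith)
    have hne : ∀ l ∈ H, l ≠ k := fun l hl h => hk (h ▸ hl)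
    have hl1 : ∀ l ∈ H, i ≠ i' l ∧ Disjoint C (C' l) := by
      intro l hl
      obtain ⟨a1, a2, -⟩ := h1 l hl
      refine ⟨fun h => ?_, (Finset.disjoint_of_subset_right Finset.subset_union_right a2).symm⟩
      exact Finset.ne_of_mem_erase (hPl' a1) h.symm
    refine ⟨Function.update i' k i, Function.update C' k C, ?_, ?_⟩
    · intro l hl
      rcases Finset.mem_insert.mp hl with h | h
      · subst h
        simp only [Function.update_self]
        exact ⟨hi, Finset.disjoint_of_subset_left hC Finset.sdiff_disjoint, B, hB,
          hC.trans Finset.sdiff_subset, hbC⟩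
      · simp only [Function.update_of_ne (hne l h)]
        obtain ⟨a1, a2, a3⟩ := h1 l h
        exact ⟨hsub a1, Finset.disjoint_of_subset_right Finset.subset_union_left a2, a3⟩
    · intro l hl m hm hlm
      rcases Finset.mem_insert.mp hl with h | h
      · subst h
        have hm' := Finset.mem_of_mem_insert_of_ne hm hlm.symm
        simpa [hlm.symm] using hl1 m hm'
      · rcases Finset.mem_insert.mp hm with h' | h'
        · subst h'
          simpa [hlm] using ⟨(hl1 l h).1.symm, (hl1 l h).2.symm⟩
        · simpa [hne l h, hne m h'] using h2 l h m h' hlm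

end APSX

namespace APSX

/-- Agent is satisfied by `A`. -/
def Sat {ι : Type} [DecidableEq ι] {M : Finset ι} {r : ℝ} (P : Prof M r) (A : Finset ι) : Prop :=
  ∃ B ∈ P.fam, ∃ C ⊆ A, C ⊆ B ∧ alp ≤ ∑ e ∈ C, P.a B e

/-- A single item satisfies the agent. -/
def Big {ι : Type} [DecidableEq ι] {M : Finset ι} {r : ℝ} (P : Prof M r) (e : ι) : Prop :=
  ∃ B ∈ P.fam, e ∈ B ∧ alp ≤ P.a B e

theorem Big.sat {ι : Type} [DecidableEq ι] {M : Finset ι} {r : ℝ} {P : Prof M r} {e : ι}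
    (h : Big P e) : Sat P {e} := by
  obtain ⟨B, hB, he, ha⟩ := h
  exact ⟨B, hB, {e}, subset_rfl, by simpa using he, by simpa using ha⟩

theorem Big.mem {ι : Type} [DecidableEq ι] {M : Finset ι} {r : ℝ} {P : Prof M r} {e : ι}
    (h : Big P e) : e ∈ M := by
  obtain ⟨B, hB, he, -⟩ := h
  exact P.sub B hB he

theorem max_matching {ι κ : Type} [DecidableEq ι] [DecidableEq κ] [Fintype κ] [Nonempty ι]
    (big : κ → ι → Prop) :
    ∃ (J : Finset κ) (q : κ → ι), Set.InjOn q J ∧ (∀ j ∈ J, big j (q j)) ∧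
      (∀ k ∉ J, ∀ e ∉ J.image q, ¬ big k e) ∧
      (∀ j ∈ J, ∀ k ∉ J, big k (q j) → ∀ e ∉ J.image q, ¬ big j e) := by
  classical
  obtain ⟨J, hJ, hmax⟩ := Finset.exists_max_image
    (Finset.univ.filter (fun J : Finset κ => ∃ q : κ → ι, Set.InjOn q J ∧ ∀ j ∈ J, big j (q j)))
    Finset.card ⟨∅, by simp⟩
  simp only [Finset.mem_filter, Finset.mem_univ, true_and] at hJ hmax
  obtain ⟨q, hq, hb⟩ := hJ
  refine ⟨J, q, hq, hb, ?_, ?_⟩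
  · intro k hk e he hbig
    have hne : ∀ j ∈ J, j ≠ k := fun j hj h => hk (h ▸ hj)
    have hqe : ∀ j ∈ J, q j ≠ e := fun j hj h => he (Finset.mem_image.mpr ⟨j, hj, h⟩)
    have := hmax (insert k J) ⟨Function.update q k e, ?_, ?_⟩
    · rw [Finset.card_insert_of_notMem hk] at this; omega
    · intro x hx y hy hxy
      simp only [Finset.coe_insert, Set.mem_insert_iff, Finset.mem_coe] at hx hy
      rcases hx with rfl | hx <;> rcases hy with rfl | hy
      · rfl
      · simp [hne y hy] at hxy; exact absurd hxy.symm (hqe y hy)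
      · simp [hne x hx] at hxy; exact absurd hxy (hqe x hx)
      · simp [hne x hx, hne y hy] at hxy; exact hq hx hy hxy
    · intro j hj
      rcases Finset.mem_insert.mp hj with rfl | hj
      · simpa using hbig
      · simpa [hne j hj] using hb j hj
  · intro i hi k hk hki e he hbig
    have hne : ∀ j ∈ J, j ≠ k := fun j hj h => hk (h ▸ hj)
    have hqe : ∀ j ∈ J, q j ≠ e := fun j hj h => he (Finset.mem_image.mpr ⟨j, hj, h⟩)
    have := hmax (insert k J) ⟨Function.update (Function.update q i e) k (q i), ?_, ?_⟩
    · rw [Finset.card_insert_of_notMem hk] at this; omega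
    · have hval : ∀ j ∈ J, Function.update (Function.update q i e) k (q i) j =
          if j = i then e else q j := by
        intro j hj
        rw [Function.update_of_ne (hne j hj), Function.update_apply]
      intro x hx y hy hxy
      simp only [Finset.coe_insert, Set.mem_insert_iff, Finset.mem_coe] at hx hy
      rcases hx with rfl | hx <;> rcases hy with rfl | hy
      · rfl
      · rw [hval y hy, Function.update_self] at hxy
        split_ifs at hxy with h
        · exact absurd hxy (hqe i hi)
        · exact absurd (hq hy hi hxy.symm) h
      · rw [hval x hx, Function.update_self] at hxy
        split_ifs at hxy with h
        · exact absurd hxy.symm (hqe i hi)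
        · exact absurd (hq hx hi hxy) h
      · rw [hval x hx, hval y hy] at hxy
        split_ifs at hxy with h h'
        · rw [h, h']
        · exact absurd hxy.symm (hqe y hy)
        · exact absurd hxy (hqe x hx)
        · exact hq hx hy hxy
    · intro j hj
      rcases Finset.mem_insert.mp hj with rfl | hj
      · simpa using hki
      · rw [Function.update_of_ne (hne j hj), Function.update_apply]
        split_ifs with h
        · rw [h]; exact hbig
        · exact hb j hj

theorem restr_exists {ι : Type} [DecidableEq ι] {M : Finset ι} {r : ℝ} (P : Prof M r) (n : ℕ)
    (hr : r = 1/(n:ℝ)) (Q : Finset ι) (u : ℕ) (hu : 1 ≤ u) (h : Q.card + u ≤ n) :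
    ∃ R : Prof M (1/(u:ℝ)), R.a = P.a ∧ ∀ B ∈ R.fam, B ∈ P.fam ∧ Disjoint B Q := by
  have hu' : (0:ℝ) < u := by exact_mod_cast hu
  have hn' : (0:ℝ) < n := by
    have : 0 < n := by omega
    exact_mod_cast this
  have e : r / ((u:ℝ)/n) = 1/(u:ℝ) := by rw [hr]; field_simp
  rw [← e]
  refine ⟨P.restrict (fun B => Disjoint B Q) ((u:ℝ)/n) (by positivity) (by rw [hr]; positivity) ?_,
    rfl, ?_⟩
  · refine le_trans ?_ (P.mass_disjoint Q)
    rw [hr, div_le_iff₀ hn']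
    have h2 : (Q.card:ℝ) + u ≤ n := by exact_mod_cast h
    have : (1 - Q.card * (1/(n:ℝ))) * n = n - Q.card := by field_simp
    linarith
  · intro B hB
    exact Finset.mem_filter.mp hB

/-- Weaken the marginal bound. -/
def Prof.weaken {ι : Type} [DecidableEq ι] {M : Finset ι} {r r' : ℝ} (P : Prof M r) (h : r ≤ r') :
    Prof M r' where
  fam := P.fam
  lam := P.lam
  a := P.a
  sub := P.sub
  lam0 := P.lam0
  a0 := P.a0
  asum := P.asum
  lsum := P.lsum
  marg := fun e => (P.marg e).trans h

theorem pf_le {ι : Type} [DecidableEq ι] {M : Finset ι} {r : ℝ} (P : Prof M r) (e : ι) (c : ℝ)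
    (hc : 0 ≤ c) (h : ∀ B ∈ P.fam, e ∈ B → P.a B e ≤ c) : P.pf (fun B => B) e ≤ c * r := by
  calc P.pf (fun B => B) e ≤ ∑ B ∈ P.fam, c * (if e ∈ B then P.lam B else 0) := by
        apply Finset.sum_le_sum
        intro B hB
        split_ifs with he
        · rw [mul_comm]; exact mul_le_mul_of_nonneg_right (h B hB he) (P.lam0 B hB)
        · simp
    _ ≤ _ := by rw [← Finset.mul_sum]; exact mul_le_mul_of_nonneg_left (P.marg e) hc

theorem easy_prof {ι : Type} [DecidableEq ι] {M : Finset ι} {r : ℝ} (P : Prof M r) (n : ℕ)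
    (hr : r = 1/(n:ℝ)) (Q Qk : Finset ι) (hQk : Qk ⊆ Q) (hQn : Q.card ≤ n)
    (hsmall : ∀ e ∉ Qk, ¬ Big P e) (ρ : ℝ) (hlt : Qk.card < n)
    (hρ : 1/((n - Qk.card : ℕ):ℝ) ≤ ρ) :
    ∃ R : Prof M ρ, R.a = P.a ∧ (∀ B ∈ R.fam, B ∈ P.fam ∧ Disjoint B Qk) ∧
      (∀ B ∈ R.fam, ∀ e ∈ B, R.a B e < bet) ∧ 1 - alp ≤ R.F (fun B => B \ Q) := by
  obtain ⟨R, h1, h2⟩ := restr_exists P n hr Qk (n - Qk.card) (by omega) (by omega)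
  have hal : (0:ℝ) ≤ alp := by unfold alp; norm_num
  have hsm : ∀ B ∈ R.fam, ∀ e ∈ B, R.a B e < alp := by
    intro B hB e he
    by_contra hc
    push Not at hc
    rw [h1] at hc
    exact hsmall e (Finset.disjoint_left.mp (h2 B hB).2 he) ⟨B, (h2 B hB).1, he, hc⟩
  refine ⟨R.weaken hρ, h1, h2, ?_, ?_⟩
  · intro B hB e he
    exact lt_trans (hsm B hB e he) (by unfold alp bet; norm_num)
  · change 1 - alp ≤ R.F (fun B => B \ Q)
    rw [R.F_sdiff (fun B => B) Q, Prof.F_id]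
    have h3 : ∑ e ∈ Q, R.pf (fun B => B) e = ∑ e ∈ Q \ Qk, R.pf (fun B => B) e := by
      rw [← Finset.sum_sdiff hQk]
      have : ∑ e ∈ Qk, R.pf (fun B => B) e = 0 := by
        apply Finset.sum_eq_zero
        intro e he
        apply Finset.sum_eq_zero
        intro B hB
        rw [if_neg, mul_zero]
        exact Finset.disjoint_right.mp (h2 B hB).2 he
      rw [this, add_zero]
    have h4 : ∑ e ∈ Q \ Qk, R.pf (fun B => B) e ≤ alp := by
      calc _ ≤ ∑ e ∈ Q \ Qk, alp * (1/((n - Qk.card : ℕ):ℝ)) := by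
            apply Finset.sum_le_sum
            intro e _
            exact pf_le R e alp hal (fun B hB he => (hsm B hB e he).le)
        _ = alp * ((Q \ Qk).card * (1/((n - Qk.card : ℕ):ℝ))) := by simp; ring
        _ ≤ alp * 1 := by
            apply mul_le_mul_of_nonneg_left _ hal
            have : 0 < n - Qk.card := by omega
            have h5 : (0:ℝ) < ((n - Qk.card : ℕ):ℝ) := by exact_mod_cast this
            rw [mul_one_div, div_le_one h5]
            rw [Finset.card_sdiff_of_subset hQk]
            exact_mod_cast Nat.sub_le_sub_right hQn _
        _ = alp := mul_one _
    linarith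

theorem pool_large {κ : Type} [DecidableEq κ] (J H : Finset κ) (G : κ → κ → Prop) [DecidableRel G]
    (n N0 : ℕ) (hN0 : 1 ≤ N0) (hJ : J.card ≤ n) (hH : H.card ≤ N0) (hne : H.Nonempty)
    (hard : ∀ k ∈ H, 4*N0*n < n + 4*N0*(J.filter (fun j => G k j)).card) :
    n ≤ 2 * (J.filter (fun j => ∀ k ∈ H, G k j)).card := by
  have h1 : J \ J.filter (fun j => ∀ k ∈ H, G k j) ⊆
      H.biUnion (fun k => J \ J.filter (fun j => G k j)) := by
    intro j hj
    simp only [Finset.mem_sdiff, Finset.mem_filter, not_and, Finset.mem_biUnion] at hj ⊢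
    obtain ⟨a, b⟩ := hj
    have := b a
    push Not at this
    obtain ⟨k, hk, hg⟩ := this
    exact ⟨k, hk, a, fun _ => hg⟩
  have h2 : ∀ k ∈ H, 4*N0*(J \ J.filter (fun j => G k j)).card ≤ n := by
    intro k hk
    rw [Finset.card_sdiff_of_subset (Finset.filter_subset _ _), Nat.mul_sub]
    have := hard k hk
    have h3 : 4*N0*J.card ≤ 4*N0*n := Nat.mul_le_mul_left _ hJ
    omega
  have h3 : 4*N0*(J \ J.filter (fun j => ∀ k ∈ H, G k j)).card ≤ N0 * n := by
    calc _ ≤ 4*N0*(H.biUnion (fun k => J \ J.filter (fun j => G k j))).card :=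
          Nat.mul_le_mul_left _ (Finset.card_le_card h1)
      _ ≤ 4*N0*∑ k ∈ H, (J \ J.filter (fun j => G k j)).card :=
          Nat.mul_le_mul_left _ Finset.card_biUnion_le
      _ = ∑ k ∈ H, 4*N0*(J \ J.filter (fun j => G k j)).card := by rw [Finset.mul_sum]
      _ ≤ ∑ k ∈ H, n := Finset.sum_le_sum h2
      _ = H.card * n := by simp
      _ ≤ _ := Nat.mul_le_mul_right _ hH
  have h4 : 4*(J \ J.filter (fun j => ∀ k ∈ H, G k j)).card ≤ n := by
    have : N0 * (4*(J \ J.filter (fun j => ∀ k ∈ H, G k j)).card) ≤ N0 * n := by linarith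
    exact Nat.le_of_mul_le_mul_left this (by omega)
  rw [Finset.card_sdiff_of_subset (Finset.filter_subset _ _)] at h4
  obtain ⟨k, hk⟩ := hne
  have h5 := hard k hk
  have h6 : (J.filter (fun j => G k j)).card ≤ J.card := Finset.card_filter_le _ _
  have h7 : 4*N0*n < n + 4*N0*J.card := lt_of_lt_of_le h5 (by
    have := Nat.mul_le_mul_left (4*N0) h6; omega)
  have h8 : 3 * n ≤ 4 * J.card := by
    by_contra hc
    push Not at hc
    have : 4*J.card + 1 ≤ 3*n := hc
    have h9 : N0*(4*J.card + 1) ≤ N0*(3*n) := Nat.mul_le_mul_left _ this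
    have h10 : n ≤ N0 * n := Nat.le_mul_of_pos_left _ hN0
    nlinarith
  omega

end APSX

namespace APSX

theorem caseA {ι κ : Type} [DecidableEq ι] [DecidableEq κ] [Fintype κ] {M : Finset ι} {r : ℝ}
    (P : κ → Prof M r) (J : Finset κ) (q : κ → ι) (hq : Set.InjOn q J)
    (hb : ∀ j ∈ J, Big (P j) (q j)) (hm1 : ∀ k ∉ J, ∀ e ∉ J.image q, ¬ Big (P k) e)
    (U : Finset κ) (hU : ∀ k, k ∈ U ↔ k ∉ J) (hu : 1 ≤ U.card)
    (R : κ → Prof M (1/(U.card:ℝ))) (hRa : ∀ k, (R k).a = (P k).a)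
    (hRf : ∀ k, ∀ B ∈ (R k).fam, B ∈ (P k).fam ∧ Disjoint B (J.image q))
    (hA : ∀ (P : ℕ → Prof M (1/(U.card:ℝ)))
      (_ : ∀ k < U.card, ∀ B ∈ (P k).fam, ∀ e ∈ B, (P k).a B e < bet),
      ∃ A : ℕ → Finset ι, (∀ j k, j < k → k < U.card → Disjoint (A j) (A k)) ∧
      ∀ j < U.card, ∃ B ∈ (P j).fam, A j ⊆ B ∧ alp ≤ ∑ e ∈ A j, (P j).a B e) :
    ∃ A : κ → Finset ι, (∀ i j, i ≠ j → Disjoint (A i) (A j)) ∧ (∀ i, A i ⊆ M) ∧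
      ∀ i, Sat (P i) (A i) := by
  classical
  obtain ⟨k0, hk0⟩ := Finset.card_pos.mp hu
  set φ := U.equivFin with hφ
  have hsm : ∀ k ∈ U, ∀ B ∈ (R k).fam, ∀ e ∈ B, (R k).a B e < bet := by
    intro k hk B hB e he
    have hal : alp < bet := by unfold alp bet; norm_num
    refine lt_trans ?_ hal
    by_contra hc
    push Not at hc
    rw [hRa] at hc
    exact hm1 k ((hU k).mp hk) e (Finset.disjoint_left.mp (hRf k B hB).2 he)
      ⟨B, (hRf k B hB).1, he, hc⟩
  obtain ⟨A, hA1, hA2⟩ := hA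
    (fun t => if h : t < U.card then R (φ.symm ⟨t, h⟩ : U) else R k0) (by
      intro t ht
      simp only [ht, dif_pos]
      exact hsm _ (φ.symm ⟨t, ht⟩).2)
  have hA3 : ∀ k (hk : k ∈ U), ∃ B ∈ (R k).fam, A (φ ⟨k, hk⟩) ⊆ B ∧
      alp ≤ ∑ e ∈ A (φ ⟨k, hk⟩), (R k).a B e := by
    intro k hk
    have := hA2 (φ ⟨k, hk⟩) (φ ⟨k, hk⟩).2
    simpa using this
  have hA4 : ∀ k (hk : k ∈ U), Disjoint (A (φ ⟨k, hk⟩)) (J.image q) := by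
    intro k hk
    obtain ⟨B, hB, hs, -⟩ := hA3 k hk
    exact Finset.disjoint_of_subset_left hs (hRf k B hB).2
  refine ⟨fun k => if h : k ∈ U then A (φ ⟨k, h⟩) else {q k}, ?_, ?_, ?_⟩
  · intro i j hij
    by_cases hi : i ∈ U <;> by_cases hj : j ∈ U
    · simp only [hi, hj, dif_pos]
      have hne : (φ ⟨i, hi⟩ : ℕ) ≠ φ ⟨j, hj⟩ := by
        intro h
        have h1 := φ.injective (Fin.ext h)
        exact hij (congrArg Subtype.val h1)
      rcases lt_or_gt_of_ne hne with h | h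
      · exact hA1 _ _ h (φ ⟨j, hj⟩).2
      · exact (hA1 _ _ h (φ ⟨i, hi⟩).2).symm
    · simp only [hi, hj, dif_pos, dif_neg, not_false_iff]
      have hjJ : j ∈ J := by by_contra h; exact hj ((hU j).mpr h)
      exact Finset.disjoint_of_subset_right
        (by simpa using ⟨j, hjJ, rfl⟩) (hA4 i hi)
    · simp only [hi, hj, dif_pos, dif_neg, not_false_iff]
      have hiJ : i ∈ J := by by_contra h; exact hi ((hU i).mpr h)
      exact (Finset.disjoint_of_subset_right
        (by simpa using ⟨i, hiJ, rfl⟩) (hA4 j hj)).symm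
    · simp only [hi, hj, dif_neg, not_false_iff]
      have hjJ : j ∈ J := by by_contra h; exact hj ((hU j).mpr h)
      have hiJ : i ∈ J := by by_contra h; exact hi ((hU i).mpr h)
      rw [Finset.disjoint_singleton]
      exact fun h => hij (hq hiJ hjJ h)
  · intro i
    by_cases hi : i ∈ U
    · simp only [hi, dif_pos]
      obtain ⟨B, hB, hs, -⟩ := hA3 i hi
      exact hs.trans ((R i).sub B hB)
    · simp only [hi, dif_neg, not_false_iff]
      have hiJ : i ∈ J := by by_contra h; exact hi ((hU i).mpr h)
      simpa using (hb i hiJ).mem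
  · intro i
    by_cases hi : i ∈ U
    · simp only [hi, dif_pos]
      obtain ⟨B, hB, hs, h1⟩ := hA3 i hi
      rw [hRa] at h1
      exact ⟨B, (hRf i B hB).1, _, subset_rfl, hs, h1⟩
    · simp only [hi, dif_neg, not_false_iff]
      have hiJ : i ∈ J := by by_contra h; exact hi ((hU i).mpr h)
      exact (hb i hiJ).sat

/-- Assembling the allocation in the case of few unmatched agents. -/
theorem assemble {ι κ : Type} [DecidableEq ι] [DecidableEq κ] [Fintype κ] {M : Finset ι} {r : ℝ}
    (P : κ → Prof M r) (J E H : Finset κ) (q : κ → ι) (hq : Set.InjOn q J)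
    (hb : ∀ j ∈ J, Big (P j) (q j)) (hcov : ∀ k, k ∈ J ∨ k ∈ E ∨ k ∈ H)
    (hJE : ∀ k ∈ J, k ∉ E) (hJH : ∀ k ∈ J, k ∉ H) (hEH : ∀ k ∈ E, k ∉ H)
    (Ce : κ → Finset ι) (hCe : ∀ k ∈ E, Disjoint (Ce k) (J.image q) ∧
      ∃ B ∈ (P k).fam, Ce k ⊆ B ∧ bet ≤ ∑ e ∈ Ce k, (P k).a B e)
    (hCe2 : ∀ k ∈ E, ∀ l ∈ E, k ≠ l → Disjoint (Ce k) (Ce l))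
    (i : κ → κ) (Ch : κ → Finset ι)
    (hi : ∀ k ∈ H, i k ∈ J ∧ Big (P k) (q (i k)) ∧ Disjoint (Ch k) (E.biUnion Ce) ∧
      Disjoint (Ch k) (J.image q) ∧
      ∃ B ∈ (P (i k)).fam, Ch k ⊆ B ∧ bet ≤ ∑ e ∈ Ch k, (P (i k)).a B e)
    (hi2 : ∀ k ∈ H, ∀ l ∈ H, k ≠ l → i k ≠ i l ∧ Disjoint (Ch k) (Ch l)) :
    ∃ A : κ → Finset ι, (∀ i j, i ≠ j → Disjoint (A i) (A j)) ∧ (∀ i, A i ⊆ M) ∧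
      ∀ i, Sat (P i) (A i) := by
  classical
  have hal : alp ≤ bet := by unfold alp bet; norm_num
  have hform : ∀ a, ∃ X : Finset ι, X ⊆ M ∧ Sat (P a) X ∧
      ((∃ j ∈ J, X = {q j} ∧ ((a ∈ H ∧ j = i a) ∨ (a = j ∧ ∀ k ∈ H, i k ≠ a))) ∨
       (a ∈ E ∧ X = Ce a) ∨ (∃ k ∈ H, i k = a ∧ X = Ch k)) := by
    intro a
    rcases hcov a with h | h | h
    · by_cases hk : ∃ k ∈ H, i k = a
      · obtain ⟨k, hk, rfl⟩ := hk
        obtain ⟨-, -, -, -, B, hB, hs, hv⟩ := hi k hk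
        exact ⟨Ch k, hs.trans ((P _).sub B hB), ⟨B, hB, _, subset_rfl, hs, hal.trans hv⟩,
          Or.inr (Or.inr ⟨k, hk, rfl, rfl⟩)⟩
      · push Not at hk
        exact ⟨{q a}, by simpa using (hb a h).mem, (hb a h).sat,
          Or.inl ⟨a, h, rfl, Or.inr ⟨rfl, hk⟩⟩⟩
    · obtain ⟨-, B, hB, hs, hv⟩ := hCe a h
      exact ⟨Ce a, hs.trans ((P _).sub B hB), ⟨B, hB, _, subset_rfl, hs, hal.trans hv⟩,
        Or.inr (Or.inl ⟨h, rfl⟩)⟩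
    · obtain ⟨h1, h2, -⟩ := hi a h
      exact ⟨{q (i a)}, by simpa using h2.mem, h2.sat, Or.inl ⟨i a, h1, rfl, Or.inl ⟨h, rfl⟩⟩⟩
  choose A hAM hAS hA using hform
  refine ⟨A, ?_, hAM, hAS⟩
  have single : ∀ j ∈ J, {q j} ⊆ J.image q := by
    intro j hj; simpa using ⟨j, hj, rfl⟩
  intro a b hab
  rcases hA a with ⟨j, hj, ha, hja⟩ | ⟨hE, ha⟩ | ⟨k, hk, hik, ha⟩ <;>
  rcases hA b with ⟨l, hl, hb', hlb⟩ | ⟨hE', hb'⟩ | ⟨m, hm, him, hb'⟩ <;> rw [ha, hb']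
  · rw [Finset.disjoint_singleton]
    intro h
    have hjl := hq hj hl h
    rcases hja with ⟨h1, h2⟩ | ⟨h1, h2⟩ <;> rcases hlb with ⟨h3, h4⟩ | ⟨h3, h4⟩
    · exact (hi2 a h1 b h3 hab).1 (by rw [← h2, ← h4, hjl])
    · exact h4 a h1 (by rw [← h2, hjl, h3])
    · exact h2 b h3 (by rw [← h4, ← hjl, h1])
    · exact hab (by rw [h1, h3, hjl])
  · exact (Finset.disjoint_of_subset_right (single j hj) (hCe b hE').1).symm
  · exact (Finset.disjoint_of_subset_right (single j hj) (hi m hm).2.2.2.1).symm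
  · exact Finset.disjoint_of_subset_right (single l hl) (hCe a hE).1
  · exact hCe2 a hE b hE' hab
  · exact (Finset.disjoint_of_subset_right (Finset.subset_biUnion_of_mem Ce hE)
      (hi m hm).2.2.1).symm
  · exact Finset.disjoint_of_subset_right (single l hl) (hi k hk).2.2.2.1
  · exact Finset.disjoint_of_subset_right (Finset.subset_biUnion_of_mem Ce hE')
      (hi k hk).2.2.1
  · apply (hi2 k hk m hm _).2
    rintro rfl
    exact hab (hik.symm.trans him)

end APSX

namespace APSX

theorem div_mul_le_one_x (c : ℝ) : 1 / c * c ≤ 1 := by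
  by_cases h : c = 0
  · simp [h]
  · rw [one_div, inv_mul_cancel₀ h]

theorem caseB {ι κ : Type} [DecidableEq ι] [DecidableEq κ] [Fintype κ] {M : Finset ι} {r : ℝ}
    (P : κ → Prof M r) (n N0 : ℕ) (hr : r = 1/(n:ℝ)) (hN0 : 1 ≤ N0)
    (hn1 : 8000 * N0^2 * (N0+1) ≤ n)
    (hn2 : 4 * (2 / (294/1000000 / (N0:ℝ)))^N0 ≤ (n:ℝ))
    (J : Finset κ) (q : κ → ι) (hq : Set.InjOn q J)
    (hb : ∀ j ∈ J, Big (P j) (q j)) (hm1 : ∀ k ∉ J, ∀ e ∉ J.image q, ¬ Big (P k) e)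
    (hm2 : ∀ j ∈ J, ∀ k ∉ J, Big (P k) (q j) → ∀ e ∉ J.image q, ¬ Big (P j) e)
    (U : Finset κ) (hU : ∀ k, k ∈ U ↔ k ∉ J) (hu : 1 ≤ U.card) (huN : U.card ≤ N0)
    (hJU : J.card + U.card ≤ n) :
    ∃ A : κ → Finset ι, (∀ i j, i ≠ j → Disjoint (A i) (A j)) ∧ (∀ i, A i ⊆ M) ∧
      ∀ i, Sat (P i) (A i) := by
  classical
  have hQc : (J.image q).card = J.card := Finset.card_image_of_injOn hq
  have hn0 : 1 ≤ n := by omega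
  have hnR : (0:ℝ) < n := by exact_mod_cast hn0
  have hN0R : (1:ℝ) ≤ N0 := by exact_mod_cast hN0
  obtain ⟨Hd, hHd⟩ : ∃ Hd : Finset κ, Hd = U.filter (fun k => 4*N0*n < n + 4*N0*(J.filter (fun j => Big (P k) (q j))).card) := ⟨_, rfl⟩
  obtain ⟨E, hE⟩ : ∃ E : Finset κ, E = U \ Hd := ⟨_, rfl⟩
  have hHU : Hd ⊆ U := by rw [hHd]; exact Finset.filter_subset _ _
  have hEU : E ⊆ U := by rw [hE]; exact Finset.sdiff_subset
  have hHc : Hd.card ≤ U.card := Finset.card_le_card hHU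
  have hEc : E.card ≤ U.card := Finset.card_le_card hEU
  have hρ0 : (0:ℝ) ≤ 4 * N0 / n := by positivity
  -- easy profiles
  have hRe : ∀ k, ∃ R : Prof M (4 * (N0:ℝ) / n), k ∈ E → (R.a = (P k).a ∧
      (∀ B ∈ R.fam, B ∈ (P k).fam) ∧
      (∀ B ∈ R.fam, ∀ e ∈ B, R.a B e < bet) ∧ 1 - alp ≤ R.F (fun B => B \ (J.image q))) := by
    intro k
    by_cases hk : k ∈ E
    · have hkU : k ∈ U := hEU hk
      have hkJ : k ∉ J := (hU k).1 hkU
      have hkH : k ∉ Hd := by rw [hE] at hk; exact (Finset.mem_sdiff.1 hk).2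
      have hle : n + 4*N0*(J.filter (fun j => Big (P k) (q j))).card ≤ 4*N0*n := by
        by_contra hc
        exact hkH (by rw [hHd]; exact Finset.mem_filter.2 ⟨hkU, by omega⟩)
      obtain ⟨Jk, hJk⟩ : ∃ Jk, Jk = J.filter (fun j => Big (P k) (q j)) := ⟨_, rfl⟩
      rw [← hJk] at hle
      have hJkJ : Jk ⊆ J := by rw [hJk]; exact Finset.filter_subset _ _
      have hc : (Jk.image q).card = Jk.card :=
        Finset.card_image_of_injOn (hq.mono (by exact_mod_cast hJkJ))
      have hlt : Jk.card < n := by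
        by_contra hcon
        have : 4*N0*n ≤ 4*N0*Jk.card := Nat.mul_le_mul_left _ (by omega)
        omega
      obtain ⟨R, h1, h2, h3, h4⟩ := easy_prof (P k) n hr (J.image q) (Jk.image q)
        (Finset.image_subset_image hJkJ) (by omega)
        (by
          intro e he hB
          by_cases heQ : e ∈ J.image q
          · obtain ⟨j, hj, rfl⟩ := Finset.mem_image.1 heQ
            exact he (Finset.mem_image_of_mem q (by rw [hJk]; exact Finset.mem_filter.2 ⟨hj, hB⟩))
          · exact hm1 k hkJ e heQ hB) (4 * (N0:ℝ) / n) (by omega)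
        (by
          rw [hc]
          have hpos : (0:ℝ) < ((n - Jk.card : ℕ):ℝ) := by
            exact_mod_cast Nat.sub_pos_of_lt hlt
          rw [div_le_div_iff₀ hpos hnR, Nat.cast_sub hlt.le]
          have : (n:ℝ) + 4*N0*Jk.card ≤ 4*N0*n := by exact_mod_cast hle
          linarith)
      exact ⟨R, fun _ => ⟨h1, fun B hB => (h2 B hB).1, h3, h4⟩⟩
    · refine ⟨(P k).weaken ?_, fun h => absurd h hk⟩
      rw [hr]
      exact div_le_div_of_nonneg_right (by linarith) hnR.le
  choose Re hRe using hRe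
  -- pool profiles
  have hRp : ∀ k, ∃ R : Prof M (1/(U.card:ℝ)), R.a = (P k).a ∧
      ∀ B ∈ R.fam, B ∈ (P k).fam ∧ Disjoint B (J.image q) := fun k =>
    restr_exists (P k) n hr (J.image q) U.card hu (by omega)
  choose R hRa hRf using hRp
  obtain ⟨Pool, hPool⟩ : ∃ Pool : Finset κ, Pool = J.filter (fun j => ∀ k ∈ Hd, Big (P k) (q j)) := ⟨_, rfl⟩
  have hpfM : ∀ j, ∑ e ∈ M, (R j).pf (fun B => B) e = 1 := fun j => by
    rw [(R j).sum_pf_M _ (fun B _ => Finset.Subset.refl _), (R j).F_id]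
  have hLL : (N0:ℝ) * (N0 + 1) * (4 * N0 / n) ≤ 1/2000 := by
    have h : (8000:ℝ) * N0^2 * (N0+1) ≤ n := by exact_mod_cast hn1
    rw [← mul_div_assoc, div_le_iff₀ hnR]
    nlinarith
  obtain ⟨Ce, hCe, hCe2, hCes⟩ := easy_phase E (4 * (N0:ℝ) / n) hρ0 Re (J.image q)
    (fun k hk => (hRe k hk).2.2.1) (fun k hk => (hRe k hk).2.2.2)
    (fun e => (1/(Pool.card:ℝ)) * ∑ j ∈ Pool, (R j).pf (fun B => B) e)
    (fun e => mul_nonneg (by positivity) (Finset.sum_nonneg fun j _ => (R j).pf_nonneg _ _))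
    (by
      rw [← Finset.mul_sum, Finset.sum_comm]
      simp only [hpfM, Finset.sum_const, nsmul_eq_mul, mul_one]
      exact div_mul_le_one_x _) (N0:ℝ) (by exact_mod_cast hEc.trans huN)
      (hLL.trans (by norm_num)) E (Finset.Subset.refl _)
  have hCe' : ∀ k ∈ E, Disjoint (Ce k) (J.image q) ∧
      ∃ B ∈ (P k).fam, Ce k ⊆ B ∧ bet ≤ ∑ e ∈ Ce k, (P k).a B e := by
    intro k hk
    obtain ⟨h1, B, hB, h2, h3⟩ := hCe k hk
    obtain ⟨g1, g2, -⟩ := hRe k hk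
    exact ⟨h1, B, g2 B hB, h2, by rw [← g1]; exact h3⟩
  have hcov : ∀ k, k ∈ J ∨ k ∈ E ∨ k ∈ Hd := by
    intro k
    by_cases h : k ∈ J
    · exact Or.inl h
    · by_cases h' : k ∈ Hd
      · exact Or.inr (Or.inr h')
      · exact Or.inr (Or.inl (by rw [hE]; exact Finset.mem_sdiff.2 ⟨(hU k).2 h, h'⟩))
  have hJE : ∀ k ∈ J, k ∉ E := fun k hk h => (hU k).1 (hEU h) hk
  have hJH : ∀ k ∈ J, k ∉ Hd := fun k hk h => (hU k).1 (hHU h) hk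
  have hEH : ∀ k ∈ E, k ∉ Hd := fun k hk => by rw [hE] at hk; exact (Finset.mem_sdiff.1 hk).2
  rcases Hd.eq_empty_or_nonempty with hemp | hne
  · exact assemble P J E Hd q hq hb hcov hJE hJH hEH Ce hCe' hCe2 id Ce
      (by rw [hemp]; intro k hk; simp at hk) (by rw [hemp]; intro k hk; simp at hk)
  obtain ⟨W, hW⟩ : ∃ W, W = E.biUnion Ce := ⟨_, rfl⟩
  have hlarge : n ≤ 2 * Pool.card := by
    rw [hPool]
    convert pool_large J Hd (fun k j => Big (P k) (q j)) n N0 hN0 (by omega) (by omega) hne ?_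
    intro k hk
    rw [hHd] at hk
    exact (Finset.mem_filter.1 hk).2
  have hPpos : (0:ℝ) < Pool.card := by
    have : 0 < Pool.card := by omega
    exact_mod_cast this
  -- total loss
  have hloss : ∑ j ∈ Pool, ∑ e ∈ W, (R j).pf (fun B => B) e ≤ Pool.card * (1/2000) := by
    have h1 : ∑ e ∈ W, (1/(Pool.card:ℝ)) * ∑ j ∈ Pool, (R j).pf (fun B => B) e ≤ 1/2000 := by
      calc _ ≤ ∑ e ∈ W, (∑ k ∈ E, (Re k).pf (fun B => B) e
              + (1/(Pool.card:ℝ)) * ∑ j ∈ Pool, (R j).pf (fun B => B) e) := by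
            apply Finset.sum_le_sum
            intro e _
            have : 0 ≤ ∑ k ∈ E, (Re k).pf (fun B => B) e :=
              Finset.sum_nonneg fun k _ => (Re k).pf_nonneg _ _
            linarith
        _ ≤ E.card * ((N0+1) * (4 * N0 / n)) := by rw [hW]; exact hCes
        _ ≤ N0 * ((N0+1) * (4 * N0 / n)) := by
            apply mul_le_mul_of_nonneg_right _ (by positivity)
            exact_mod_cast hEc.trans huN
        _ ≤ 1/2000 := by rw [← mul_assoc]; exact hLL
    rw [← Finset.mul_sum, Finset.sum_comm] at h1
    rw [one_div, inv_mul_le_iff₀ hPpos] at h1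
    exact h1
  obtain ⟨P0, hP0⟩ : ∃ P0 : Finset κ, P0 = Pool.filter (fun j => ∑ e ∈ W, (R j).pf (fun B => B) e ≤ 1/1000) := ⟨_, rfl⟩
  have hP0P : P0 ⊆ Pool := by rw [hP0]; exact Finset.filter_subset _ _
  have hP0c : (Pool.card:ℝ) ≤ 2 * P0.card := by
    have h1 : ((Pool \ P0).card : ℝ) * (1/1000) ≤ Pool.card * (1/2000) := by
      calc ((Pool \ P0).card : ℝ) * (1/1000) = ∑ j ∈ Pool \ P0, (1/1000:ℝ) := by simp
        _ ≤ ∑ j ∈ Pool \ P0, ∑ e ∈ W, (R j).pf (fun B => B) e := by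
            apply Finset.sum_le_sum
            intro j hj
            rw [hP0, Finset.mem_sdiff, Finset.mem_filter] at hj
            by_contra hc
            exact hj.2 ⟨hj.1, (not_le.1 hc).le⟩
        _ ≤ ∑ j ∈ Pool, ∑ e ∈ W, (R j).pf (fun B => B) e :=
            Finset.sum_le_sum_of_subset_of_nonneg Finset.sdiff_subset
              (fun j _ _ => Finset.sum_nonneg fun e _ => (R j).pf_nonneg _ _)
        _ ≤ _ := hloss
    have h2 : ((Pool \ P0).card : ℝ) + P0.card = Pool.card := by
      exact_mod_cast Finset.card_sdiff_add_card_eq_card hP0P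
    linarith
  have hcard : (2 / (294/1000000 / (N0:ℝ)))^Hd.card ≤ (P0.card : ℝ) := by
    have hx : 1 ≤ 2 / (294/1000000 / (N0:ℝ)) := by
      rw [le_div_iff₀ (by positivity), one_mul, div_le_iff₀ (by positivity)]
      linarith
    have h1 := pow_le_pow_right₀ hx (hHc.trans huN)
    have h2 : (n:ℝ) ≤ 2 * Pool.card := by exact_mod_cast hlarge
    linarith
  obtain ⟨k0, hk0⟩ := hne
  have hk0J : k0 ∉ J := (hU k0).1 (hHU hk0)
  have hPoolJ : ∀ j ∈ Pool, j ∈ J ∧ ∀ k ∈ Hd, Big (P k) (q j) := by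
    intro j hj
    rw [hPool] at hj
    exact Finset.mem_filter.1 hj
  obtain ⟨i, Ch, h1, h2⟩ := hard_phase U.card (N0:ℝ) (by exact_mod_cast huN) hN0R _ rfl R Hd P0
    (by
      intro j hj B hB e he
      obtain ⟨hjJ, hjB⟩ := hPoolJ j (hP0P hj)
      obtain ⟨hBf, hBd⟩ := hRf j B hB
      have hn := hm2 j hjJ k0 hk0J (hjB k0 hk0) e (Finset.disjoint_left.1 hBd he)
      rw [hRa]
      by_contra hc
      refine hn ⟨B, hBf, he, ?_⟩
      unfold bet at hc
      unfold alp
      linarith) 0 (by omega) W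
    (by
      intro j hj
      rw [(R j).F_sdiff (fun B => B) W, (R j).F_id]
      rw [hP0, Finset.mem_filter] at hj
      have : Fh U.card 0 = 999/1000 := rfl
      rw [this]
      linarith [hj.2]) hcard
  refine assemble P J E Hd q hq hb hcov hJE hJH hEH Ce hCe' hCe2 i Ch ?_ h2
  intro k hk
  obtain ⟨g1, g2, B, hB, g3, g4⟩ := h1 k hk
  obtain ⟨hjJ, hjB⟩ := hPoolJ _ (hP0P g1)
  obtain ⟨hBf, hBd⟩ := hRf _ B hB
  exact ⟨hjJ, hjB k hk, by rw [← hW]; exact g2, hBd.mono_left g3, B, hBf, g3, by rw [← hRa]; exact g4⟩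

theorem core : ∃ N1 : ℕ, ∀ n : ℕ, N1 ≤ n → ∀ (ι : Type) [DecidableEq ι] (κ : Type) [Fintype κ]
    [DecidableEq κ] (M : Finset ι) (r : ℝ) (_ : r = 1/(n:ℝ)) (P : κ → Prof M r)
    (_ : Fintype.card κ ≤ n),
    ∃ A : κ → Finset ι, (∀ i j, i ≠ j → Disjoint (A i) (A j)) ∧ (∀ i, A i ⊆ M) ∧
      ∀ i, Sat (P i) (A i) := by
  classical
  obtain ⟨N0, hN0, hA⟩ := thmA
  obtain ⟨m, hm⟩ := exists_nat_ge (4 * (2 / (294/1000000 / (N0:ℝ)))^N0)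
  refine ⟨8000 * N0^2 * (N0+1) + m, ?_⟩
  intro n hn ι _ κ _ _ M r hr P hκ
  by_cases hκe : IsEmpty κ
  · exact ⟨fun _ => ∅, fun i => (hκe.false i).elim, fun i => (hκe.false i).elim,
      fun i => (hκe.false i).elim⟩
  obtain ⟨k0⟩ := not_isEmpty_iff.1 hκe
  have hι : Nonempty ι := by
    by_contra hne
    have h1 := (P k0).lsum
    have : (P k0).fam.Nonempty := by
      rw [Finset.nonempty_iff_ne_empty]
      intro h
      rw [h] at h1
      simp at h1
    obtain ⟨B, hB⟩ := this
    have h2 := (P k0).asum B hB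
    have : B = ∅ := Finset.eq_empty_of_forall_notMem fun e _ => hne ⟨e⟩
    rw [this] at h2
    simp at h2
  obtain ⟨J, q, hq, hb, hm1, hm2⟩ := max_matching (fun k e => Big (P k) e)
  obtain ⟨U, hUd⟩ : ∃ U : Finset κ, U = Jᶜ := ⟨_, rfl⟩
  have hU : ∀ k, k ∈ U ↔ k ∉ J := fun k => by rw [hUd, Finset.mem_compl]
  have hJU : J.card + U.card ≤ n := by
    rw [hUd, Finset.card_add_card_compl]; exact hκ
  rcases Nat.eq_zero_or_pos U.card with h0 | hpos
  · have hU0 : U = ∅ := Finset.card_eq_zero.1 h0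
    refine assemble P J ∅ ∅ q hq hb ?_ (by simp) (by simp) (by simp) (fun _ => ∅) (by simp) (by simp)
      id (fun _ => ∅) (by simp) (by simp)
    intro k
    left
    by_contra hk
    have := (hU k).2 hk
    rw [hU0] at this
    simp at this
  by_cases hUN : N0 ≤ U.card
  · have hQc : (J.image q).card = J.card := Finset.card_image_of_injOn hq
    have hRp : ∀ k, ∃ R : Prof M (1/(U.card:ℝ)), R.a = (P k).a ∧
        ∀ B ∈ R.fam, B ∈ (P k).fam ∧ Disjoint B (J.image q) := fun k =>
      restr_exists (P k) n hr (J.image q) U.card hpos (by omega)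
    choose R hRa hRf using hRp
    exact caseA P J q hq hb hm1 U hU hpos R hRa hRf (hA U.card hUN ι M _ rfl)
  · refine caseB P n N0 hr hN0 (by omega) (hm.trans ?_) J q hq hb hm1 hm2 U hU hpos (by omega) hJU
    exact_mod_cast (by omega : m ≤ n)

end APSX

namespace APSX

theorem xos_nonneg {ι : Type} {M : Finset ι} {v : Finset ι → ℝ} (h : IsXOS M v) (S : Finset ι)
    (hS : S ⊆ M) : 0 ≤ v S := by
  obtain ⟨t, a, h0, h1⟩ := h
  rw [h1 S hS]
  exact (Finset.sum_nonneg fun e he => h0 0 e (hS he)).trans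
    (Finset.le_sup' (fun j => ∑ e ∈ S, a j e) (Finset.mem_univ 0))

theorem xos_mono {ι : Type} {M : Finset ι} {v : Finset ι → ℝ} (h : IsXOS M v) (S T : Finset ι)
    (hS : S ⊆ T) (hT : T ⊆ M) : v S ≤ v T := by
  obtain ⟨t, a, h0, h1⟩ := h
  rw [h1 S (hS.trans hT), h1 T hT]
  apply Finset.sup'_le
  intro j hj
  exact (Finset.sum_le_sum_of_subset_of_nonneg hS fun e he _ => h0 j e (hT he)).trans
    (Finset.le_sup' (fun j => ∑ e ∈ T, a j e) (Finset.mem_univ j))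

theorem agent_prof {ι : Type} [DecidableEq ι] {M : Finset ι} {v : Finset ι → ℝ} (h : IsXOS M v)
    (b : ℝ) (hb : 0 ≤ b) (hpos : 0 < APS M v b) (c : ℝ) (hc : c < 1) :
    ∃ (P : Prof M b) (x : ℝ), c * APS M v b ≤ x ∧ ∀ A ⊆ M, Sat P A → alp * x ≤ v A := by
  classical
  have hlt : max (c * APS M v b) 0 < APS M v b := by
    apply max_lt _ hpos
    nlinarith
  have hne : { x | ∃ lam : Finset ι → ℝ,
    (∀ B ∈ M.powerset, 0 ≤ lam B) ∧
    (∑ B ∈ M.powerset, lam B) = 1 ∧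
    (∀ e ∈ M, (∑ B ∈ M.powerset.filter (fun B => e ∈ B), lam B) ≤ b) ∧
    x = sInf { y | ∃ B ∈ M.powerset, 0 < lam B ∧ y = v B } }.Nonempty := by
    rw [Set.nonempty_iff_ne_empty]
    intro he
    unfold APS at hpos
    rw [he, Real.sSup_empty] at hpos
    exact lt_irrefl _ hpos
  obtain ⟨x, ⟨lam, l0, l1, l2, hx⟩, hxlt⟩ := exists_lt_of_lt_csSup hne hlt
  have hx0 : 0 < x := lt_of_le_of_lt (le_max_right _ _) hxlt
  have hxc : c * APS M v b ≤ x := ((le_max_left _ _).trans_lt hxlt).le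
  have hxB : ∀ B ∈ M.powerset, 0 < lam B → x ≤ v B := by
    intro B hB hl
    rw [hx]
    refine csInf_le ⟨0, ?_⟩ ⟨B, hB, hl, rfl⟩
    rintro y ⟨B', hB', -, rfl⟩
    exact xos_nonneg h _ (Finset.mem_powerset.1 hB')
  obtain ⟨t, a, h0, h1⟩ := id h
  have hj : ∀ B : Finset ι, ∃ j, B ⊆ M → v B = ∑ e ∈ B, a j e := by
    intro B
    by_cases hB : B ⊆ M
    · obtain ⟨j, -, hj⟩ := Finset.exists_mem_eq_sup' (Finset.univ_nonempty (α := Fin (t+1)))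
        (fun j => ∑ e ∈ B, a j e)
      exact ⟨j, fun _ => (h1 B hB).trans hj⟩
    · exact ⟨0, fun h => absurd h hB⟩
  choose j hj using hj
  have hfam : ∀ B ∈ M.powerset.filter (fun B => 0 < lam B), B ⊆ M ∧ 0 < lam B ∧ x ≤ v B := by
    intro B hB
    obtain ⟨g1, g2⟩ := Finset.mem_filter.1 hB
    exact ⟨Finset.mem_powerset.1 g1, g2, hxB B g1 g2⟩
  refine ⟨{ fam := M.powerset.filter (fun B => 0 < lam B)
            lam := lam
            a := fun B e => if e ∈ B then a (j B) e / v B else 0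
            sub := fun B hB => (hfam B hB).1
            lam0 := fun B hB => (hfam B hB).2.1.le
            a0 := ?_
            asum := ?_
            lsum := ?_
            marg := ?_ }, x, hxc, ?_⟩
  · intro B hB e
    obtain ⟨g1, g2, g3⟩ := hfam B hB
    split_ifs with he
    · exact div_nonneg (h0 _ e (g1 he)) (hx0.le.trans g3)
    · exact le_rfl
  · intro B hB
    obtain ⟨g1, g2, g3⟩ := hfam B hB
    have : ∑ e ∈ B, (if e ∈ B then a (j B) e / v B else 0) = ∑ e ∈ B, a (j B) e / v B :=
      Finset.sum_congr rfl fun e he => if_pos he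
    rw [this, ← Finset.sum_div, ← hj B g1, div_self (by linarith)]
  · rw [← l1]
    apply Finset.sum_subset (Finset.filter_subset _ _)
    intro B hB hn
    rw [Finset.mem_filter, not_and] at hn
    exact le_antisymm (not_lt.1 (hn hB)) (l0 B hB)
  · intro e
    by_cases he : e ∈ M
    · refine le_trans ?_ (l2 e he)
      rw [Finset.sum_filter (fun B => e ∈ B)]
      apply Finset.sum_le_sum_of_subset_of_nonneg (Finset.filter_subset _ _)
      intro B hB _
      split_ifs
      · exact l0 B hB
      · exact le_rfl
    · refine le_trans (le_of_eq ?_) hb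
      apply Finset.sum_eq_zero
      intro B hB
      exact if_neg fun hc => he ((hfam B hB).1 hc)
  · rintro A hA ⟨B, hB, C, hCA, hCB, hle⟩
    obtain ⟨g1, g2, g3⟩ := hfam B hB
    dsimp only at hle
    have h2 : ∑ e ∈ C, (if e ∈ B then a (j B) e / v B else 0) = (∑ e ∈ C, a (j B) e) / v B := by
      rw [Finset.sum_div]
      exact Finset.sum_congr rfl fun e he => if_pos (hCB he)
    have hvB : 0 < v B := by linarith
    rw [h2, le_div_iff₀ hvB] at hle
    have halp : 0 < alp := by unfold alp; norm_num
    calc alp * x ≤ alp * v B := by gcongr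
      _ ≤ ∑ e ∈ C, a (j B) e := hle
      _ ≤ v C := by
          rw [h1 C (hCA.trans hA)]
          exact Finset.le_sup' (fun j => ∑ e ∈ C, a j e) (Finset.mem_univ (j B))
      _ ≤ v A := xos_mono h _ _ hCA hA

end APSX

/-- There exist `α > 11/40` and `n_α` such that for every `n ≥ n_α`, every finite set `M`
of items and every family of `n` XOS valuations on `M`, there is a partition of `M` into
`n` pairwise disjoint parts giving every agent at least `α` times her anyprice share. -/
theorem exists_alpha_APS_allocation :
    ∃ α : ℝ, 11 / 40 < α ∧ ∃ nα : ℕ,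
      ∀ n : ℕ, nα ≤ n →
      ∀ (ι : Type) [DecidableEq ι], ∀ (M : Finset ι) (v : Fin n → Finset ι → ℝ),
        (∀ i, IsXOS M (v i)) →
        ∃ P : Fin n → Finset ι,
          (∀ i j, i ≠ j → Disjoint (P i) (P j)) ∧
          Finset.univ.biUnion P = M ∧
          ∀ i, α * APS M (v i) (1 / (n : ℝ)) ≤ v i (P i) := by
  classical
  obtain ⟨N1, hN1⟩ := APSX.core
  refine ⟨2751/10000, by norm_num, N1 + 1, ?_⟩
  intro n hn ι _ M v hv
  have hb : (0:ℝ) ≤ 1 / (n:ℝ) := by positivity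
  have hprof := fun k : {i : Fin n // 0 < APS M (v i) (1/(n:ℝ))} =>
    APSX.agent_prof (hv k.1) (1/(n:ℝ)) hb k.2 (2751/2752) (by norm_num)
  choose P x hx hP using hprof
  obtain ⟨A, hA1, hA2, hA3⟩ := hN1 n (by omega) ι {i : Fin n // 0 < APS M (v i) (1/(n:ℝ))} M _ rfl P
    ((Fintype.card_subtype_le _).trans (by simp))
  -- extend by the empty set to all agents
  obtain ⟨D, hD⟩ : ∃ D : Fin n → Finset ι, D = fun i =>
      if h : 0 < APS M (v i) (1/(n:ℝ)) then A ⟨i, h⟩ else ∅ := ⟨_, rfl⟩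
  have hD1 : ∀ i j, i ≠ j → Disjoint (D i) (D j) := by
    intro i j hij
    rw [hD]
    dsimp only
    split_ifs with h1 h2
    · exact hA1 _ _ fun h => hij (congrArg Subtype.val h)
    · simp
    · simp
    · simp
  have hD2 : ∀ i, D i ⊆ M := by
    intro i
    rw [hD]
    dsimp only
    split_ifs with h1
    · exact hA2 _
    · simp
  have hD3 : ∀ i, 2751/10000 * APS M (v i) (1 / (n : ℝ)) ≤ v i (D i) := by
    intro i
    by_cases h : 0 < APS M (v i) (1/(n:ℝ))
    · have e : D i = A ⟨i, h⟩ := by rw [hD]; exact dif_pos h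
      rw [e]
      have h1 := hx ⟨i, h⟩
      have h2 := hP ⟨i, h⟩ _ (hA2 _) (hA3 ⟨i, h⟩)
      unfold APSX.alp at h2
      dsimp only at h1 h2
      linarith
    · have := APSX.xos_nonneg (hv i) _ (hD2 i)
      linarith [not_lt.1 h]
  have i0 : Fin n := ⟨0, by omega⟩
  refine ⟨fun i => if i = i0 then D i ∪ (M \ Finset.univ.biUnion D) else D i, ?_, ?_, ?_⟩
  · have hrest : ∀ j, Disjoint (M \ Finset.univ.biUnion D) (D j) := fun j =>
      Disjoint.mono_right (Finset.subset_biUnion_of_mem D (Finset.mem_univ j))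
        Finset.sdiff_disjoint
    intro i j hij
    dsimp only
    split_ifs with h1 h2
    · exact absurd (h1.trans h2.symm) hij
    · exact Finset.disjoint_union_left.2 ⟨hD1 i j hij, hrest j⟩
    · exact Finset.disjoint_union_right.2 ⟨hD1 i j hij, (hrest i).symm⟩
    · exact hD1 i j hij
  · ext e
    simp only [Finset.mem_biUnion, Finset.mem_univ, true_and]
    constructor
    · rintro ⟨i, hi⟩
      split_ifs at hi with h1
      · rcases Finset.mem_union.1 hi with h | h
        · exact hD2 i h
        · exact (Finset.mem_sdiff.1 h).1
      · exact hD2 i hi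
    · intro he
      by_cases h : e ∈ Finset.univ.biUnion D
      · obtain ⟨i, -, hi⟩ := Finset.mem_biUnion.1 h
        refine ⟨i, ?_⟩
        split_ifs
        · exact Finset.mem_union_left _ hi
        · exact hi
      · refine ⟨i0, ?_⟩
        rw [if_pos rfl]
        exact Finset.mem_union_right _ (Finset.mem_sdiff.2 ⟨he, h⟩)
  · intro i
    refine (hD3 i).trans (APSX.xos_mono (hv i) _ _ ?_ ?_)
    · dsimp only
      split_ifs
      · exact Finset.subset_union_left
      · exact Finset.Subset.refl _
    · dsimp only
      split_ifs
      · exact Finset.union_subset (hD2 i) Finset.sdiff_subset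
      · exact hD2 i
end

section
/- There exists a real number α > 11/40 such that for every integer n ≥ 1, every finite set M of items, and every XOS valuation v on M, it holds that MMS(M, v, 1/n) ≥ α · APS(M, v, 1/n); in particular, for every XOS valuation and every n, the multiplicative gap between the APS and the MMS is less than 40/11. -/
open Finset

/-- Maximin share of valuation `v` over the finite set `M` with entitlement `1/n`. -/
noncomputable def MMS {ι : Type} [DecidableEq ι] (M : Finset ι) (v : Finset ι → ℝ)
    (n : ℕ) : ℝ :=
  sSup { x | ∃ P : Fin n → Finset ι,
    (∀ i j, i ≠ j → Disjoint (P i) (P j)) ∧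
    Finset.univ.biUnion P = M ∧
    x = ⨅ i, v (P i) }

/-- Splitting lemma: merge items until any two parts have value at least `α`, then take the two
parts of smallest weight. -/
lemma split_aux {ι : Type} [DecidableEq ι] (α : ℝ) (hα : 3 / 11 ≤ α) (S : Finset ι)
    (a w : ι → ℝ) (hw : ∀ e ∈ S, 0 ≤ w e)
    (hlt : ∀ e ∈ S, a e < α) (hx : α ≤ ∑ e ∈ S, a e) (hx1 : ∑ e ∈ S, a e ≤ 1) :
    ∃ C ⊆ S, α ≤ ∑ e ∈ C, a e ∧
      (∑ e ∈ C, w e) * (∑ e ∈ S, a e - α) ≤ 4 * α / 3 * ∑ e ∈ S, w e := by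
  classical
  let Q : ℕ → Prop := fun m => ∃ f : ι → ι, (S.image f).card = m ∧
    ∀ p ∈ S.image f, ∑ e ∈ S with f e = p, a e < α
  have hQ : ∃ m, Q m := by
    refine ⟨_, id, rfl, ?_⟩
    intro p hp
    simp only [image_id] at hp
    have : S.filter (fun e => id e = p) = {p} := by
      ext e; simp only [id, mem_filter, mem_singleton]
      exact ⟨fun h => h.2, fun h => ⟨h ▸ hp, h⟩⟩
    rw [this, sum_singleton]; exact hlt p hp
  obtain ⟨f, hfm, hf⟩ := Nat.find_spec hQ
  have hmin := fun m (h : m < Nat.find hQ) => Nat.find_min hQ h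
  rw [← hfm] at hmin
  set T := S.image f with hT
  set A : ι → ℝ := fun p => ∑ e ∈ S with f e = p, a e with hA
  set W : ι → ℝ := fun p => ∑ e ∈ S with f e = p, w e with hW
  have hAs : ∑ p ∈ T, A p = ∑ e ∈ S, a e :=
    sum_fiberwise_of_maps_to (fun e he => mem_image_of_mem f he) a
  have hWs : ∑ p ∈ T, W p = ∑ e ∈ S, w e :=
    sum_fiberwise_of_maps_to (fun e he => mem_image_of_mem f he) w
  have hW0 : ∀ p, 0 ≤ W p := fun p => sum_nonneg fun e he => hw e (mem_filter.1 he).1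
  have disj : ∀ p q, p ≠ q → Disjoint (S.filter (fun e => f e = p)) (S.filter (fun e => f e = q)) := by
    intro p q hpq
    rw [disjoint_left]
    intro e h1 h2
    exact hpq ((mem_filter.1 h1).2.symm.trans (mem_filter.1 h2).2)
  have hpair : ∀ p ∈ T, ∀ q ∈ T, p ≠ q → α ≤ A p + A q := by
    intro p hp q hq hpq
    by_contra! hcon
    let g : ι → ι := fun e => if f e = q then p else f e
    have hsub : S.image g ⊆ T.erase q := by
      intro r hr
      obtain ⟨e, he, rfl⟩ := mem_image.1 hr
      simp only [g]
      split_ifs with h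
      · exact mem_erase.2 ⟨hpq, hp⟩
      · exact mem_erase.2 ⟨h, mem_image_of_mem f he⟩
    have hcard : (S.image g).card < T.card :=
      lt_of_le_of_lt (card_le_card hsub) (card_erase_lt_of_mem hq)
    refine hmin _ hcard ⟨g, rfl, ?_⟩
    intro r hr
    have hr' := mem_erase.1 (hsub hr)
    by_cases hrp : r = p
    · subst hrp
      have : S.filter (fun e => g e = r) =
          S.filter (fun e => f e = r) ∪ S.filter (fun e => f e = q) := by
        ext e; simp only [g, mem_filter, mem_union]
        split_ifs with h
        · simp only [h]; tauto
        · simp [h]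
      rw [this, sum_union (disj _ _ hpq)]
      exact hcon
    · have : S.filter (fun e => g e = r) = S.filter (fun e => f e = r) := by
        ext e; simp only [g, mem_filter]
        split_ifs with h
        · constructor
          · rintro ⟨_, h2⟩; exact absurd h2.symm hrp
          · rintro ⟨_, h2⟩; exact absurd (h2.symm.trans h) hr'.1
        · rfl
      rw [this]; exact hf r hr'.2
  have hTne : T.Nonempty := by
    rw [nonempty_iff_ne_empty]; intro h
    rw [h, sum_empty] at hAs; linarith
  have hcardx : ∑ e ∈ S, a e < T.card * α := by
    rw [← hAs, ← nsmul_eq_mul, ← sum_const]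
    exact sum_lt_sum_of_nonempty hTne hf
  have hcard2 : 2 ≤ T.card := by
    by_contra! h
    have h1 : (T.card : ℝ) ≤ 1 := by exact_mod_cast (by omega : T.card ≤ 1)
    nlinarith
  obtain ⟨p, hp, hpmin⟩ := exists_min_image T W hTne
  have hTe : (T.erase p).Nonempty := by
    rw [← card_pos, card_erase_of_mem hp]; omega
  obtain ⟨q, hq, hqmin⟩ := exists_min_image (T.erase p) W hTe
  have hqT := mem_erase.1 hq
  have hsumW : W p + ((T.card : ℝ) - 1) * W q ≤ ∑ e ∈ S, w e := by
    rw [← hWs, ← add_sum_erase T W hp]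
    have := card_nsmul_le_sum (T.erase p) W (W q) hqmin
    rw [card_erase_of_mem hp, nsmul_eq_mul, Nat.cast_sub (by omega)] at this
    push_cast at this
    linarith
  have hpq : W p ≤ W q := hpmin q hqT.2
  refine ⟨S.filter (fun e => f e = p) ∪ S.filter (fun e => f e = q),
    union_subset (filter_subset _ _) (filter_subset _ _), ?_, ?_⟩
  · rw [sum_union (disj _ _ hqT.1.symm)]
    exact hpair p hp q hqT.2 hqT.1.symm
  · rw [sum_union (disj _ _ hqT.1.symm)]
    change (W p + W q) * _ ≤ _
    set x := ∑ e ∈ S, a e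
    set w' := ∑ e ∈ S, w e
    have hm2 : (2 : ℝ) ≤ T.card := by exact_mod_cast hcard2
    have key : (T.card : ℝ) * (W p + W q) ≤ 2 * w' := by nlinarith
    have hx' : x - α ≤ 2 * T.card / 3 * α := by
      rcases Nat.lt_or_ge T.card 4 with h | h
      · have h3 : (T.card : ℝ) ≤ 3 := by exact_mod_cast (by omega : T.card ≤ 3)
        nlinarith
      · have h4 : (4 : ℝ) ≤ T.card := by exact_mod_cast h
        nlinarith
    have h0 : 0 ≤ W p + W q := add_nonneg (hW0 p) (hW0 q)
    calc (W p + W q) * (x - α) ≤ (W p + W q) * (2 * T.card / 3 * α) :=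
          mul_le_mul_of_nonneg_left hx' h0
      _ = (2 * α / 3) * (T.card * (W p + W q)) := by ring
      _ ≤ (2 * α / 3) * (2 * w') := mul_le_mul_of_nonneg_left key (by linarith)
      _ = _ := by ring

/-- One step of the extraction process. -/
lemma step_aux {ι : Type} [DecidableEq ι] (α b : ℝ) (hα : 3 / 11 ≤ α)
    (s : Finset (Finset ι)) (lam : Finset ι → ℝ) (a : Finset ι → ι → ℝ)
    (hl : ∀ B ∈ s, 0 < lam B) (hsum : ∑ B ∈ s, lam B = 1)
    (hb : ∀ e, ∑ B ∈ s with e ∈ B, lam B ≤ b)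
    (ha : ∀ B ∈ s, ∀ e ∈ B, 0 ≤ a B e) (ha1 : ∀ B ∈ s, ∑ e ∈ B, a B e ≤ 1)
    (hlt : ∀ B ∈ s, ∀ e ∈ B, a B e < α) (R : Finset ι)
    (hy : α < ∑ B ∈ s, lam B * ∑ e ∈ B ∩ R, a B e) :
    ∃ B ∈ s, ∃ C ⊆ B ∩ R, α ≤ ∑ e ∈ C, a B e ∧
      ((∑ B ∈ s, lam B * ∑ e ∈ B ∩ R, a B e) - ∑ B ∈ s, lam B * ∑ e ∈ B ∩ (R \ C), a B e) *
        ((∑ B ∈ s, lam B * ∑ e ∈ B ∩ R, a B e) - α) ≤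
        4 * α / 3 * (b * ∑ B ∈ s, lam B * ∑ e ∈ B ∩ R, a B e) := by
  classical
  set w : ι → ℝ := fun e => ∑ B ∈ s with e ∈ B, lam B * a B e with hw
  have hw0 : ∀ e, 0 ≤ w e := fun e => sum_nonneg fun B hB => by
    rw [mem_filter] at hB
    exact mul_nonneg (hl B hB.1).le (ha B hB.1 e hB.2)
  have hwR : ∀ R : Finset ι, ∑ B ∈ s, lam B * ∑ e ∈ B ∩ R, a B e = ∑ e ∈ R, w e := by
    intro R
    simp only [hw, sum_filter]
    rw [sum_comm]
    refine sum_congr rfl fun B _ => ?_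
    rw [mul_sum, ← sum_filter, filter_mem_eq_inter, inter_comm]
  have hsumw : ∑ B ∈ s, lam B * ∑ e ∈ B ∩ R, w e ≤ b * ∑ e ∈ R, w e := by
    have : ∑ B ∈ s, lam B * ∑ e ∈ B ∩ R, w e = ∑ e ∈ R, (∑ B ∈ s with e ∈ B, lam B) * w e := by
      simp only [sum_mul, sum_filter, ite_mul, zero_mul]
      rw [sum_comm]
      refine sum_congr rfl fun B _ => ?_
      rw [mul_sum, ← sum_filter, filter_mem_eq_inter, inter_comm]
    rw [this, mul_sum]
    exact sum_le_sum fun e _ => mul_le_mul_of_nonneg_right (hb e) (hw0 e)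
  set x : Finset ι → ℝ := fun B => ∑ e ∈ B ∩ R, a B e with hxdef
  set y := ∑ B ∈ s, lam B * x B with hydef
  have hyw : y = ∑ e ∈ R, w e := hwR R
  have hsne : s.Nonempty := by
    rw [nonempty_iff_ne_empty]; rintro rfl; simp at hsum
  have hex : ∃ B ∈ s, lam B * ((∑ e ∈ B ∩ R, w e) * (y - α)) ≤ lam B * (b * y * (x B - α)) := by
    apply exists_le_of_sum_le hsne
    have e1 : ∑ B ∈ s, lam B * ((∑ e ∈ B ∩ R, w e) * (y - α)) =
        (∑ B ∈ s, lam B * ∑ e ∈ B ∩ R, w e) * (y - α) := by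
      rw [sum_mul]; exact sum_congr rfl fun _ _ => by ring
    have e2 : ∑ B ∈ s, lam B * (b * y * (x B - α)) = b * y * (y - α) := by
      have : ∀ B ∈ s, lam B * (b * y * (x B - α)) = b * y * (lam B * x B) - b * y * α * lam B :=
        fun _ _ => by ring
      rw [sum_congr rfl this, sum_sub_distrib, ← mul_sum, ← mul_sum, hsum, ← hydef]; ring
    rw [e1, e2]
    apply mul_le_mul_of_nonneg_right _ (by linarith)
    rw [hyw]; exact hsumw
  obtain ⟨B, hB, hBle⟩ := hex
  have hBle := le_of_mul_le_mul_left hBle (hl B hB)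
  have hwB : 0 ≤ ∑ e ∈ B ∩ R, w e := sum_nonneg fun e _ => hw0 e
  have hxle : x B ≤ 1 := le_trans
    (sum_le_sum_of_subset_of_nonneg inter_subset_left fun e he _ => ha B hB e he) (ha1 B hB)
  have hy0 : 0 < y := by linarith
  have hb0 : 0 ≤ b := by
    rcases (s.biUnion id).eq_empty_or_nonempty with h | ⟨e, he⟩
    · exfalso
      have : y = 0 := by
        rw [hydef]
        refine sum_eq_zero fun B hB => ?_
        have : B = ∅ := by
          have := subset_biUnion_of_mem id hB
          rw [h] at this
          exact subset_empty.1 this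
        simp [hxdef, this]
      linarith
    · exact le_trans (sum_nonneg fun B hB => (hl B (mem_filter.1 hB).1).le) (hb e)
  have hbpos : 0 < b := by
    rcases hb0.lt_or_eq with h | h
    · exact h
    · exfalso
      have hz : ∀ B ∈ s, B = ∅ := by
        intro B hB
        by_contra hne
        obtain ⟨e, he⟩ := nonempty_iff_ne_empty.2 hne
        have h1 := hb e
        rw [← h] at h1
        have h2 : 0 < ∑ B ∈ s with e ∈ B, lam B :=
          sum_pos (fun B hB => hl B (mem_filter.1 hB).1) ⟨B, mem_filter.2 ⟨hB, he⟩⟩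
        linarith
      have : y = 0 := by
        rw [hydef]
        refine sum_eq_zero fun B hB => ?_
        simp [hxdef, hz B hB]
      linarith
  have hby : 0 < b * y := mul_pos hbpos hy0
  have hxα : α ≤ x B := by
    by_contra! h
    have : b * y * (x B - α) < 0 := mul_neg_of_pos_of_neg hby (by linarith)
    have : 0 ≤ (∑ e ∈ B ∩ R, w e) * (y - α) := mul_nonneg hwB (by linarith)
    linarith
  obtain ⟨C, hC, hCα, hCw⟩ := split_aux α hα (B ∩ R) (a B) w (fun e _ => hw0 e)
    (fun e he => hlt B hB e (mem_inter.1 he).1) hxα hxle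
  change _ * (x B - α) ≤ _ at hCw
  refine ⟨B, hB, C, hC, hCα, ?_⟩
  have hCR : C ⊆ R := hC.trans inter_subset_right
  rw [hwR (R \ C)]
  have hdiff : y - ∑ e ∈ R \ C, w e = ∑ e ∈ C, w e := by
    rw [hyw, ← sum_sdiff hCR]; ring
  rw [hdiff]
  have hCle : ∑ e ∈ C, w e ≤ ∑ e ∈ B ∩ R, w e :=
    sum_le_sum_of_subset_of_nonneg hC fun e _ _ => hw0 e
  have hC0 : 0 ≤ ∑ e ∈ C, w e := sum_nonneg fun e _ => hw0 e
  set l := ∑ e ∈ C, w e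
  set wB := ∑ e ∈ B ∩ R, w e
  rcases hxα.lt_or_eq with h | h
  · have hd : 0 < x B - α := by linarith
    refine le_of_mul_le_mul_right ?_ hd
    calc l * (y - α) * (x B - α) = (l * (x B - α)) * (y - α) := by ring
      _ ≤ (4 * α / 3 * wB) * (y - α) := mul_le_mul_of_nonneg_right hCw (by linarith)
      _ = (4 * α / 3) * (wB * (y - α)) := by ring
      _ ≤ (4 * α / 3) * (b * y * (x B - α)) := mul_le_mul_of_nonneg_left hBle (by linarith)
      _ = _ := by ring
  · have h1 : wB * (y - α) ≤ 0 := by rw [← h] at hBle; simpa using hBle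
    have h2 : l * (y - α) ≤ wB * (y - α) := mul_le_mul_of_nonneg_right hCle (by linarith)
    have h3 : 0 ≤ 4 * α / 3 * (b * y) := mul_nonneg (by linarith) hby.le
    linarith

lemma pot_aux {α y z d : ℝ} (hα : 0 < α) (hy : α ≤ y) (hz : α ≤ z)
    (h : (y - z) * (y - α) ≤ d * y) :
    (y - α * Real.log y) - d ≤ z - α * Real.log z := by
  have hy0 : 0 < y := by linarith
  have hz0 : 0 < z := by linarith
  have h1 : Real.log z - Real.log y ≤ z / y - 1 := by
    rw [← Real.log_div hz0.ne' hy0.ne']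
    exact Real.log_le_sub_one_of_pos (div_pos hz0 hy0)
  have h2 : (y - z) * (1 - α / y) ≤ d := by
    have : (y - z) * (1 - α / y) = ((y - z) * (y - α)) / y := by field_simp
    rw [this, div_le_iff₀ hy0]; exact h
  have h3 : (y - z) * (1 - α / y) = (y - z) + α * (z / y - 1) := by field_simp; ring
  nlinarith [mul_le_mul_of_nonneg_left h1 hα.le]

/-- Repeated extraction. -/
lemma extract_aux {ι : Type} [DecidableEq ι] (α b : ℝ) (hα : 3 / 11 ≤ α) (hb0 : 0 ≤ b)
    (s : Finset (Finset ι)) (lam : Finset ι → ℝ) (a : Finset ι → ι → ℝ)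
    (hl : ∀ B ∈ s, 0 < lam B) (hsum : ∑ B ∈ s, lam B = 1)
    (hb : ∀ e, ∑ B ∈ s with e ∈ B, lam B ≤ b)
    (ha : ∀ B ∈ s, ∀ e ∈ B, 0 ≤ a B e) (ha1 : ∀ B ∈ s, ∑ e ∈ B, a B e ≤ 1)
    (hlt : ∀ B ∈ s, ∀ e ∈ B, a B e < α) (k : ℕ) :
    ∀ (R : Finset ι) (y : ℝ), y = ∑ B ∈ s, lam B * ∑ e ∈ B ∩ R, a B e → α < y →
      α - α * Real.log α + 4 * α / 3 * b * k < y - α * Real.log y →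
      ∃ P : Fin k → Finset ι, (∀ i j, i ≠ j → Disjoint (P i) (P j)) ∧
        ∀ i, P i ⊆ R ∧ ∃ B ∈ s, P i ⊆ B ∧ α ≤ ∑ e ∈ P i, a B e := by
  induction k with
  | zero => exact fun R y _ _ _ => ⟨fun i => i.elim0, fun i => i.elim0, fun i => i.elim0⟩
  | succ k ih =>
    intro R y hy hαy hG
    obtain ⟨B, hB, C, hC, hCα, hstep⟩ := step_aux α b hα s lam a hl hsum hb ha ha1 hlt R (hy ▸ hαy)
    rw [← hy] at hstep
    set z := ∑ B ∈ s, lam B * ∑ e ∈ B ∩ (R \ C), a B e with hz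
    have hα0 : 0 < α := by linarith
    push_cast at hG
    have hcb : 0 ≤ 4 * α / 3 * b * k := by positivity
    have hαz : α < z := by
      by_contra! h
      have := pot_aux (α := α) (y := y) (z := α) (d := 4 * α / 3 * b) hα0 hαy.le le_rfl (by
        nlinarith [mul_nonneg (sub_nonneg.2 h) (sub_nonneg.2 hαy.le)])
      nlinarith
    have hpot := pot_aux (α := α) (y := y) (z := z) (d := 4 * α / 3 * b) hα0 hαy.le hαz.le
      (by linarith)
    obtain ⟨P, hP, hP2⟩ := ih (R \ C) z hz hαz (by linarith)
    have hd : ∀ i, Disjoint C (P i) := fun i =>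
      (disjoint_sdiff (s := C) (t := R)).mono_right (hP2 i).1
    refine ⟨Fin.cons C P, ?_, ?_⟩
    · intro i j
      refine Fin.cases ?_ (fun i => ?_) i <;> refine Fin.cases ?_ (fun j => ?_) j
      · simp
      · intro _; simpa using hd j
      · intro _; simpa using (hd i).symm
      · intro h; simpa using hP i j (fun h' => h (by rw [h']))
    · intro i
      refine Fin.cases ?_ (fun i => ?_) i
      · simp only [Fin.cons_zero]
        exact ⟨hC.trans inter_subset_right, B, hB, hC.trans inter_subset_left, hCα⟩
      · simp only [Fin.cons_succ]
        exact ⟨(hP2 i).1.trans sdiff_subset, (hP2 i).2⟩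

/-- The combinatorial core, after removing large items one at a time. -/
lemma core_aux {ι : Type} [DecidableEq ι] (α : ℝ) (hα : 3 / 11 ≤ α) (hα1 : α < 1)
    (hnum : α - α * Real.log α + 4 * α / 3 < 1)
    (mu : Finset ι → ℝ) (a : Finset ι → ι → ℝ) (n : ℕ) :
    ∀ (s : Finset (Finset ι)), (∀ B ∈ s, 0 < mu B) → (n : ℝ) ≤ ∑ B ∈ s, mu B →
    (∀ e, ∑ B ∈ s with e ∈ B, mu B ≤ 1) →
    (∀ B ∈ s, ∀ e ∈ B, 0 ≤ a B e) → (∀ B ∈ s, ∑ e ∈ B, a B e = 1) →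
      ∃ P : Fin n → Finset ι, (∀ i j, i ≠ j → Disjoint (P i) (P j)) ∧
        ∀ i, ∃ B ∈ s, P i ⊆ B ∧ α ≤ ∑ e ∈ P i, a B e := by
  induction n with
  | zero => exact fun s _ _ _ _ _ => ⟨fun i => i.elim0, fun i => i.elim0, fun i => i.elim0⟩
  | succ n ih =>
    intro s hl hsum hb ha ha1
    by_cases hbig : ∃ B ∈ s, ∃ e ∈ B, α ≤ a B e
    · obtain ⟨B, hB, e, he, hae⟩ := hbig
      have hsub : s.filter (fun B => e ∉ B) ⊆ s := filter_subset _ _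
      obtain ⟨P, hP, hP2⟩ := ih (s.filter (fun B => e ∉ B)) (fun B hB => hl B (hsub hB)) (by
          have h1 := sum_filter_add_sum_filter_not s (fun B => e ∈ B) mu
          have h2 := hb e
          push_cast at hsum
          linarith)
        (fun e' => le_trans (sum_le_sum_of_subset_of_nonneg (filter_subset_filter _ hsub)
          (fun B hB _ => (hl B (mem_filter.1 hB).1).le)) (hb e'))
        (fun B hB => ha B (hsub hB)) (fun B hB => ha1 B (hsub hB))
      have hd : ∀ i, Disjoint {e} (P i) := by
        intro i
        obtain ⟨B', hB', hPB, _⟩ := hP2 i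
        rw [disjoint_singleton_left]
        exact fun h => (mem_filter.1 hB').2 (hPB h)
      refine ⟨Fin.cons {e} P, ?_, ?_⟩
      · intro i j
        refine Fin.cases ?_ (fun i => ?_) i <;> refine Fin.cases ?_ (fun j => ?_) j
        · simp
        · intro _; simpa using hd j
        · intro _; simpa using (hd i).symm
        · intro h; simpa using hP i j (fun h' => h (by rw [h']))
      · intro i
        refine Fin.cases ?_ (fun i => ?_) i
        · simp only [Fin.cons_zero]
          exact ⟨B, hB, by simpa using he, by simpa using hae⟩
        · simp only [Fin.cons_succ]
          obtain ⟨B', hB', h⟩ := hP2 i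
          exact ⟨B', hsub hB', h⟩
    · push Not at hbig
      set W := ∑ B ∈ s, mu B with hW
      have hn1 : (0 : ℝ) < (n + 1 : ℕ) := by positivity
      have hW0 : 0 < W := lt_of_lt_of_le hn1 hsum
      have hs1 : ∑ B ∈ s, mu B / W = 1 := by rw [← sum_div, ← hW, div_self hW0.ne']
      obtain ⟨P, hP, hP2⟩ := extract_aux α (1 / W) hα (by positivity) s (fun B => mu B / W) a
        (fun B hB => div_pos (hl B hB) hW0) hs1
        (fun e => by rw [← sum_div]; exact div_le_div_of_nonneg_right (hb e) hW0.le) ha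
        (fun B hB => (ha1 B hB).le) hbig (n + 1) (s.biUnion id) 1 (by
          rw [← hs1]
          refine sum_congr rfl fun B hB => ?_
          rw [inter_eq_left.2 (show B ⊆ s.biUnion id from subset_biUnion_of_mem id hB), ha1 B hB, mul_one]) hα1 (by
          rw [Real.log_one]
          have : 1 / W * (n + 1 : ℕ) ≤ 1 := by
            rw [one_div_mul_eq_div]; exact (div_le_one hW0).2 hsum
          have := mul_le_mul_of_nonneg_left this (by linarith : 0 ≤ 4 * α / 3)
          linarith)
      exact ⟨P, hP, fun i => (hP2 i).2⟩

lemma num_aux : (2751 / 10000 : ℝ) - 2751 / 10000 * Real.log (2751 / 10000) +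
    4 * (2751 / 10000) / 3 < 1 := by
  have h : -(13 / 10 : ℝ) ≤ Real.log (2751 / 10000) := by
    rw [Real.le_log_iff_exp_le (by norm_num), Real.exp_neg]
    have h1 : Real.exp (13 / 10) = Real.exp 1 * Real.exp (3 / 10) := by
      rw [← Real.exp_add]; norm_num
    have h2 := Real.exp_one_gt_d9
    have h3 : (1 : ℝ) + 3 / 10 + (3 / 10) ^ 2 / 2 ≤ Real.exp (3 / 10) :=
      Real.quadratic_le_exp_of_nonneg (by norm_num)
    have h4 : (10000 / 2751 : ℝ) ≤ Real.exp (13 / 10) := by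
      rw [h1]; nlinarith
    calc (Real.exp (13 / 10))⁻¹ ≤ (10000 / 2751 : ℝ)⁻¹ := inv_anti₀ (by norm_num) h4
      _ = _ := by norm_num
  linarith

/-- There exists `α > 11/40` such that for every `n ≥ 1`, every finite set `M` and every
XOS valuation `v` on `M`, we have `MMS(M, v, 1/n) ≥ α · APS(M, v, 1/n)`; in particular,
the multiplicative gap between the APS and the MMS is less than `40/11`. -/
theorem MMS_ge_alpha_APS :
    ∃ α : ℝ, 11 / 40 < α ∧
      ∀ n : ℕ, 1 ≤ n →
      ∀ (ι : Type) [DecidableEq ι], ∀ (M : Finset ι) (v : Finset ι → ℝ),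
        IsXOS M v → α * APS M v (1 / (n : ℝ)) ≤ MMS M v n := by
  refine ⟨2751 / 10000, by norm_num, ?_⟩
  intro n hn ι _ M v hv
  obtain ⟨t, a, ha, hva⟩ := hv
  have hle : ∀ S ⊆ M, ∀ j, ∑ e ∈ S, a j e ≤ v S := by
    intro S hS j
    rw [hva S hS]
    exact le_sup' (fun j => ∑ e ∈ S, a j e) (mem_univ j)
  have hatt : ∀ S ⊆ M, ∃ j, v S = ∑ e ∈ S, a j e := by
    intro S hS
    obtain ⟨j, _, hj⟩ := exists_mem_eq_sup' univ_nonempty (fun j => ∑ e ∈ S, a j e)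
    exact ⟨j, by rw [hva S hS, hj]⟩
  have hmono : ∀ S ⊆ M, ∀ T ⊆ S, v T ≤ v S := by
    intro S hS T hT
    obtain ⟨j, hj⟩ := hatt T (hT.trans hS)
    rw [hj]
    exact (sum_le_sum_of_subset_of_nonneg hT fun e he _ => ha j e (hS he)).trans (hle S hS j)
  have hv0 : ∀ S ⊆ M, 0 ≤ v S := fun S hS =>
    (sum_nonneg fun e he => ha 0 e (hS he)).trans (hle S hS 0)
  have : Nonempty (Fin n) := ⟨⟨0, hn⟩⟩
  have hsubP : ∀ P : Fin n → Finset ι, univ.biUnion P = M → ∀ i, P i ⊆ M := fun P hP i => by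
    rw [← hP]; exact subset_biUnion_of_mem P (mem_univ i)
  have hMMS : ∀ P : Fin n → Finset ι, (∀ i j, i ≠ j → Disjoint (P i) (P j)) →
      univ.biUnion P = M → ∀ c, (∀ i, c ≤ v (P i)) → c ≤ MMS M v n := by
    intro P h1 h2 c hc
    refine le_trans (le_ciInf hc) (le_csSup ?_ ⟨P, h1, h2, rfl⟩)
    refine ⟨v M, ?_⟩
    rintro x ⟨P', _, h2', rfl⟩
    exact (ciInf_le (Set.finite_range _).bddBelow ⟨0, hn⟩).trans
      (hmono M Subset.rfl _ (hsubP P' h2' _))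
  have hMMS' : ∀ P : Fin n → Finset ι, (∀ i j, i ≠ j → Disjoint (P i) (P j)) →
      (∀ i, P i ⊆ M) → ∀ c, (∀ i, c ≤ v (P i)) → c ≤ MMS M v n := by
    intro P h1 h2 c hc
    let i0 : Fin n := ⟨0, hn⟩
    let X := M \ univ.biUnion P
    have hX : ∀ i, Disjoint (P i) X := fun i =>
      (disjoint_sdiff (s := univ.biUnion P) (t := M)).mono_left
        (subset_biUnion_of_mem P (mem_univ i))
    let P' : Fin n → Finset ι := fun i => if i = i0 then P i ∪ X else P i
    have hPP' : ∀ i, P i ⊆ P' i := by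
      intro i; simp only [P']; split_ifs
      · exact subset_union_left
      · exact Subset.rfl
    have hP'M : ∀ i, P' i ⊆ M := by
      intro i; simp only [P']; split_ifs
      · exact union_subset (h2 i) sdiff_subset
      · exact h2 i
    refine hMMS P' ?_ ?_ c (fun i => (hc i).trans (hmono _ (hP'M i) _ (hPP' i)))
    · intro i j hij
      simp only [P']
      split_ifs with hi hj hj
      · exact absurd (hi.trans hj.symm) hij
      · exact disjoint_union_left.2 ⟨h1 i j hij, (hX j).symm⟩
      · exact disjoint_union_right.2 ⟨h1 i j hij, hX i⟩
      · exact h1 i j hij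
    · apply Subset.antisymm
      · exact biUnion_subset.2 fun i _ => hP'M i
      · intro e he
        by_cases h : e ∈ univ.biUnion P
        · obtain ⟨i, hi, hei⟩ := mem_biUnion.1 h
          exact mem_biUnion.2 ⟨i, hi, hPP' i hei⟩
        · refine mem_biUnion.2 ⟨i0, mem_univ _, ?_⟩
          simp only [P', if_true]
          exact mem_union_right _ (mem_sdiff.2 ⟨he, h⟩)
  have hMMS0 : 0 ≤ MMS M v n :=
    hMMS' (fun _ => ∅) (fun _ _ _ => disjoint_empty_left _) (fun _ => empty_subset _) 0
      (fun _ => hv0 _ (empty_subset _))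
  suffices h : APS M v (1 / (n : ℝ)) ≤ MMS M v n / (2751 / 10000) by
    rw [le_div_iff₀ (by norm_num)] at h; linarith
  refine Real.sSup_le ?_ (by positivity)
  rintro x ⟨lam, hl0, hl1, hlb, rfl⟩
  set x := sInf { y | ∃ B ∈ M.powerset, 0 < lam B ∧ y = v B } with hx
  rw [le_div_iff₀ (by norm_num)]
  rcases le_or_gt x 0 with hx0 | hx0
  · linarith
  have hBx : ∀ B ∈ M.powerset, 0 < lam B → x ≤ v B := by
    intro B hB hB0
    refine csInf_le ⟨0, ?_⟩ ⟨B, hB, hB0, rfl⟩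
    rintro y ⟨B', hB', _, rfl⟩
    exact hv0 B' (mem_powerset.1 hB')
  have hch : ∀ B : Finset ι, ∃ j, B ⊆ M → v B = ∑ e ∈ B, a j e := by
    intro B
    by_cases h : B ⊆ M
    · obtain ⟨j, hj⟩ := hatt B h
      exact ⟨j, fun _ => hj⟩
    · exact ⟨0, fun h' => absurd h' h⟩
  choose J hJ using hch
  have hn0 : (0 : ℝ) < n := by exact_mod_cast hn
  set s := M.powerset.filter (fun B => 0 < lam B) with hs
  have hsM : ∀ B ∈ s, B ⊆ M := fun B hB => mem_powerset.1 (mem_filter.1 hB).1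
  have hvx : ∀ B ∈ s, x ≤ v B := fun B hB => hBx B (mem_filter.1 hB).1 (mem_filter.1 hB).2
  obtain ⟨P, hP, hP2⟩ := core_aux (2751 / 10000) (by norm_num) (by norm_num) num_aux
    (fun B => n * lam B) (fun B e => a (J B) e / v B) n s
    (fun B hB => mul_pos hn0 (mem_filter.1 hB).2) (by
      rw [← mul_sum]
      have : ∑ B ∈ s, lam B = 1 := by
        rw [← hl1, hs, sum_filter]
        refine sum_congr rfl fun B hB => ?_
        split_ifs with h
        · rfl
        · exact le_antisymm (hl0 B hB) (not_lt.1 h)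
      rw [this, mul_one])
    (by
      intro e
      rw [← mul_sum]
      have h1 : ∑ B ∈ s with e ∈ B, lam B ≤ 1 / n := by
        by_cases he : e ∈ M
        · refine le_trans (sum_le_sum_of_subset_of_nonneg
            (filter_subset_filter _ (filter_subset _ _)) ?_) (hlb e he)
          exact fun B hB _ => hl0 B (mem_filter.1 hB).1
        · have : s.filter (fun B => e ∈ B) = ∅ := by
            refine filter_eq_empty_iff.2 fun B hB h => he (hsM B hB h)
          rw [this, sum_empty]; positivity
      calc (n : ℝ) * _ ≤ n * (1 / n) := mul_le_mul_of_nonneg_left h1 hn0.le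
        _ = 1 := by field_simp)
    (fun B hB e he => div_nonneg (ha _ e (hsM B hB he)) (hv0 B (hsM B hB)))
    (fun B hB => by
      rw [← sum_div, ← hJ B (hsM B hB)]
      exact div_self (hx0.trans_le (hvx B hB)).ne')
  refine hMMS' P hP ?_ _ ?_
  · intro i
    obtain ⟨B, hB, hPB, _⟩ := hP2 i
    exact hPB.trans (hsM B hB)
  · intro i
    obtain ⟨B, hB, hPB, h⟩ := hP2 i
    have hvB := hvx B hB
    rw [← sum_div, le_div_iff₀ (hx0.trans_le hvB)] at h
    have := hle (P i) (hPB.trans (hsM B hB)) (J B)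
    nlinarith
end

section
/- Let M be a finite set of items, let v be a valuation on M (so v(∅) = 0 and v(S) ≤ v(T) whenever S ⊆ T ⊆ M), let n ≥ 2 be an integer, and let e ∈ M be any item. Then APS(M \ {e}, v, 1/(n−1)) ≥ APS(M, v, 1/n), where on the left v is restricted to subsets of M \ {e}. -/
open Finset

/-- Removing one item and one agent does not decrease the anyprice share:
`APS(M \ {e}, v, 1/(n-1)) ≥ APS(M, v, 1/n)` for any monotone valuation `v` with `v ∅ = 0`,
any `n ≥ 2` and any item `e ∈ M`. -/
theorem APS_erase_ge {ι : Type} [DecidableEq ι] (M : Finset ι) (v : Finset ι → ℝ)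
    (hv0 : v (∅ : Finset ι) = 0)
    (hmono : ∀ S T : Finset ι, S ⊆ T → T ⊆ M → v S ≤ v T)
    (n : ℕ) (hn : 2 ≤ n) (e : ι) (he : e ∈ M) :
    APS M v (1 / (n : ℝ)) ≤ APS (M.erase e) v (1 / ((n : ℝ) - 1)) := by
  have hn' : (2 : ℝ) ≤ n := by exact_mod_cast hn
  have hpow : (M.erase e).powerset = M.powerset.filter (fun B => e ∉ B) := by
    ext B
    simp [Finset.subset_erase]
  have hsub : M.erase e ⊆ M := Finset.erase_subset e M
  have hpos : ∀ (P : Finset (Finset ι)) (lam : Finset ι → ℝ), (∑ B ∈ P, lam B) > 0 →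
      ∃ B ∈ P, 0 < lam B := by
    intro P lam h
    by_contra! hc
    exact absurd (Finset.sum_nonpos hc) (not_le.mpr h)
  have hbdd : ∀ (N : Finset ι) (lam : Finset ι → ℝ), N ⊆ M →
      BddBelow { y | ∃ B ∈ N.powerset, 0 < lam B ∧ y = v B } := by
    intro N lam hN
    refine ⟨0, ?_⟩
    rintro y ⟨B, hB, -, rfl⟩
    rw [← hv0]
    exact hmono _ _ (Finset.empty_subset _) ((Finset.mem_powerset.mp hB).trans hN)
  unfold APS
  apply csSup_le
  · refine ⟨_, fun B => if B = ∅ then 1 else 0, ?_, ?_, ?_, rfl⟩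
    · intro B _
      dsimp only
      split_ifs <;> norm_num
    · simp
    · intro f _
      rw [Finset.sum_eq_zero]
      · positivity
      · intro B hB
        have hf := (Finset.mem_filter.mp hB).2
        rw [if_neg]
        rintro rfl
        simp at hf
  · rintro x ⟨lam, h0, h1, h2, rfl⟩
    set s := ∑ B ∈ (M.erase e).powerset, lam B with hs
    have hsplit : (∑ B ∈ M.powerset.filter (fun B => e ∈ B), lam B) + s = 1 := by
      rw [hs, hpow, Finset.sum_filter_add_sum_filter_not, h1]
    have hse : 1 - 1 / (n : ℝ) ≤ s := by linarith [h2 e he]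
    have hnn : 0 < 1 - 1 / (n : ℝ) := by
      have : 1 / (n : ℝ) ≤ 1 / 2 := one_div_le_one_div_of_le (by norm_num) hn'
      linarith
    have hs0 : 0 < s := lt_of_lt_of_le hnn hse
    have hmem : ∀ B ∈ (M.erase e).powerset, B ∈ M.powerset := fun B hB =>
      Finset.powerset_mono.mpr hsub hB
    have key : sInf { y | ∃ B ∈ M.powerset, 0 < lam B ∧ y = v B } ≤
        sInf { y | ∃ B ∈ (M.erase e).powerset, 0 < lam B / s ∧ y = v B } := by
      apply csInf_le_csInf (hbdd M lam subset_rfl)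
      · obtain ⟨B, hB, hl⟩ := hpos _ _ hs0
        exact ⟨v B, B, hB, div_pos hl hs0, rfl⟩
      · rintro y ⟨B, hB, hl, rfl⟩
        exact ⟨B, hmem B hB, (div_pos_iff_of_pos_right hs0).mp hl, rfl⟩
    refine key.trans (le_csSup ?_ ⟨fun B => lam B / s, ?_, ?_, ?_, rfl⟩)
    · refine ⟨v (M.erase e), ?_⟩
      rintro x ⟨mu, -, g1, -, rfl⟩
      obtain ⟨B, hB, hl⟩ := hpos _ mu (by rw [g1]; norm_num)
      exact (csInf_le (hbdd _ mu hsub) ⟨B, hB, hl, rfl⟩).trans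
        (hmono _ _ (Finset.mem_powerset.mp hB) hsub)
    · intro B hB
      exact div_nonneg (h0 B (hmem B hB)) hs0.le
    · rw [← Finset.sum_div, ← hs, div_self hs0.ne']
    · intro f hf
      rw [← Finset.sum_div]
      have h3 : (∑ B ∈ (M.erase e).powerset.filter (fun B => f ∈ B), lam B) ≤ 1 / (n : ℝ) := by
        refine le_trans ?_ (h2 f (hsub hf))
        apply Finset.sum_le_sum_of_subset_of_nonneg
        · exact Finset.filter_subset_filter _ (Finset.powerset_mono.mpr hsub)
        · intro B hB _
          exact h0 B (Finset.mem_filter.mp hB).1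
      rw [div_le_iff₀ hs0]
      have hn1 : (0 : ℝ) < n - 1 := by linarith
      have hn0 : (0 : ℝ) < n := by linarith
      calc _ ≤ 1 / (n : ℝ) := h3
        _ = 1 / ((n : ℝ) - 1) * (1 - 1 / (n : ℝ)) := by field_simp
        _ ≤ _ := mul_le_mul_of_nonneg_left hse (by positivity)
end

section
/- Let α > 0, let S be a finite set, and let w assign to each e ∈ S a real weight with 0 ≤ w(e) < α, extended additively to subsets of S by w(T) = Σ_{e∈T} w(e). Let t ≥ 2 be an integer with w(S) ≥ (t−1)·α. Then: (i) if t is even, there exist t/2 pairwise disjoint subsets B_1, …, B_{t/2} of S with w(B_k) ≥ α for every k; (ii) if t is odd, there exist t subsets B_1, …, B_t of S with w(B_k) ≥ α for every k, such that every element of S belongs to at most two of the sets B_1, …, B_t. -/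
open Finset

/-- Greedy splitting: a prefix of weight below `α` and one more element reaching `α`. -/
theorem greedy_split {ι : Type} [DecidableEq ι] (α : ℝ) (hα : 0 < α) (w : ι → ℝ)
    (S : Finset ι) (h : α ≤ ∑ e ∈ S, w e) :
    ∃ P : Finset ι, ∃ x : ι, x ∉ P ∧ insert x P ⊆ S ∧ ∑ e ∈ P, w e < α ∧
      α ≤ ∑ e ∈ insert x P, w e := by
  induction S using Finset.induction_on with
  | empty => simp at h; linarith
  | insert a S ha ih =>
    by_cases hS : α ≤ ∑ e ∈ S, w e
    · obtain ⟨P, x, h1, h2, h3, h4⟩ := ih hS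
      exact ⟨P, x, h1, h2.trans (Finset.subset_insert a S), h3, h4⟩
    · exact ⟨S, a, ha, Finset.Subset.refl _, not_le.mp hS, h⟩

theorem even_case {ι : Type} [DecidableEq ι] (α : ℝ) (hα : 0 < α) (w : ι → ℝ) (m : ℕ) :
    ∀ S : Finset ι, (∀ e ∈ S, w e < α) → (2 * (m : ℝ) + 1) * α ≤ ∑ e ∈ S, w e →
    ∃ B : Fin (m + 1) → Finset ι,
      (∀ k, B k ⊆ S) ∧
      (∀ k l, k ≠ l → Disjoint (B k) (B l)) ∧
      ∀ k, α ≤ ∑ e ∈ B k, w e := by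
  induction m with
  | zero =>
    intro S _ h
    refine ⟨fun _ => S, fun _ => Finset.Subset.refl _, ?_, ?_⟩
    · intro k l hkl
      exact absurd (Fin.ext (by omega)) hkl
    · intro _
      simpa using h
  | succ m ih =>
    intro S hS h
    push_cast at h
    have hm : (0 : ℝ) ≤ m * α := by positivity
    obtain ⟨P, x, h1, h2, h3, h4⟩ := greedy_split α hα w S (by nlinarith)
    have hx := hS x (h2 (Finset.mem_insert_self x P))
    have e1 := Finset.sum_insert (f := w) h1
    have e2 := Finset.sum_sdiff (f := w) h2
    obtain ⟨B, b1, b2, b3⟩ := ih (S \ insert x P)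
      (fun e he => hS e (Finset.mem_sdiff.mp he).1) (by nlinarith)
    have hd : ∀ k, Disjoint (B k) (insert x P) := fun k =>
      Finset.disjoint_of_subset_left (b1 k) Finset.sdiff_disjoint
    refine ⟨Fin.cons (insert x P) B, ?_, ?_, ?_⟩
    · intro k
      refine Fin.cases ?_ (fun k => ?_) k
      · simpa using h2
      · simpa using (b1 k).trans Finset.sdiff_subset
    · intro k l
      refine Fin.cases ?_ (fun k => ?_) k <;> refine Fin.cases ?_ (fun l => ?_) l
      · intro h
        exact absurd rfl h
      · intro _
        rw [Fin.cons_zero, Fin.cons_succ]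
        exact (hd l).symm
      · intro _
        rw [Fin.cons_zero, Fin.cons_succ]
        exact hd k
      · intro h
        rw [Fin.cons_succ, Fin.cons_succ]
        exact b2 k l (fun hkl => h (by rw [hkl]))
    · intro k
      refine Fin.cases ?_ (fun k => ?_) k
      · rw [Fin.cons_zero]
        exact h4
      · rw [Fin.cons_succ]
        exact b3 k

theorem odd_case {ι : Type} [DecidableEq ι] (α : ℝ) (hα : 0 < α) (w : ι → ℝ) (m : ℕ) :
    ∀ S : Finset ι, (∀ e ∈ S, w e < α) → (2 * (m : ℝ) + 2) * α ≤ ∑ e ∈ S, w e →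
    ∃ B : Fin (2 * m + 3) → Finset ι,
      (∀ k, B k ⊆ S) ∧
      (∀ k, α ≤ ∑ e ∈ B k, w e) ∧
      ∀ e, (∑ k, if e ∈ B k then 1 else 0) ≤ 2 := by
  induction m with
  | zero =>
    intro S hS h
    norm_num at h
    obtain ⟨P, x, h1, h2, h3, h4⟩ := greedy_split α hα w S (by nlinarith)
    have hx' := h2 (Finset.mem_insert_self x P)
    have hP : P ⊆ S := (Finset.subset_insert x P).trans h2
    have hx := hS x hx'
    have e1 := Finset.sum_sdiff (f := w) hP
    have e2 := Finset.sum_erase_add (f := w) S hx'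
    refine ⟨![insert x P, S \ P, S.erase x], ?_, ?_, ?_⟩
    · intro k
      fin_cases k
      · exact h2
      · exact Finset.sdiff_subset
      · exact Finset.erase_subset x S
    · intro k
      fin_cases k
      · exact h4
      · change α ≤ ∑ e ∈ S \ P, w e
        linarith
      · change α ≤ ∑ e ∈ S.erase x, w e
        linarith
    · intro e
      change (∑ k : Fin 3, if e ∈ (![insert x P, S \ P, S.erase x] : Fin 3 → Finset ι) k
        then 1 else 0) ≤ 2
      rw [Fin.sum_univ_three]
      change (if e ∈ insert x P then 1 else 0) + (if e ∈ S \ P then 1 else 0) +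
        (if e ∈ S.erase x then 1 else 0) ≤ 2
      simp only [Finset.mem_insert, Finset.mem_sdiff, Finset.mem_erase]
      by_cases hex : e = x <;> by_cases heP : e ∈ P <;> by_cases heS : e ∈ S <;>
        simp [hex, heP, heS] <;> grind
  | succ m ih =>
    intro S hS h
    push_cast at h
    have hm : (0 : ℝ) ≤ m * α := by positivity
    obtain ⟨P, x, h1, h2, h3, h4⟩ := greedy_split α hα w S (by nlinarith)
    have hx := hS x (h2 (Finset.mem_insert_self x P))
    have e1 := Finset.sum_insert (f := w) h1
    have e2 := Finset.sum_sdiff (f := w) h2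
    obtain ⟨B, b1, b2, b3⟩ := ih (S \ insert x P)
      (fun e he => hS e (Finset.mem_sdiff.mp he).1) (by nlinarith)
    let C : Fin (2 * m + 3 + 1 + 1) → Finset ι :=
      Fin.cons (insert x P) (Fin.cons (insert x P) B : Fin (2 * m + 3 + 1) → Finset ι)
    have c0 : C 0 = insert x P := rfl
    have c1 : C (Fin.succ 0) = insert x P := rfl
    have c2 : ∀ k : Fin (2 * m + 3), C k.succ.succ = B k := fun k => rfl
    change ∃ B : Fin (2 * m + 3 + 1 + 1) → Finset ι, _
    refine ⟨C, ?_, ?_, ?_⟩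
    · intro k
      refine Fin.cases ?_ (fun k => ?_) k
      · rw [c0]
        exact h2
      · refine Fin.cases ?_ (fun k => ?_) k
        · rw [c1]
          exact h2
        · rw [c2]
          exact (b1 k).trans Finset.sdiff_subset
    · intro k
      refine Fin.cases ?_ (fun k => ?_) k
      · rw [c0]
        exact h4
      · refine Fin.cases ?_ (fun k => ?_) k
        · rw [c1]
          exact h4
        · rw [c2]
          exact b2 k
    · intro e
      rw [Fin.sum_univ_succ, Fin.sum_univ_succ]
      change (if e ∈ insert x P then 1 else 0) + ((if e ∈ insert x P then 1 else 0) +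
        ∑ k, if e ∈ B k then 1 else 0) ≤ 2
      by_cases he : e ∈ insert x P
      · have hz : (∑ k, if e ∈ B k then 1 else 0) = 0 := by
          refine Finset.sum_eq_zero (fun k _ => if_neg (fun hk => ?_))
          exact (Finset.mem_sdiff.mp (b1 k hk)).2 he
        rw [hz, if_pos he]
        norm_num
      · rw [if_neg he]
        have := b3 e
        omega

/-- Partition lemma: if all weights are below `α` and the total weight of `S` is at least
`(t-1)·α` for some `t ≥ 2`, then (i) for even `t` there are `t/2` pairwise disjoint subsets
of `S` of weight at least `α` each, and (ii) for odd `t` there are `t` subsets of `S` of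
weight at least `α` each such that every element of `S` lies in at most two of them. -/
theorem bundles_of_large_weight {ι : Type} [DecidableEq ι] (α : ℝ) (hα : 0 < α)
    (S : Finset ι) (w : ι → ℝ)
    (hw0 : ∀ e ∈ S, 0 ≤ w e) (hwα : ∀ e ∈ S, w e < α)
    (t : ℕ) (ht : 2 ≤ t) (hsum : ((t : ℝ) - 1) * α ≤ ∑ e ∈ S, w e) :
    (Even t → ∃ B : Fin (t / 2) → Finset ι,
      (∀ k, B k ⊆ S) ∧
      (∀ k l, k ≠ l → Disjoint (B k) (B l)) ∧
      ∀ k, α ≤ ∑ e ∈ B k, w e) ∧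
    (Odd t → ∃ B : Fin t → Finset ι,
      (∀ k, B k ⊆ S) ∧
      (∀ k, α ≤ ∑ e ∈ B k, w e) ∧
      ∀ e ∈ S, (Finset.univ.filter (fun k => e ∈ B k)).card ≤ 2) := by
  constructor
  · rintro ⟨r, hr⟩
    obtain ⟨m, rfl⟩ : ∃ m, r = m + 1 := ⟨r - 1, by omega⟩
    have hk : t / 2 = m + 1 := by omega
    rw [hk]
    refine even_case α hα w m S hwα ?_
    have : (t : ℝ) = (m + 1) + (m + 1) := by rw [hr]; push_cast; ring
    rw [this] at hsum
    linarith
  · rintro ⟨r, hr⟩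
    obtain ⟨m, rfl⟩ : ∃ m, r = m + 1 := ⟨r - 1, by omega⟩
    have hk : t = 2 * m + 3 := by omega
    subst hk
    obtain ⟨B, b1, b2, b3⟩ := odd_case α hα w m S hwα (by
      push_cast at hsum
      linarith)
    refine ⟨B, b1, b2, fun e _ => ?_⟩
    rw [Finset.card_filter]
    exact b3 e
end

section
/- Let α and β be real numbers with 0 < α < 1/3, and let w_α, w_{2α}, w_{3α}, w_1 be nonnegative reals satisfying w_α + w_{2α} + w_{3α} + w_1 = 1 and α·w_α + 2α·w_{2α} + 3α·w_{3α} + w_1 ≥ β. Set W = w_{2α} + (3/2)·w_{3α} + 2·w_1. Then: (i) if α ≤ 3/11, then W ≥ 2(β − α)/(1 − α); (ii) if α ≥ 3/11 and β ≥ 3α, then W ≥ (β − 12α + 3)/(2(1 − 3α)); (iii) if α ≥ 3/11 and β < 3α, then W ≥ 3(β − α)/(4α). -/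
/-- Lower bounds on the objective `W = w₂α + (3/2)·w₃α + 2·w₁` of the linear program
with constraints `wα + w₂α + w₃α + w₁ = 1` and
`α·wα + 2α·w₂α + 3α·w₃α + w₁ ≥ β`, in the three regimes of `α` and `β`. -/
theorem LP_lower_bounds (α β wa w2a w3a w1 : ℝ)
    (hα0 : 0 < α) (hα3 : α < 1 / 3)
    (hwa : 0 ≤ wa) (hw2a : 0 ≤ w2a) (hw3a : 0 ≤ w3a) (hw1 : 0 ≤ w1)
    (hsum : wa + w2a + w3a + w1 = 1)
    (hval : β ≤ α * wa + 2 * α * w2a + 3 * α * w3a + w1) :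
    (α ≤ 3 / 11 → 2 * (β - α) / (1 - α) ≤ w2a + (3 / 2) * w3a + 2 * w1) ∧
    (3 / 11 ≤ α → 3 * α ≤ β →
      (β - 12 * α + 3) / (2 * (1 - 3 * α)) ≤ w2a + (3 / 2) * w3a + 2 * w1) ∧
    (3 / 11 ≤ α → β < 3 * α →
      3 * (β - α) / (4 * α) ≤ w2a + (3 / 2) * w3a + 2 * w1) := by
  obtain rfl : wa = 1 - w2a - w3a - w1 := by linarith
  refine ⟨fun h => ?_, fun h hb => ?_, fun h hb => ?_⟩
  · rw [div_le_iff₀ (by linarith)]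
    nlinarith [mul_nonneg hw2a (show 0 ≤ 1 - 3 * α by linarith),
      mul_nonneg hw3a (show 0 ≤ 3 - 11 * α by linarith)]
  · rw [div_le_iff₀ (by linarith)]
    nlinarith [mul_nonneg hwa (show 0 ≤ 11 * α - 3 by linarith),
      mul_nonneg hw2a (show 0 ≤ 4 * α - 1 by linarith)]
  · rw [div_le_iff₀ (by linarith)]
    nlinarith [mul_nonneg hw2a hα0.le,
      mul_nonneg hw1 (show 0 ≤ 11 * α - 3 by linarith)]
end

section
/- Let n ≥ 2 be an integer and M a finite set of items. For each agent i ∈ {1, …, n}, let S_{i,1}, …, S_{i,m_i} be subsets of M with real weights λ_{i,1}, …, λ_{i,m_i} ≥ 0 satisfying Σ_k λ_{i,k} = 1 and, for every e ∈ M, Σ_{k : e ∈ S_{i,k}} λ_{i,k} ≤ 1/n; moreover let a_{i,k} : M → ℝ be nonnegative additive functions vanishing outside S_{i,k} with a_{i,k}(S_{i,k}) = 1. For B ⊆ M and agent j define Δ(B, j) = Σ_k λ_{j,k} · a_{j,k}(B) and Δ_i(B) = Σ_{j ≠ i} Δ(B, j). Then for every real D > 0 and every agent i: Σ_{k : Δ_i(S_{i,k})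 ≤ D} λ_{i,k} ≥ 1 − (n−1)/(D·n). -/
open Finset

open Classical in
/-- The total weight of the bundles of agent `i` whose damage to the other agents is at
most `D` is at least `1 - (n-1)/(D·n)`. -/
theorem weight_of_low_damage_bundles {ι : Type} [DecidableEq ι]
    (n : ℕ) (hn : 2 ≤ n) (M : Finset ι)
    (m : Fin n → ℕ)
    (S : (i : Fin n) → Fin (m i) → Finset ι)
    (lam : (i : Fin n) → Fin (m i) → ℝ)
    (a : (i : Fin n) → Fin (m i) → ι → ℝ)
    (hSM : ∀ i k, S i k ⊆ M)
    (hlam0 : ∀ i k, 0 ≤ lam i k)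
    (hlamsum : ∀ i, ∑ k, lam i k = 1)
    (hfrac : ∀ i, ∀ e ∈ M,
      ∑ k ∈ Finset.univ.filter (fun k => e ∈ S i k), lam i k ≤ 1 / (n : ℝ))
    (ha0 : ∀ i k e, 0 ≤ a i k e)
    (havanish : ∀ i k e, e ∉ S i k → a i k e = 0)
    (hanorm : ∀ i k, ∑ e ∈ S i k, a i k e = 1)
    (D : ℝ) (hD : 0 < D) (i : Fin n) :
    1 - ((n : ℝ) - 1) / (D * n) ≤
      ∑ k ∈ Finset.univ.filter (fun k =>
          (∑ j ∈ Finset.univ.filter (fun j => j ≠ i),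
            ∑ l, lam j l * ∑ e ∈ S i k, a j l e) ≤ D),
        lam i k := by
  have hn0 : (0 : ℝ) < n := by
    have : 0 < n := by omega
    exact_mod_cast this
  -- the average damage caused to a single bundle of another agent
  have key : ∀ j l, ∑ k, lam i k * ∑ e ∈ S i k, a j l e ≤ 1 / (n : ℝ) := by
    intro j l
    have h1 : ∀ k, ∑ e ∈ S i k, a j l e =
        ∑ e ∈ S j l, if e ∈ S i k then a j l e else 0 := by
      intro k
      rw [← Finset.sum_filter, Finset.filter_mem_eq_inter, Finset.inter_comm]
      symm
      apply Finset.sum_subset Finset.inter_subset_left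
      intro e he hne
      apply havanish
      intro h
      exact hne (Finset.mem_inter.2 ⟨he, h⟩)
    calc ∑ k, lam i k * ∑ e ∈ S i k, a j l e
        = ∑ k, ∑ e ∈ S j l, (if e ∈ S i k then lam i k else 0) * a j l e := by
          apply Finset.sum_congr rfl
          intro k _
          rw [h1, Finset.mul_sum]
          apply Finset.sum_congr rfl
          intro e _
          split_ifs <;> simp
      _ = ∑ e ∈ S j l, (∑ k, if e ∈ S i k then lam i k else 0) * a j l e := by
          rw [Finset.sum_comm]
          apply Finset.sum_congr rfl
          intro e _
          rw [Finset.sum_mul]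
      _ ≤ ∑ e ∈ S j l, 1 / (n : ℝ) * a j l e := by
          apply Finset.sum_le_sum
          intro e he
          apply mul_le_mul_of_nonneg_right _ (ha0 j l e)
          have := hfrac i e (hSM j l he)
          rwa [Finset.sum_filter] at this
      _ = 1 / (n : ℝ) := by rw [← Finset.mul_sum, hanorm, mul_one]
  set d : Fin (m i) → ℝ := fun k => ∑ j ∈ Finset.univ.filter (fun j => j ≠ i),
            ∑ l, lam j l * ∑ e ∈ S i k, a j l e with hd
  have hd0 : ∀ k, 0 ≤ d k := fun k =>
    Finset.sum_nonneg fun j _ => Finset.sum_nonneg fun l _ =>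
      mul_nonneg (hlam0 j l) (Finset.sum_nonneg fun e _ => ha0 j l e)
  have havg : ∑ k, lam i k * d k ≤ ((n : ℝ) - 1) / n := by
    calc ∑ k, lam i k * d k
        = ∑ j ∈ Finset.univ.filter (fun j => j ≠ i),
            ∑ l, lam j l * ∑ k, lam i k * ∑ e ∈ S i k, a j l e := by
          simp only [hd, Finset.mul_sum]
          rw [Finset.sum_comm]
          apply Finset.sum_congr rfl
          intro j _
          rw [Finset.sum_comm]
          apply Finset.sum_congr rfl
          intro l _
          apply Finset.sum_congr rfl
          intro k _
          apply Finset.sum_congr rfl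
          intro e _
          ring
      _ ≤ ∑ j ∈ Finset.univ.filter (fun j => j ≠ i), ∑ l, lam j l * (1 / (n : ℝ)) :=
          Finset.sum_le_sum fun j _ => Finset.sum_le_sum fun l _ =>
            mul_le_mul_of_nonneg_left (key j l) (hlam0 j l)
      _ = ((n : ℝ) - 1) / n := by
          simp only [← Finset.sum_mul, hlamsum]
          rw [Finset.filter_ne', Finset.sum_const, Finset.card_erase_of_mem (Finset.mem_univ i),
            Finset.card_univ, Fintype.card_fin, nsmul_eq_mul, Nat.cast_sub (by omega)]
          push_cast
          ring
  have hsplit := Finset.sum_filter_add_sum_filter_not Finset.univ (fun k => d k ≤ D) (lam i)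
  rw [hlamsum] at hsplit
  have hmarkov : D * ∑ k ∈ Finset.univ.filter (fun k => ¬ d k ≤ D), lam i k
      ≤ ((n : ℝ) - 1) / n := by
    refine le_trans ?_ havg
    rw [Finset.mul_sum]
    refine le_trans ?_ (Finset.sum_le_sum_of_subset_of_nonneg
      (Finset.filter_subset (fun k => ¬ d k ≤ D) Finset.univ)
      fun k _ _ => mul_nonneg (hlam0 i k) (hd0 k))
    apply Finset.sum_le_sum
    intro k hk
    rw [mul_comm]
    exact mul_le_mul_of_nonneg_left (not_le.1 (Finset.mem_filter.1 hk).2).le (hlam0 i k)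
  have hfin : ∑ k ∈ Finset.univ.filter (fun k => ¬ d k ≤ D), lam i k
      ≤ ((n : ℝ) - 1) / (D * n) := by
    rw [mul_comm D, ← div_div, le_div_iff₀ hD, mul_comm]
    exact hmarkov
  linarith
end

section
/- Let α and ρ be real numbers with 0 < α ≤ ρ < 1 and let n ≥ 1 be an integer. Define the sequence γ : ℕ → ℝ by γ(1) = 1 and γ(i+1) = (1 − (1−α)/(2(γ(i) − α)·n))·γ(i) for i ≥ 1. If k is an integer with 1 ≤ k ≤ n such that 2(1 − ρ + α·ln ρ)/(1 − α) ≥ 1 + (k − ρk)/n + 2(k − ρk)/(ρk(ρk + 1)) + 2/k, then γ(n) ≥ ρ. -/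
/-- The recursively defined sequence: `γ 1 = 1` and
`γ (i+1) = (1 - (1-α)/(2(γ i - α)·n))·γ i` for `i ≥ 1`. -/
noncomputable def gam (α : ℝ) (n : ℕ) : ℕ → ℝ
  | 0 => 1
  | 1 => 1
  | i + 2 => (1 - (1 - α) / (2 * (gam α n (i + 1) - α) * n)) * gam α n (i + 1)

/-- Tangent-line inequality for the convex function `x - α log x`. -/
theorem tangent_ineq (α x y : ℝ) (hα : 0 < α) (hx : 0 < x) (hy : 0 < y) :
    x - α * Real.log x + (y - x) * ((x - α) / x) ≤ y - α * Real.log y := by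
  have h := Real.log_le_sub_one_of_pos (div_pos hy hx)
  rw [Real.log_div hy.ne' hx.ne'] at h
  have h2 := mul_le_mul_of_nonneg_left h hα.le
  have e : (y - x) * ((x - α) / x) = y - x - α * (y / x - 1) := by
    field_simp
  rw [e]
  linarith

theorem gam_invariant (α ρ : ℝ) (hα : 0 < α) (hαρ : α ≤ ρ) (hρ : ρ < 1)
    (n : ℕ) (hn : 1 ≤ n) (hT : (1 - α) / 2 ≤ 1 - ρ + α * Real.log ρ) (j : ℕ) :
    j + 1 ≤ n → ρ ≤ gam α n (j + 1) ∧
      1 - (1 - α) / 2 / n * j ≤ gam α n (j + 1) - α * Real.log (gam α n (j + 1)) := by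
  have hn0 : (0 : ℝ) < n := by exact_mod_cast hn
  induction j with
  | zero => intro _; simp [gam, hρ.le]
  | succ j ih =>
    intro hj
    obtain ⟨h1, h2⟩ := ih (by omega)
    have hg : gam α n (j + 1 + 1) =
        (1 - (1 - α) / (2 * (gam α n (j + 1) - α) * n)) * gam α n (j + 1) := by
      rw [gam]
    rw [hg]
    generalize gam α n (j + 1) = x at *
    have hρ0 : 0 < ρ := by linarith
    have hx : 0 < x := by linarith
    have hjn : (j : ℝ) + 1 + 1 ≤ n := by exact_mod_cast hj
    obtain ⟨d, hd⟩ : ∃ d, d = (1 - α) / 2 / n := ⟨_, rfl⟩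
    have hd0 : 0 < d := by rw [hd]; apply div_pos _ hn0; linarith
    have hdn : d * n = (1 - α) / 2 := by rw [hd]; field_simp
    rw [← hd] at h2 ⊢
    have h3 := tangent_ineq α x ρ hα hx hρ0
    have h4 : d * (j + 1 + 1) ≤ d * n := mul_le_mul_of_nonneg_left hjn hd0.le
    have h5 : d ≤ (x - ρ) * ((x - α) / x) := by nlinarith
    have hxα : α < x := by
      rcases lt_or_eq_of_le (hαρ.trans h1) with h | h
      · exact h
      · rw [← h] at h5; simp at h5; linarith
    have hxa : 0 < x - α := by linarith
    have e : (1 - (1 - α) / (2 * (x - α) * n)) * x = x - d * (x / (x - α)) := by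
      rw [hd]; field_simp
    rw [e]
    have h6 : d * (x / (x - α)) ≤ x - ρ := by
      have := mul_le_mul_of_nonneg_right h5 (div_pos hx hxa).le
      have e2 : (x - ρ) * ((x - α) / x) * (x / (x - α)) = x - ρ := by field_simp
      linarith
    refine ⟨by linarith, ?_⟩
    have h7 := tangent_ineq α x (x - d * (x / (x - α))) hα hx (by linarith)
    have e3 : (x - d * (x / (x - α)) - x) * ((x - α) / x) = -d := by
      field_simp
      ring
    rw [e3] at h7
    push_cast
    linarith

/-- If `k` with `1 ≤ k ≤ n` satisfies the stated inequality, then `γ(n) ≥ ρ`. -/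
theorem gam_ge_of_ineq (α ρ : ℝ) (hα : 0 < α) (hαρ : α ≤ ρ) (hρ : ρ < 1)
    (n : ℕ) (hn : 1 ≤ n) (k : ℕ) (hk1 : 1 ≤ k) (hkn : k ≤ n)
    (hineq : 1 + ((k : ℝ) - ρ * k) / n
        + 2 * ((k : ℝ) - ρ * k) / (ρ * k * (ρ * k + 1)) + 2 / k
      ≤ 2 * (1 - ρ + α * Real.log ρ) / (1 - α)) :
    ρ ≤ gam α n n := by
  have hn0 : (0 : ℝ) < n := by exact_mod_cast hn
  have hk0 : (0 : ℝ) < k := by exact_mod_cast hk1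
  have hρ0 : 0 < ρ := by linarith
  have hkk : 0 ≤ (k : ℝ) - ρ * k := by nlinarith
  have a1 : 0 ≤ ((k : ℝ) - ρ * k) / n := by positivity
  have a2 : 0 ≤ 2 * ((k : ℝ) - ρ * k) / (ρ * k * (ρ * k + 1)) := by positivity
  have a3 : 0 ≤ 2 / (k : ℝ) := by positivity
  have h1 : 1 ≤ 2 * (1 - ρ + α * Real.log ρ) / (1 - α) := by linarith
  rw [le_div_iff₀ (by linarith)] at h1
  obtain ⟨m, rfl⟩ : ∃ m, n = m + 1 := ⟨n - 1, by omega⟩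
  exact (gam_invariant α ρ hα hαρ hρ (m + 1) hn (by linarith) m le_rfl).1
end

section
/- Let α ∈ [1/4, 3/11) and let ρ be a real number with α < ρ < 1 satisfying 2(1 − ρ + α·ln ρ) = 1 − α. For each integer n ≥ 1 define the sequence γ_n : ℕ → ℝ by γ_n(1) = 1 and γ_n(i+1) = (1 − (1−α)/(2(γ_n(i) − α)·n))·γ_n(i) for i ≥ 1. Then for every constant δ with 0 < δ < ρ − α there exists a natural number n_δ such that γ_n(n) ≥ α + δ for every n ≥ n_δ. -/
lemma gam_step_aux (α ρ c x : ℝ) (hα : 0 < α) (hρ : α < ρ) (hc : 0 < c) (hcs : c ≤ (ρ - α) ^ 2)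
    (hx : ρ ≤ x) (hx1 : x ≤ 1)
    (hF : ρ - α * Real.log ρ ≤ x - α * Real.log x - c) :
    ρ ≤ (1 - c / (x - α)) * x ∧ (1 - c / (x - α)) * x ≤ 1 ∧
      x - α * Real.log x - c ≤
        (1 - c / (x - α)) * x - α * Real.log ((1 - c / (x - α)) * x) := by
  have hxa : 0 < x - α := by linarith
  have hx0 : 0 < x := by linarith
  have hq : 0 < c / (x - α) := div_pos hc hxa
  have hqe : c / (x - α) * (x - α) = c := div_mul_cancel₀ c hxa.ne'
  set q := c / (x - α) with hqdef
  have hqle : q ≤ x - α := by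
    rw [hqdef, div_le_iff₀ hxa]
    nlinarith
  have hq1 : 0 < 1 - q := by linarith
  have hge : α ≤ (1 - q) * x := by nlinarith
  have hpos : 0 < (1 - q) * x := by positivity
  have hlog : Real.log ((1 - q) * x) ≤ -q + Real.log x := by
    rw [Real.log_mul hq1.ne' hx0.ne']
    linarith [Real.log_le_sub_one_of_pos hq1]
  have hT : x - α * Real.log x - c ≤ (1 - q) * x - α * Real.log ((1 - q) * x) := by
    have := mul_le_mul_of_nonneg_left hlog hα.le
    nlinarith
  refine ⟨?_, by nlinarith, hT⟩
  by_contra! hlt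
  set y := (1 - q) * x with hy
  have hρ0 : 0 < ρ := by linarith
  have h1 : Real.log (ρ / y) < ρ / y - 1 :=
    Real.log_lt_sub_one_of_pos (by positivity) (by
      intro h
      rw [div_eq_one_iff_eq hpos.ne'] at h
      linarith)
  rw [Real.log_div hρ0.ne' hpos.ne'] at h1
  have h2 : α * (ρ / y - 1) ≤ ρ - y := by
    have : ρ / y - 1 = (ρ - y) / y := by field_simp
    rw [this, ← mul_div_assoc, div_le_iff₀ hpos]
    nlinarith
  have h3 := mul_lt_mul_of_pos_left h1 hα
  linarith

theorem gam_eventually_ge (α ρ : ℝ)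
    (hα1 : 1 / 4 ≤ α) (hα2 : α < 3 / 11)
    (hρ1 : α < ρ) (hρ2 : ρ < 1)
    (hρeq : 2 * (1 - ρ + α * Real.log ρ) = 1 - α)
    (δ : ℝ) (hδ0 : 0 < δ) (hδ : δ < ρ - α) :
    ∃ nδ : ℕ, ∀ n : ℕ, nδ ≤ n → α + δ ≤ gam α n n := by
  have hd : 0 < (ρ - α) ^ 2 := by
    have : 0 < ρ - α := by linarith
    positivity
  obtain ⟨N, hN⟩ := exists_nat_gt (1 / (ρ - α) ^ 2)
  refine ⟨N, fun n hn => ?_⟩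
  have hnN : (N : ℝ) ≤ n := by exact_mod_cast hn
  have hn1 : 1 / (ρ - α) ^ 2 < n := by linarith
  have hn0 : (0 : ℝ) < n := lt_trans (by positivity) hn1
  rw [div_lt_iff₀ hd] at hn1
  obtain ⟨c, hcdef⟩ : ∃ c, c = (1 - α) / (2 * n) := ⟨_, rfl⟩
  have hc : 0 < c := by
    rw [hcdef]
    exact div_pos (by linarith) (by linarith)
  have hcn : c * n = (1 - α) / 2 := by
    rw [hcdef]
    field_simp
  have hcs : c ≤ (ρ - α) ^ 2 := by
    rw [hcdef, div_le_iff₀ (by linarith)]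
    nlinarith
  have key : ∀ i : ℕ, i + 1 ≤ n → ρ ≤ gam α n (i + 1) ∧ gam α n (i + 1) ≤ 1 ∧
      1 - i * c ≤ gam α n (i + 1) - α * Real.log (gam α n (i + 1)) := by
    intro i
    induction i with
    | zero =>
      intro _
      simp [gam, hρ2.le]
    | succ i ih =>
      intro hi
      obtain ⟨h1, h2, h3⟩ := ih (by omega)
      have hi' : (i : ℝ) + 1 ≤ n := by
        have : i + 1 ≤ n := by omega
        exact_mod_cast this
      have hm := mul_le_mul_of_nonneg_right hi' hc.le
      have hs := gam_step_aux α ρ c (gam α n (i + 1)) (by linarith) hρ1 hc hcs h1 h2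
        (by nlinarith)
      have he : gam α n (i + 1 + 1) =
          (1 - c / (gam α n (i + 1) - α)) * gam α n (i + 1) := by
        rw [gam, hcdef, div_div]
        congr 3
        ring
      rw [he]
      refine ⟨hs.1, hs.2.1, ?_⟩
      push_cast
      linarith [hs.2.2]
  have hnpos : 0 < n := by exact_mod_cast hn0
  obtain ⟨m, rfl⟩ : ∃ m, n = m + 1 := ⟨n - 1, by omega⟩
  have := (key m le_rfl).1
  linarith
end

section
/- Let α ∈ [1/4, 3/11). For each integer n ≥ 1 define the sequence γ_n : ℕ → ℝ by γ_n(1) = 1 and γ_n(i+1) = (1 − (1−α)/(2(γ_n(i) − α)·n))·γ_n(i) for i ≥ 1. Then γ_n(n) ≥ α for every integer n ≥ 11. -/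
/-- One step: the potential `g - α log g` drops by at most `h`, and `g` stays above `α`. -/
lemma gam_step (α h g : ℝ) (ha1 : 1 / 4 ≤ α) (ha2 : α < 3 / 11) (hh : 0 < h) (hh2 : h < 1 / 20)
    (hg : α ≤ g) (hf : (1 + α) / 2 + 2 * h ≤ g - α * Real.log g) :
    α < g ∧ α ≤ (1 - h / (g - α)) * g ∧
      g - α * Real.log g - h ≤ (1 - h / (g - α)) * g - α * Real.log ((1 - h / (g - α)) * g) := by
  have ha0 : 0 < α := by linarith
  have hg0 : 0 < g := by linarith
  have hs : 0 ≤ (1 - α) / 2 + α * Real.log α := by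
    have h1 : Real.log (1 / (4 * α)) ≤ 1 / (4 * α) - 1 := Real.log_le_sub_one_of_pos (by positivity)
    have h2 : Real.log (1 / (4 * α)) = -(2 * Real.log 2) - Real.log α := by
      rw [one_div, Real.log_inv, Real.log_mul (by norm_num) ha0.ne',
        show (4 : ℝ) = 2 ^ 2 by norm_num, Real.log_pow]
      push_cast; ring
    have h3 := Real.log_two_lt_d9
    have h4 : α * (-(2 * Real.log 2) - Real.log α) ≤ α * (1 / (4 * α) - 1) := by
      rw [← h2]; exact mul_le_mul_of_nonneg_left h1 ha0.le
    have h5 : α * (1 / (4 * α) - 1) = 1 / 4 - α := by field_simp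
    have h6 : α * Real.log 2 ≤ α * 0.6931471808 := mul_le_mul_of_nonneg_left h3.le ha0.le
    rw [h5] at h4
    nlinarith
  obtain ⟨d, rfl⟩ : ∃ d, g = α + d := ⟨g - α, by ring⟩
  have hd : 0 ≤ d := by linarith
  have hlog : 2 * (d / α) / (d / α + 2) ≤ Real.log (1 + d / α) :=
    Real.le_log_one_add_of_nonneg (by positivity)
  have e1 : Real.log (α + d) = Real.log α + Real.log (1 + d / α) := by
    rw [← Real.log_mul ha0.ne' (by positivity)]; congr 1; field_simp
  have hd2 : 4 * α * h ≤ d ^ 2 := by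
    have h1 : α * (2 * (d / α) / (d / α + 2)) ≤ α * Real.log (1 + d / α) :=
      mul_le_mul_of_nonneg_left hlog ha0.le
    have h2 : d - d ^ 2 / (2 * α) ≤ α * (2 * (d / α) / (d / α + 2)) := by
      have : α * (2 * (d / α) / (d / α + 2)) - (d - d ^ 2 / (2 * α))
          = d ^ 3 / (2 * α * (d + 2 * α)) := by field_simp; ring
      have : 0 ≤ d ^ 3 / (2 * α * (d + 2 * α)) := by positivity
      linarith
    rw [e1] at hf
    have h3 : 2 * h ≤ d ^ 2 / (2 * α) := by nlinarith
    rw [le_div_iff₀ (by positivity)] at h3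
    linarith
  have hdp : 0 < d := by
    rcases hd.eq_or_lt with h0 | h0
    · rw [← h0] at hd2; nlinarith [mul_pos ha0 hh]
    · exact h0
  have key : h * (α + d) ≤ d ^ 2 := by
    by_cases hc : d ≤ 3 * α
    · nlinarith
    · push Not at hc
      nlinarith
  have e2 : α + d - α = d := by ring
  rw [e2]
  have hstep : α ≤ (1 - h / d) * (α + d) := by
    have : (1 - h / d) * (α + d) - α = (d ^ 2 - h * (α + d)) / d := by field_simp; ring
    have : 0 ≤ (d ^ 2 - h * (α + d)) / d := div_nonneg (by linarith) hd
    linarith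
  have hx : 0 < 1 - h / d := by
    by_contra hc
    push Not at hc
    nlinarith
  refine ⟨by linarith, hstep, ?_⟩
  rw [Real.log_mul hx.ne' hg0.ne']
  have h1 := Real.log_le_sub_one_of_pos hx
  have h2 : α * Real.log (1 - h / d) ≤ α * (1 - h / d - 1) := mul_le_mul_of_nonneg_left h1 ha0.le
  have h3 : h / d * d = h := by field_simp
  nlinarith

/-- The recursively defined invariant along the whole sequence. -/
lemma gam_inv (α : ℝ) (hα1 : 1 / 4 ≤ α) (hα2 : α < 3 / 11)
    (n : ℕ) (hn : 11 ≤ n) (i : ℕ) (hi : i + 1 ≤ n) :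
    α ≤ gam α n (i + 1) ∧
      1 - i * ((1 - α) / (2 * n)) ≤ gam α n (i + 1) - α * Real.log (gam α n (i + 1)) := by
  have hn' : (11 : ℝ) ≤ n := by exact_mod_cast hn
  induction i with
  | zero => simp [gam]; linarith
  | succ i ih =>
    obtain ⟨h1, h2⟩ := ih (by omega)
    have hi' : (i : ℝ) + 2 ≤ n := by exact_mod_cast hi
    have hpos : 0 < (1 - α) / (2 * n) := div_pos (by linarith) (by linarith)
    have hlt : (1 - α) / (2 * n) < 1 / 20 := by
      rw [div_lt_div_iff₀ (by linarith) (by norm_num)]; linarith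
    have hmul : n * ((1 - α) / (2 * n)) = (1 - α) / 2 := by field_simp
    have hrec : gam α n (i + 1 + 1)
        = (1 - (1 - α) / (2 * n) / (gam α n (i + 1) - α)) * gam α n (i + 1) := by
      rw [gam, div_div]; congr 3; ring
    obtain ⟨-, s1, s2⟩ := gam_step α ((1 - α) / (2 * n)) (gam α n (i + 1)) hα1 hα2 hpos hlt h1
      (by nlinarith)
    rw [hrec]
    refine ⟨s1, ?_⟩
    push_cast
    linarith

/-- For `α ∈ [1/4, 3/11)`, the sequence satisfies `γ_n(n) ≥ α` for every `n ≥ 11`. -/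
theorem gam_ge_alpha (α : ℝ) (hα1 : 1 / 4 ≤ α) (hα2 : α < 3 / 11)
    (n : ℕ) (hn : 11 ≤ n) :
    α ≤ gam α n n := by
  have h := (gam_inv α hα1 hα2 n hn (n - 1) (by omega)).1
  rwa [Nat.sub_add_cancel (by omega)] at h
end
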